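/- arXiv:2507.08221 — 2 statements merged into one kernel-verified Lean document; each statement's English description precedes it below -/
import Mathlib

section
/- Let L/K satisfy condition (ram) with parameter n ≥ 1, G^1 cyclic with generator γ, and K unramified over ℚ_p. Let T be the k-linear operator on V := O_L/M_1 induced by γ, where M_1 := O_L·m_1 = m_L^{p^n}, and put N = T − 1. Then for every α ∈ O_K + X, where X = {x ∈ m_L : v_L(x) < p}, one has N^{p^{n−1}−1}·α ≠ 0 and N^{p^{n−1}}·α = 0 in V. -/
noncomputable section

open scoped Classical

/-- An additive `ℚ ∪ {∞}`-valued valuation on a field `A`, normalized by `v p = 1`.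
This models the `p`-adic valuation `v_p` on (an algebraic closure of) `ℚ_p`,
with the convention `v 0 = ∞`. -/
structure PadicValData (A : Type) [Field A] (p : ℕ) : Type where
  v : A → WithTop ℚ
  v_top_iff : ∀ x : A, v x = ⊤ ↔ x = 0
  v_mul : ∀ x y : A, v (x * y) = v x + v y
  v_min_le_add : ∀ x y : A, min (v x) (v y) ≤ v (x + y)
  v_coe_p : v (p : A) = 1

variable {p : ℕ} {A : Type} [Field A]

/-- `x ∈ F` is a uniformizer of the `p`-adic field `F` (embedded in `A` by `emb`):
its valuation is minimal among the positive valuations of elements of `F`. -/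
def IsUniformizer (vd : PadicValData A p) {F : Type} [Field F] (emb : F →+* A) (x : F) : Prop :=
  x ≠ 0 ∧ 0 < vd.v (emb x) ∧
    ∀ y : F, 0 < vd.v (emb y) → vd.v (emb x) ≤ vd.v (emb y)

/-- `y` belongs to the `j`-th power `m_F^j` of the maximal ideal of the ring of integers
`O_F` of `F` (embedded in `A` by `emb`): `y` is a multiple, by an element of `O_F`, of a
product of `j` elements of the maximal ideal `m_F`.  (For `j = 0` this says `y ∈ O_F`.) -/
def InMaxIdealPow (vd : PadicValData A p) {F : Type} [Field F] (emb : F →+* A) (j : ℕ)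
    (y : A) : Prop :=
  ∃ (u : F) (s : Fin j → F), 0 ≤ vd.v (emb u) ∧ (∀ k, 0 < vd.v (emb (s k))) ∧
    y = emb u * ∏ k, emb (s k)

/-- The lower-numbering ramification set
`G_i = {σ ∈ Gal(L/K) | ∀ x ∈ O_L, σ x - x ∈ m_L^{i+1}}` (with `G_i = G` for `i ≤ -1`). -/
def lowerRamSet (vd : PadicValData A p) (K L : Type) [Field K] [Field L] [Algebra K L]
    (emb : L →+* A) (i : ℤ) : Set (L ≃ₐ[K] L) :=
  {σ | ∀ x : L, 0 ≤ vd.v (emb x) →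
    InMaxIdealPow vd emb (i + 1).toNat (emb (σ x) - emb x)}

/-- The Herbrand function `φ_{L/K}(u) = ∫_0^u dt / (G_0 : G_t)`, where `G_t = G_{⌈t⌉}`. -/
noncomputable def herbrandPhi (vd : PadicValData A p) (K L : Type) [Field K] [Field L]
    [Algebra K L] (emb : L →+* A) (u : ℝ) : ℝ :=
  ∫ t in (0:ℝ)..u,
    (Nat.card ↥(lowerRamSet vd K L emb ⌈t⌉) : ℝ) /
      (Nat.card ↥(lowerRamSet vd K L emb 0) : ℝ)

/-- The Herbrand function `ψ_{L/K}`, the inverse of `φ_{L/K}`. -/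
noncomputable def herbrandPsi (vd : PadicValData A p) (K L : Type) [Field K] [Field L]
    [Algebra K L] (emb : L →+* A) (w : ℝ) : ℝ :=
  Function.invFun (herbrandPhi vd K L emb) w

/-- The upper-numbering ramification set `G^i = G_{ψ_{L/K}(i)}` of `Gal(L/K)`. -/
def upperRamSet (vd : PadicValData A p) (K L : Type) [Field K] [Field L] [Algebra K L]
    (emb : L →+* A) (i : ℤ) : Set (L ≃ₐ[K] L) :=
  lowerRamSet vd K L emb ⌈herbrandPsi vd K L emb (i : ℝ)⌉

/-- Condition (ram): the upper ramification groups of `L/K` satisfy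
`G = G^{-1} = G^0 ⊇ G^1 ⊋ G^2 ⊋ ⋯ ⊋ G^n ⊋ G^{n+1} = {1}`, with `G^i/G^{i+1}` of order `p`
for `1 ≤ i ≤ n` and `G^0/G^1` of order `p - 1`. -/
def RamCond (vd : PadicValData A p) (K L : Type) [Field K] [Field L] [Algebra K L]
    (emb : L →+* A) (n : ℕ) : Prop :=
  upperRamSet vd K L emb (-1) = Set.univ ∧
  upperRamSet vd K L emb 0 = Set.univ ∧
  (∀ i : ℤ, upperRamSet vd K L emb (i + 1) ⊆ upperRamSet vd K L emb i) ∧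
  Nat.card ↥(upperRamSet vd K L emb 0)
    = (p - 1) * Nat.card ↥(upperRamSet vd K L emb 1) ∧
  (∀ i : ℕ, 1 ≤ i → i ≤ n →
    Nat.card ↥(upperRamSet vd K L emb (i : ℤ))
      = p * Nat.card ↥(upperRamSet vd K L emb ((i : ℤ) + 1))) ∧
  upperRamSet vd K L emb ((n : ℤ) + 1) = {1}

/-- The local resolvent `⟨α|χ⟩ = ∑_{γ ∈ Gal(L/K)} χ(γ) γ(α)`, computed in `A`. -/
noncomputable def localResolvent (K L : Type) [Field K] [Field L] [Algebra K L]
    (emb : L →+* A) (χ : (L ≃ₐ[K] L) → A) (α : L) : A :=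
  ∑ᶠ γ : L ≃ₐ[K] L, χ γ * emb (γ α)

end


section AbstractRam

set_option linter.unusedSectionVars false
set_option linter.unusedVariables false

variable {R G : Type} [CommRing R] [IsDomain R] [Group G] [MulSemiringAction G R]

def Rm (ϖ : R) (i : ℕ) (σ : G) : Prop := ∀ x : R, ϖ ^ (i + 1) ∣ σ • x - x

theorem Rm.mono {ϖ : R} {i j : ℕ} {σ : G} (h : Rm ϖ i σ) (hij : j ≤ i) : Rm ϖ j σ :=
  fun x => (pow_dvd_pow ϖ (by omega)).trans (h x)

theorem Rm.dvd_smul {ϖ : R} {i : ℕ} {σ : G} (h : Rm ϖ i σ) : ϖ ∣ σ • ϖ := by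
  have h1 : ϖ ∣ σ • ϖ - ϖ := (dvd_pow_self ϖ (by omega)).trans (h ϖ)
  have := dvd_add h1 (dvd_refl ϖ)
  simpa using this

theorem Rm.dvd_smul_pow {ϖ : R} {i : ℕ} {σ : G} (h : Rm ϖ i σ) {m : ℕ} {z : R}
    (hz : ϖ ^ m ∣ z) : ϖ ^ m ∣ σ • z := by
  obtain ⟨u, rfl⟩ := hz
  rw [smul_mul', smul_pow']
  exact (pow_dvd_pow_of_dvd h.dvd_smul m).mul_right _

theorem Rm.pow_diff {ϖ : R} {i : ℕ} {σ : G} (h : Rm ϖ i σ) (m : ℕ) :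
    ϖ ^ (m + i) ∣ σ • (ϖ ^ m) - ϖ ^ m := by
  induction m with
  | zero => simp
  | succ m ih =>
    have e : σ • (ϖ ^ (m+1)) - ϖ ^ (m+1)
        = (σ • ϖ) * (σ • (ϖ ^ m) - ϖ ^ m) + ϖ ^ m * (σ • ϖ - ϖ) := by
      rw [pow_succ, smul_mul']; ring
    rw [e]
    refine dvd_add ?_ ?_
    · rw [show m + 1 + i = 1 + (m + i) by ring, pow_add, pow_one]
      exact mul_dvd_mul h.dvd_smul ih
    · rw [show m + 1 + i = m + (i + 1) by ring, pow_add]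
      exact mul_dvd_mul (dvd_refl _) (h ϖ)

theorem Rm.raise {ϖ : R} {i : ℕ} {σ : G} (h : Rm ϖ i σ) {m : ℕ} {z : R}
    (hz : ϖ ^ m ∣ z) : ϖ ^ (m + i) ∣ σ • z - z := by
  obtain ⟨u, rfl⟩ := hz
  have e : σ • (ϖ ^ m * u) - ϖ ^ m * u
      = (σ • (ϖ ^ m)) * (σ • u - u) + (σ • (ϖ ^ m) - ϖ ^ m) * u := by
    rw [smul_mul']; ring
  rw [e]
  refine dvd_add ?_ ((h.pow_diff m).mul_right _)
  have := mul_dvd_mul (h.dvd_smul_pow (dvd_refl (ϖ ^ m))) (h u)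
  rw [← pow_add] at this
  exact (pow_dvd_pow ϖ (by omega)).trans this

theorem Rm.mul {ϖ : R} {i : ℕ} {σ τ : G} (h : Rm ϖ i σ) (h' : Rm ϖ i τ) : Rm ϖ i (σ * τ) := by
  intro x
  have e : (σ * τ) • x - x = σ • (τ • x - x) + (σ • x - x) := by
    rw [mul_smul, smul_sub]; ring
  rw [e]
  exact dvd_add (h.dvd_smul_pow (h' x)) (h x)

theorem Rm.inv {ϖ : R} {i : ℕ} {σ : G} (h : Rm ϖ i σ) : Rm ϖ i σ⁻¹ := by
  intro x
  have := h (σ⁻¹ • x)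
  rw [smul_inv_smul] at this
  rw [← neg_sub]
  exact (dvd_neg).2 this

def Rsub (G : Type) [Group G] [MulSemiringAction G R] (ϖ : R) (i : ℕ) : Subgroup G where
  carrier := {σ | Rm ϖ i σ}
  mul_mem' := fun h h' => Rm.mul h h'
  one_mem' := fun x => by simp
  inv_mem' := fun h => Rm.inv h

/-- the operator `σ - 1`. -/
def NN (σ : G) : Module.End ℤ R :=
  (DistribSMul.toAddMonoidHom R σ).toIntLinearMap - 1

def TT (σ : G) : Module.End ℤ R := (DistribSMul.toAddMonoidHom R σ).toIntLinearMap

theorem TT_pow (σ : G) (m : ℕ) (x : R) : (TT σ ^ m) x = σ ^ m • x := by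
  induction m with
  | zero => simp
  | succ m ih =>
    rw [pow_succ', Module.End.mul_apply, ih, pow_succ', mul_smul]
    rfl

theorem NN_apply (σ : G) (x : R) : NN σ x = σ • x - x := rfl

theorem TT_eq (σ : G) : (TT σ : Module.End ℤ R) = NN σ + 1 := by
  simp [NN, TT]

theorem Rm.NN_pow {ϖ : R} {i : ℕ} {σ : G} (h : Rm ϖ i σ) {m : ℕ} {z : R}
    (hz : ϖ ^ m ∣ z) (k : ℕ) : ϖ ^ (m + k * i) ∣ (NN σ ^ k) z := by
  induction k with
  | zero => simpa using hz
  | succ k ih =>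
    rw [pow_succ', Module.End.mul_apply, NN_apply]
    have := h.raise ih
    rwa [show m + (k+1) * i = m + k * i + i by ring]

/-- binomial expansion -/
theorem smul_pow_expand (σ : G) (m : ℕ) (z : R) :
    σ ^ m • z = ∑ j ∈ Finset.range (m + 1), (m.choose j : R) * (NN σ ^ j) z := by
  rw [← TT_pow, TT_eq, (Commute.one_right (NN σ)).add_pow]
  simp only [LinearMap.sum_apply, one_pow, mul_one]
  refine Finset.sum_congr rfl fun j _ => ?_
  rw [(Nat.cast_commute _ _).symm.eq, Module.End.mul_apply]
  rw [← nsmul_eq_mul]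
  simp

theorem NN_pow_expand (σ : G) (m : ℕ) (z : R) :
    (NN σ ^ m) z = ∑ j ∈ Finset.range (m + 1),
      (((-1 : ℤ) ^ (m - j) * (m.choose j) : ℤ) : R) * (σ ^ j • z) := by
  have : (NN σ : Module.End ℤ R) = TT σ + (-1) := by simp [NN, TT, sub_eq_add_neg]
  rw [this, ((Commute.one_right (TT σ)).neg_right).add_pow]
  simp only [LinearMap.sum_apply]
  refine Finset.sum_congr rfl fun j _ => ?_
  rw [← TT_pow]
  have e : (TT σ ^ j * (-1) ^ (m - j) * ((m.choose j : ℕ) : Module.End ℤ R))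
      = ((-1 : ℤ) ^ (m - j) * (m.choose j) : ℤ) • (TT σ ^ j : Module.End ℤ R) := by
    rw [zsmul_eq_mul, mul_assoc]
    push_cast
    exact (((Commute.one_right _).neg_right.pow_right _).mul_right (Nat.cast_commute _ _).symm).eq
  rw [e, LinearMap.smul_apply, zsmul_eq_mul]

theorem split2 (σ : G) (m : ℕ) (hm : 2 ≤ m) (z : R) :
    σ ^ m • z - z = (NN σ ^ m) z + (m : R) * NN σ z +
      ∑ j ∈ Finset.Ico 2 m, (m.choose j : R) * (NN σ ^ j) z := by
  rw [smul_pow_expand, Finset.sum_range_succ, Finset.range_eq_Ico,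
    Finset.sum_eq_sum_Ico_succ_bot (by omega), Finset.sum_eq_sum_Ico_succ_bot (by omega)]
  simp
  ring

/-- criterion -/
theorem Rm.crit {p : ℕ} (hp2 : 2 ≤ p) {ϖ : R} (hpϖ : ϖ ∣ (p : R))
    (hperf : ∀ z : R, ∃ u, ϖ ∣ z - u ^ p) {i : ℕ} {σ : G} (h : Rm ϖ i σ)
    (h1 : ϖ ^ (i + 2) ∣ σ • ϖ - ϖ) : Rm ϖ (i + 1) σ := by
  intro z
  obtain ⟨u, y, hy⟩ := hperf z
  obtain ⟨d, hd⟩ := h u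
  have hz : z = u ^ p + ϖ * y := by rw [← hy]; ring
  have e : σ • z - z = ((u + ϖ ^ (i+1) * d) ^ p - u ^ p) +
      ((σ • ϖ - ϖ) * (σ • y) + ϖ * (σ • y - y)) := by
    rw [hz, smul_add, smul_mul', smul_pow', ← hd]; ring
  rw [e]
  refine dvd_add ?_ (dvd_add (h1.mul_right _) ?_)
  · obtain ⟨c, hc⟩ := Polynomial.powAddExpansion u (ϖ ^ (i+1) * d) p
    rw [hc]
    obtain ⟨q, hq⟩ := hpϖ
    refine ⟨u ^ (p-1) * q * d + c * ϖ ^ i * d ^ 2, ?_⟩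
    rw [hq]; ring
  · rw [show i + 1 + 1 = 1 + (i + 1) by ring, pow_add, pow_one]
    exact mul_dvd_mul (dvd_refl _) (h y)

theorem Rm.crit' {p : ℕ} (hp2 : 2 ≤ p) {ϖ : R} (hpϖ : ϖ ∣ (p : R))
    (hperf : ∀ z : R, ∃ u, ϖ ∣ z - u ^ p) {i : ℕ} {σ : G} (h : Rm ϖ 0 σ)
    (h1 : ϖ ^ (i + 1) ∣ σ • ϖ - ϖ) : Rm ϖ i σ := by
  induction i with
  | zero => exact h
  | succ i ih => exact Rm.crit hp2 hpϖ hperf (ih ((pow_dvd_pow _ (by omega)).trans h1)) h1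

theorem not_dvd_cast {p : ℕ} (hp : p.Prime) {ϖ : R} (hϖ : Prime ϖ) (hpϖ : ϖ ∣ (p : R))
    {m : ℕ} (hm : ¬ p ∣ m) : ¬ ϖ ∣ (m : R) := by
  intro h
  have hc : IsCoprime (p : ℤ) (m : ℤ) := Nat.isCoprime_iff_coprime.2 ((hp.coprime_iff_not_dvd).2 hm)
  obtain ⟨a, b, hab⟩ := hc
  have := congrArg (Int.cast : ℤ → R) hab
  push_cast at this
  apply hϖ.not_isUnit
  rw [isUnit_iff_dvd_one, ← this]
  exact dvd_add (hpϖ.mul_left _) (h.mul_left _)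

theorem cancel_pow {ϖ : R} (hϖ : Prime ϖ) {m k : ℕ} {u : R} (h : ϖ ^ (m + k) ∣ ϖ ^ m * u) :
    ϖ ^ k ∣ u := by
  rw [pow_add] at h
  exact (mul_dvd_mul_iff_left (pow_ne_zero _ hϖ.ne_zero)).1 h

theorem not_dvd_mul_pow {ϖ : R} (hϖ : Prime ϖ) {a b : ℕ} {x y : R} (hx : ϖ ^ a ∣ x)
    (hx' : ¬ ϖ ^ (a + 1) ∣ x) (hy : ϖ ^ b ∣ y) (hy' : ¬ ϖ ^ (b + 1) ∣ y) :
    ¬ ϖ ^ (a + b + 1) ∣ x * y := by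
  obtain ⟨u, rfl⟩ := hx
  obtain ⟨w, rfl⟩ := hy
  intro h
  rw [show ϖ ^ a * u * (ϖ ^ b * w) = ϖ ^ (a + b) * (u * w) by ring] at h
  have := cancel_pow hϖ h
  rw [pow_one] at this
  rcases hϖ.dvd_or_dvd this with h | h
  · exact hx' (by rw [pow_add, pow_one]; exact mul_dvd_mul_left _ h)
  · exact hy' (by rw [pow_add, pow_one]; exact mul_dvd_mul_left _ h)

/-- exactness -/
theorem Rm.exact_raise {p : ℕ} (hp : p.Prime) {ϖ : R} (hϖ : Prime ϖ) (hpϖ : ϖ ∣ (p : R))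
    {b : ℕ} (hb : 1 ≤ b) {σ : G} (h : Rm ϖ b σ) (h' : ¬ ϖ ^ (b + 2) ∣ σ • ϖ - ϖ)
    {m : ℕ} (hm1 : 1 ≤ m) (hm : ¬ p ∣ m) {u : R} (hu : ¬ ϖ ∣ u) :
    ¬ ϖ ^ (m + b + 1) ∣ σ • (ϖ ^ m * u) - ϖ ^ m * u := by
  obtain ⟨g, hg⟩ := h ϖ
  have hg' : ¬ ϖ ∣ g := fun hh => h' (by
    rw [hg, show b + 2 = (b + 1) + 1 by ring, pow_succ ϖ (b+1)]; exact mul_dvd_mul_left _ hh)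
  obtain ⟨c, hc⟩ := Polynomial.powAddExpansion (1 : R) (ϖ ^ b * g) m
  obtain ⟨d, hd⟩ := h u
  have e1 : σ • ϖ = ϖ * (1 + ϖ ^ b * g) := by
    rw [← sub_add_cancel (σ • ϖ) ϖ, hg]; ring
  have e2 : σ • u = u + ϖ ^ (b + 1) * d := by rw [← hd]; ring
  obtain ⟨b', rfl⟩ : ∃ b', b = b' + 1 := ⟨b - 1, by omega⟩
  intro hdvd
  have e3 : σ • (ϖ ^ m * u) - ϖ ^ m * u = ϖ ^ (m + (b'+1)) * (m * g * u +
      ϖ * (c * ϖ ^ b' * g ^ 2 * u + (1 + ϖ ^ (b'+1) * g) ^ m * d)) := by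
    rw [smul_mul', smul_pow', e1, e2, mul_pow, mul_add, mul_assoc (ϖ ^ m) _ u]
    have : (1 + ϖ ^ (b'+1) * g) ^ m * u = u + m * (ϖ ^ (b'+1) * g) * u
      + c * (ϖ ^ (b'+1) * g)^2 * u := by rw [hc]; simp; ring
    rw [this]; ring
  rw [e3] at hdvd
  have := cancel_pow hϖ hdvd
  rw [pow_one] at this
  have h3 := (dvd_add_left (dvd_mul_right ϖ _)).1 this
  rcases hϖ.dvd_or_dvd h3 with h | h
  · rcases hϖ.dvd_or_dvd h with h | h
    · exact not_dvd_cast hp hϖ hpϖ hm h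
    · exact hg' h
  · exact hu h

theorem exists_break {ϖ : R} [FaithfulSMul G R]
    (hsep : ∀ z : R, (∀ j : ℕ, ϖ ^ j ∣ z) → z = 0) {σ : G} (h1 : σ ≠ 1) {i : ℕ}
    (h : Rm ϖ i σ) : ∃ b, i ≤ b ∧ Rm ϖ b σ ∧ ¬ Rm ϖ (b + 1) σ := by
  by_contra hcon
  push Not at hcon
  have hall : ∀ k, Rm ϖ (i + k) σ := by
    intro k
    induction k with
    | zero => exact h
    | succ k ih => exact hcon (i + k) (by omega) ih
  apply h1
  apply FaithfulSMul.eq_of_smul_eq_smul (α := R)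
  intro a
  rw [one_smul]
  refine sub_eq_zero.1 (hsep _ fun j => ?_)
  exact (pow_dvd_pow _ (by omega)).trans (hall j a)

theorem not_crit {p : ℕ} (hp2 : 2 ≤ p) {ϖ : R} (hpϖ : ϖ ∣ (p : R))
    (hperf : ∀ z : R, ∃ u, ϖ ∣ z - u ^ p) {b : ℕ} {σ : G}
    (h : Rm ϖ b σ) (h' : ¬ Rm ϖ (b + 1) σ) : ¬ ϖ ^ (b + 2) ∣ σ • ϖ - ϖ :=
  fun hh => h' (Rm.crit hp2 hpϖ hperf h hh)

/-- prime-to-p torsion in wild inertia is trivial -/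
theorem wild_torsion {p : ℕ} (hp : p.Prime) {ϖ : R} (hϖ : Prime ϖ) (hpϖ : ϖ ∣ (p : R))
    (hperf : ∀ z : R, ∃ u, ϖ ∣ z - u ^ p) [FaithfulSMul G R]
    (hsep : ∀ z : R, (∀ j : ℕ, ϖ ^ j ∣ z) → z = 0) {σ : G} (h : Rm ϖ 1 σ)
    {m : ℕ} (hm : ¬ p ∣ m) (hσ : σ ^ m = 1) : σ = 1 := by
  by_contra h1
  obtain ⟨b, hb, hR, hR'⟩ := exists_break hsep h1 h
  have hnc := not_crit hp.two_le hpϖ hperf hR hR'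
  have hm0 : m ≠ 0 := by rintro rfl; simp at hm
  have hm1 : m ≠ 1 := by rintro rfl; simp at hσ; exact h1 hσ
  have hs := split2 σ m (by omega) ϖ
  rw [hσ, one_smul, sub_self] at hs
  have hϖ1 : ϖ ^ 1 ∣ ϖ := by simp
  have key : ∀ j, 2 ≤ j → ϖ ^ (b + 2) ∣ (NN σ ^ j) ϖ := fun j hj =>
    (pow_dvd_pow ϖ (by nlinarith)).trans (hR.NN_pow hϖ1 j)
  have hd : ϖ ^ (b + 2) ∣ (m : R) * NN σ ϖ := by
    have : (m : R) * NN σ ϖ = -((NN σ ^ m) ϖ +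
        ∑ j ∈ Finset.Ico 2 m, (m.choose j : R) * (NN σ ^ j) ϖ) := by
      linear_combination -hs
    rw [this, dvd_neg]
    refine dvd_add (key m (by omega)) (Finset.dvd_sum fun j hj => ?_)
    exact (key j (Finset.mem_Ico.1 hj).1).mul_left _
  have := not_dvd_mul_pow hϖ (a := 0) (b := b + 1) (x := (m : R)) (y := NN σ ϖ)
    (by simp) (by simpa using not_dvd_cast hp hϖ hpϖ hm) (hR ϖ) hnc
  exact this (by convert hd using 2; ring)

/-- order p: break bound -/
theorem break_bound {p : ℕ} (hp : p.Prime) (hp3 : 3 ≤ p) {ϖ : R} (hϖ : Prime ϖ)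
    {e : ℕ} (he1 : 1 ≤ e) (he : ϖ ^ e ∣ (p : R)) (he' : ¬ ϖ ^ (e + 1) ∣ (p : R))
    (hperf : ∀ z : R, ∃ u, ϖ ∣ z - u ^ p) {σ : G} {b : ℕ} (hb : 1 ≤ b)
    (hR : Rm ϖ b σ) (hR' : ¬ Rm ϖ (b + 1) σ) (hσ : σ ^ p = 1) : (p - 1) * b ≤ e := by
  by_contra hlt
  push Not at hlt
  have hpϖ : ϖ ∣ (p : R) := (dvd_pow_self ϖ (by omega)).trans he
  have hnc := not_crit hp.two_le hpϖ hperf hR hR'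
  have hs := split2 σ p (by omega) ϖ
  rw [hσ, one_smul, sub_self] at hs
  have hϖ1 : ϖ ^ 1 ∣ ϖ := by simp
  have hd : ϖ ^ (e + (b + 1) + 1) ∣ (p : R) * NN σ ϖ := by
    have : (p : R) * NN σ ϖ = -((NN σ ^ p) ϖ +
        ∑ j ∈ Finset.Ico 2 p, (p.choose j : R) * (NN σ ^ j) ϖ) := by
      linear_combination -hs
    rw [this, dvd_neg]
    refine dvd_add ?_ (Finset.dvd_sum fun j hj => ?_)
    · refine (pow_dvd_pow ϖ ?_).trans (hR.NN_pow hϖ1 p)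
      obtain ⟨q, rfl⟩ : ∃ q, p = q + 1 := ⟨p - 1, by omega⟩
      simp at hlt
      nlinarith
    · rw [Finset.mem_Ico] at hj
      have h1 : ϖ ^ e ∣ (p.choose j : R) :=
        he.trans (Nat.cast_dvd_cast (hp.dvd_choose_self (by omega) hj.2))
      have := mul_dvd_mul h1 (hR.NN_pow hϖ1 j)
      rw [← pow_add] at this
      exact (pow_dvd_pow ϖ (by nlinarith)).trans this
  exact not_dvd_mul_pow hϖ he he' (hR ϖ) hnc hd

theorem pow_p_raise {p : ℕ} (hp : p.Prime) (hp3 : 3 ≤ p) {ϖ : R}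
    {e : ℕ} (he1 : 1 ≤ e) (he : ϖ ^ e ∣ (p : R))
    (hperf : ∀ z : R, ∃ u, ϖ ∣ z - u ^ p) {σ : G} {i : ℕ}
    (hR : Rm ϖ i σ) (hi : (p - 1) * i ≤ e) : Rm ϖ (p * i) (σ ^ p) := by
  have hpϖ : ϖ ∣ (p : R) := (dvd_pow_self ϖ (by omega)).trans he
  have h0 : Rm ϖ 0 (σ ^ p) := (Rsub G ϖ 0).pow_mem (hR.mono (by omega) : Rm ϖ 0 σ) p
  refine Rm.crit' hp.two_le hpϖ hperf h0 ?_
  have hϖ1 : ϖ ^ 1 ∣ ϖ := by simp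
  obtain ⟨q, rfl⟩ : ∃ q, p = q + 1 := ⟨p - 1, by omega⟩
  simp at hi
  have key : ∀ j, 1 ≤ j → ϖ ^ e * ϖ ^ (1 + j * i) ∣ ϖ ^ e * (NN σ ^ j) ϖ := fun j hj =>
    mul_dvd_mul_left _ (hR.NN_pow hϖ1 j)
  rw [split2 σ (q+1) (by omega)]
  refine dvd_add (dvd_add ?_ ?_) (Finset.dvd_sum fun j hj => ?_)
  · refine (pow_dvd_pow ϖ ?_).trans (hR.NN_pow hϖ1 (q+1))
    nlinarith
  · refine Dvd.dvd.trans ?_ (mul_dvd_mul he (hR ϖ))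
    rw [← pow_add]
    exact pow_dvd_pow ϖ (by nlinarith)
  · rw [Finset.mem_Ico] at hj
    have h1 : ϖ ^ e ∣ ((q+1).choose j : R) :=
      he.trans (Nat.cast_dvd_cast (hp.dvd_choose_self (by omega) hj.2))
    refine Dvd.dvd.trans ?_ (mul_dvd_mul h1 (hR.NN_pow hϖ1 j))
    rw [← pow_add]
    exact pow_dvd_pow ϖ (by nlinarith)

theorem smul_unif {ϖ : R} (hϖ : Prime ϖ) {τ : G} (h : Rm ϖ 0 τ) :
    ∃ u, τ • ϖ = ϖ * u ∧ ¬ ϖ ∣ u := by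
  obtain ⟨u, hu⟩ := h.dvd_smul
  refine ⟨u, hu, fun hd => ?_⟩
  have h2 : ϖ ^ 2 ∣ τ • ϖ := by rw [hu, pow_two]; exact mul_dvd_mul_left _ hd
  have := h.inv.dvd_smul_pow h2
  rw [inv_smul_smul] at this
  have h3 : ϖ ^ (1 + 1) ∣ ϖ ^ 1 * 1 := by simpa using this
  have := cancel_pow hϖ h3
  rw [pow_one] at this
  exact hϖ.not_isUnit (isUnit_of_dvd_one this)

/-- abelian tame argument -/
theorem tame_abelian {p : ℕ} (hp : p.Prime) {ϖ : R} (hϖ : Prime ϖ) (hpϖ : ϖ ∣ (p : R))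
    (hperf : ∀ z : R, ∃ u, ϖ ∣ z - u ^ p) {σ τ : G} (hc : σ * τ = τ * σ) (hτ : Rm ϖ 0 τ)
    {n : ℕ} (hR : Rm ϖ (p ^ n) σ) (hR' : ¬ Rm ϖ (p ^ n + 1) σ) : Rm ϖ 1 τ := by
  have hnc := not_crit hp.two_le hpϖ hperf hR hR'
  obtain ⟨u, hu, hu'⟩ := smul_unif hϖ hτ
  generalize hb : p ^ n = b at *
  obtain ⟨g, hg⟩ := hR ϖ
  have hg' : ¬ ϖ ∣ g := fun hh => hnc (by
    rw [hg, show b + 2 = (b + 1) + 1 by ring, pow_succ ϖ (b+1)]; exact mul_dvd_mul_left _ hh)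
  obtain ⟨d, hd⟩ := hR u
  obtain ⟨f, hf⟩ := hτ g
  have e1 : σ • ϖ = ϖ + ϖ ^ (b+1) * g := by rw [← hg]; ring
  have e2 : σ • u = u + ϖ ^ (b+1) * d := by rw [← hd]; ring
  have e3 : τ • g = g + ϖ * f := by rw [zero_add, pow_one] at hf; rw [← hf]; ring
  have e4 : σ • τ • ϖ = τ • σ • ϖ := by rw [← mul_smul, hc, mul_smul]
  rw [hu, e1, smul_mul', e1, e2, smul_add, smul_mul', smul_pow', hu, e3] at e4
  have h5 : ϖ ^ (b+1) * (u * g * (u ^ b - 1))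
      = ϖ ^ (b+1) * (ϖ * (d + ϖ ^ b * g * d - u ^ (b+1) * f)) := by
    linear_combination -e4
  have h6 := mul_left_cancel₀ (pow_ne_zero _ hϖ.ne_zero) h5
  have h7 : ϖ ∣ u ^ b - 1 := by
    have : ϖ ∣ u * g * (u ^ b - 1) := ⟨_, h6⟩
    rcases hϖ.dvd_or_dvd this with h | h
    · rcases hϖ.dvd_or_dvd h with h | h
      · exact absurd h hu'
      · exact absurd h hg'
    · exact h
  have h8 : ϖ ∣ u - 1 := by
    have : Fact p.Prime := ⟨hp⟩
    obtain ⟨r, hr⟩ := exists_add_pow_prime_pow_eq hp (u - 1) 1 n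
    rw [sub_add_cancel, hb, one_pow] at hr
    have h9 : (u - 1) ^ b = (u ^ b - 1) - p * ((u - 1) * 1 * r) := by
      rw [hr]; ring
    exact hϖ.dvd_of_dvd_pow (h9 ▸ dvd_sub h7 (hpϖ.mul_right _))
  refine Rm.crit' hp.two_le hpϖ hperf hτ ?_
  rw [hu, show ϖ * u - ϖ = ϖ * (u - 1) by ring, pow_two]
  exact mul_dvd_mul_left _ h8

theorem e_le_card {ϖ : R} (hϖ : Prime ϖ) [Fintype G] (h0 : ∀ τ : G, Rm ϖ 0 τ) {e : ℕ} {P : R}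
    (he : ϖ ^ e ∣ P) (hn : P ∣ ∏ τ : G, τ • ϖ) : e ≤ Fintype.card G := by
  choose u hu hu' using fun τ : G => smul_unif hϖ (h0 τ)
  simp only [hu, Finset.prod_mul_distrib, Finset.prod_const] at hn
  by_contra hlt
  push Not at hlt
  have h := he.trans hn
  have : ϖ ^ (Fintype.card G + 1) ∣ ϖ ^ (Fintype.card G) * ∏ τ, u τ :=
    (pow_dvd_pow ϖ (by omega)).trans h
  have := cancel_pow hϖ this
  rw [pow_one] at this
  obtain ⟨τ, _, hτ⟩ := (hϖ.dvd_finsetProd_iff _).1 this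
  exact hu' τ hτ

/-- final computation -/
theorem final_comp {p : ℕ} (hp : p.Prime) (hp3 : 3 ≤ p) {ϖ : R} (hϖ : Prime ϖ)
    {e n : ℕ} (hn : 1 ≤ n) (he : ϖ ^ e ∣ (p : R)) (hen : p ^ n - 1 ≤ e) (he1 : 1 ≤ e)
    (hperf : ∀ z : R, ∃ u, ϖ ∣ z - u ^ p) {γ : G} (hγ : Rm ϖ (p - 1) γ)
    (hσ : Rm ϖ (p ^ n - 1) (γ ^ p ^ (n - 1))) (hσ' : ¬ Rm ϖ (p ^ n) (γ ^ p ^ (n - 1)))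
    {a x : R} (ha : ∀ σ : G, σ • a = a) {i : ℕ} (hi1 : 1 ≤ i) (hip : i < p) {u : R}
    (hu : ¬ ϖ ∣ u) (hx : x = ϖ ^ i * u) :
    ¬ ϖ ^ (p ^ n) ∣ (NN γ ^ (p ^ (n - 1) - 1)) (a + x) ∧
      ϖ ^ (p ^ n) ∣ (NN γ ^ (p ^ (n - 1))) (a + x) := by
  have hpϖ : ϖ ∣ (p : R) := (dvd_pow_self ϖ (by omega)).trans he
  have hpn : p ≤ p ^ n := Nat.le_self_pow (by omega) p
  set q := p ^ (n - 1) with hq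
  have hq1 : 1 ≤ q := Nat.one_le_pow _ _ hp.pos
  have hrest : ∃ r, (NN γ ^ q) (a + x) = (γ ^ q • (a + x) - (a + x)) - r ∧
      ϖ ^ (e + p) ∣ r := by
    refine ⟨∑ j ∈ Finset.Ico 1 q, (q.choose j : R) * (NN γ ^ j) (a + x), ?_,
      Finset.dvd_sum fun j hj => ?_⟩
    · rw [smul_pow_expand γ q, Finset.sum_range_succ, Finset.range_eq_Ico,
        Finset.sum_eq_sum_Ico_succ_bot (by omega)]
      simp only [zero_add, Nat.choose_zero_right, Nat.choose_self, Nat.cast_one, one_mul, pow_zero, Module.End.one_apply]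
      ring
    · rw [Finset.mem_Ico] at hj
      have h1 : ϖ ^ e ∣ (q.choose j : R) :=
        he.trans (Nat.cast_dvd_cast (hp.dvd_choose_pow (by omega) (by omega)))
      rw [pow_add]
      refine mul_dvd_mul h1 ?_
      obtain ⟨j, rfl⟩ : ∃ k, j = k + 1 := ⟨j - 1, by omega⟩
      rw [pow_succ, Module.End.mul_apply]
      have h2 : ϖ ^ p ∣ NN γ (a + x) := by
        have := hγ (a + x)
        rwa [show p - 1 + 1 = p by omega] at this
      exact (pow_dvd_pow ϖ (by omega)).trans (hγ.NN_pow h2 j)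
  obtain ⟨r, hr, hr'⟩ := hrest
  constructor
  · intro hE
    have h1 : ϖ ^ (p ^ n + (p - 1)) ∣ (NN γ ^ q) (a + x) := by
      have := hγ.raise hE
      rw [← NN_apply, ← Module.End.mul_apply, ← pow_succ'] at this
      rwa [show q - 1 + 1 = q by omega] at this
    have h2 : ϖ ^ (p ^ n + i) ∣ γ ^ q • (a + x) - (a + x) := by
      have e1 : γ ^ q • (a + x) - (a + x) = (NN γ ^ q) (a + x) + r := by rw [hr]; ring
      rw [e1]
      exact dvd_add ((pow_dvd_pow ϖ (by omega)).trans h1) ((pow_dvd_pow ϖ (by omega)).trans hr')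
    rw [smul_add, ha, add_sub_add_left_eq_sub, hx] at h2
    have hb : 1 ≤ p ^ n - 1 := by omega
    have hnc := not_crit hp.two_le hpϖ hperf hσ (by rwa [show p ^ n - 1 + 1 = p ^ n by omega])
    refine Rm.exact_raise hp hϖ hpϖ hb hσ hnc hi1 (Nat.not_dvd_of_pos_of_lt hi1 hip) hu ?_
    rwa [show i + (p ^ n - 1) + 1 = p ^ n + i by omega]
  · rw [hr]
    refine dvd_sub ?_ ((pow_dvd_pow ϖ (by omega)).trans hr')
    have := hσ (a + x)
    rwa [show p ^ n - 1 + 1 = p ^ n by omega] at this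

end AbstractRam

section GroupPart

theorem chain_lemma {G : Type} [Group G] [Finite G] (hab : ∀ σ τ : G, σ * τ = τ * σ)
    {p n : ℕ} (hp : p.Prime) {γ : G} (hγ : orderOf γ = p ^ n) (H : Subgroup G)
    (hH : H ≤ Subgroup.zpowers γ) {j : ℕ} (hj1 : 1 ≤ j) (hjn : j ≤ n)
    (hγj : γ ^ p ^ (j - 1) ∉ H) : Nat.card H ≤ p ^ (n - j) := by
  have hnorm : H.Normal := ⟨fun h hh g => by rw [hab g h]; simpa using hh⟩
  have h1 : Nat.card (Subgroup.zpowers γ) = p ^ n := by rw [Nat.card_zpowers, hγ]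
  have h2 : H.relIndex (Subgroup.zpowers γ) * Nat.card H = p ^ n := by
    rw [← h1, mul_comm]
    have := Subgroup.card_mul_index (H.subgroupOf (Subgroup.zpowers γ))
    rw [← this, Subgroup.relIndex, Nat.card_congr (Subgroup.subgroupOfEquivOfLe hH).toEquiv]
  obtain ⟨s, hs, hs'⟩ := (Nat.dvd_prime_pow hp).1 (Dvd.intro _ h2)
  have h3 := Subgroup.pow_relIndex_mem H (Subgroup.mem_zpowers γ)
  rw [hs'] at h3 h2
  have h4 : j ≤ s := by
    by_contra hlt
    apply hγj
    obtain ⟨d, hd⟩ := pow_dvd_pow p (show s ≤ j - 1 by omega)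
    rw [hd, pow_mul]
    exact H.pow_mem h3 d
  have h5 : Nat.card H = p ^ (n - s) := by
    have : p ^ s * Nat.card H = p ^ s * p ^ (n - s) := by
      rw [h2, ← pow_add]; congr 1; omega
    exact Nat.eq_of_mul_eq_mul_left (Nat.pow_pos hp.pos) this
  rw [h5]
  exact Nat.pow_le_pow_right hp.pos (by omega)

set_option linter.unusedSectionVars false
set_option linter.unusedVariables false

variable {R G : Type} [CommRing R] [IsDomain R] [Group G] [MulSemiringAction G R]

theorem wild_card [Finite G] [FaithfulSMul G R]
    {p n : ℕ} (hp : p.Prime) {ϖ : R} (hϖ : Prime ϖ) (hpϖ : ϖ ∣ (p : R))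
    (hperf : ∀ z : R, ∃ u, ϖ ∣ z - u ^ p)
    (hsep : ∀ z : R, (∀ j : ℕ, ϖ ^ j ∣ z) → z = 0)
    (hcard : Nat.card G = (p - 1) * p ^ n) : Nat.card (Rsub G ϖ 1) ≤ p ^ n := by
  have hf : Fact p.Prime := ⟨hp⟩
  have hnd : ¬ p ∣ (p - 1) := Nat.not_dvd_of_pos_of_lt (by have := hp.two_le; omega)
    (by have := hp.two_le; omega)
  have hpg : IsPGroup p (Rsub G ϖ 1) := by
    intro g
    refine ⟨n, ?_⟩
    obtain ⟨g, hg⟩ := g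
    ext
    simp only [SubmonoidClass.mk_pow, OneMemClass.coe_one]
    refine wild_torsion hp hϖ hpϖ hperf hsep ((Rsub G ϖ 1).pow_mem hg _) hnd ?_
    rw [← pow_mul, mul_comm, ← hcard, pow_card_eq_one']
  obtain ⟨s, hs⟩ := hpg.exists_card_eq
  have hd := Subgroup.card_subgroup_dvd_card (Rsub G ϖ 1)
  rw [hs, hcard] at hd
  have hcop : Nat.Coprime (p ^ s) (p - 1) := Nat.Coprime.pow_left _ ((hp.coprime_iff_not_dvd).2 hnd)
  rw [hs]
  exact Nat.le_of_dvd (Nat.pow_pos hp.pos) (hcop.dvd_of_dvd_mul_left hd)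

theorem core [Fintype G] [FaithfulSMul G R] (hab : ∀ σ τ : G, σ * τ = τ * σ)
    {p n : ℕ} (hp : p.Prime) (hp3 : 3 ≤ p) (hn : 1 ≤ n) {ϖ : R} (hϖ : Prime ϖ)
    {e : ℕ} (he1 : 1 ≤ e) (he : ϖ ^ e ∣ (p : R)) (he' : ¬ ϖ ^ (e + 1) ∣ (p : R))
    (hperf : ∀ z : R, ∃ u, ϖ ∣ z - u ^ p)
    (hsep : ∀ z : R, (∀ j : ℕ, ϖ ^ j ∣ z) → z = 0)
    (hcard : Nat.card G = (p - 1) * p ^ n) (h0 : ∀ τ : G, Rm ϖ 0 τ)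
    (hN : (p : R) ∣ ∏ τ : G, τ • ϖ) {γ : G} (hγ1 : Rm ϖ 1 γ) (hγ : orderOf γ = p ^ n) :
    (∀ j t, j ≤ n → p ^ j ≤ t → Nat.card (Rsub G ϖ t) ≤ p ^ (n - j)) ∧
    ¬ Rm ϖ (p ^ n) (γ ^ p ^ (n - 1)) ∧
    (1 < Nat.card (Rsub G ϖ (p ^ n - 1)) → Rm ϖ (p ^ n - 1) (γ ^ p ^ (n - 1))) ∧
    (Rm ϖ (p ^ n - 1) (γ ^ p ^ (n - 1)) → p ^ n - 1 ≤ e) := by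
  have hpϖ : ϖ ∣ (p : R) := (dvd_pow_self ϖ (by omega)).trans he
  have hpn : p ≤ p ^ n := Nat.le_self_pow (by omega) p
  have hW := wild_card hp hϖ hpϖ hperf hsep hcard
  have hz : Subgroup.zpowers γ = Rsub G ϖ 1 := by
    apply Subgroup.eq_of_le_of_card_ge
    · rw [Subgroup.zpowers_le]; exact hγ1
    · rw [Nat.card_zpowers, hγ]; exact hW
  have hsub : ∀ t, 1 ≤ t → Rsub G ϖ t ≤ Subgroup.zpowers γ := by
    intro t ht
    rw [hz]
    exact fun σ hσ => Rm.mono hσ ht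
  set σ := γ ^ p ^ (n - 1) with hσdef
  have hσp : σ ^ p = 1 := by
    rw [hσdef, ← pow_mul, ← pow_succ, show n - 1 + 1 = n by omega, ← hγ, pow_orderOf_eq_one]
  have hσ1 : σ ≠ 1 := by
    intro h
    have h1 := orderOf_dvd_of_pow_eq_one h
    rw [hγ] at h1
    have := (Nat.pow_dvd_pow_iff_le_right hp.two_le).1 h1
    omega
  have hσR : Rm ϖ 1 σ := (Rsub G ϖ 1).pow_mem hγ1 _
  obtain ⟨b, hb1, hbR, hbR'⟩ := exists_break hsep hσ1 hσR
  have hbe := break_bound hp hp3 hϖ he1 he he' hperf hb1 hbR hbR' hσp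
  have hec := e_le_card hϖ h0 he hN
  rw [← Nat.card_eq_fintype_card, hcard] at hec
  have hble : b ≤ p ^ n := Nat.le_of_mul_le_mul_left (hbe.trans hec) (by omega)
  have hbne : b ≠ p ^ n := by
    rintro rfl
    have hall : ∀ τ : G, Rm ϖ 1 τ := fun τ =>
      tame_abelian hp hϖ hpϖ hperf (hab σ τ) (h0 τ) hbR hbR'
    have htop : Rsub G ϖ 1 = ⊤ := by
      rw [eq_top_iff]; exact fun τ _ => hall τ
    rw [htop, Subgroup.card_top, hcard] at hW
    have : 0 < p ^ n := Nat.pow_pos hp.pos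
    have h2 : 2 * p ^ n ≤ (p - 1) * p ^ n := Nat.mul_le_mul_right _ (by omega)
    omega
  have hbreak : ∀ i, Rm ϖ i σ → i ≤ b := by
    intro i hi
    by_contra hlt
    exact hbR' (hi.mono (by omega))
  have hσn : ¬ Rm ϖ (p ^ n) σ := fun h => by have := hbreak _ h; omega
  have hdesc : ∀ d, d < n → ¬ Rm ϖ (p ^ (n - d)) (γ ^ p ^ (n - d - 1)) := by
    intro d
    induction d with
    | zero => intro _; exact hσn
    | succ d ih =>
      intro hd hR
      have ih' := ih (by omega)
      apply ih'
      have h1 : Rm ϖ (p ^ (n - (d+1))) σ := by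
        have h2 := (Rsub G ϖ (p ^ (n - (d+1)))).pow_mem hR (p ^ (d + 1))
        rw [← pow_mul, ← pow_add, show n - (d+1) - 1 + (d+1) = n - 1 by omega] at h2
        exact h2
      have h3 := hbreak _ h1
      have h4 := pow_p_raise hp hp3 he1 he hperf hR
        ((Nat.mul_le_mul_left _ h3).trans hbe)
      rw [← pow_mul, ← pow_succ, ← pow_succ'] at h4
      rwa [show n - (d+1) - 1 + 1 = n - d - 1 by omega, show n - (d+1) + 1 = n - d by omega] at h4
  refine ⟨?_, hσn, ?_, ?_⟩
  · intro j t hjn ht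
    rcases Nat.eq_zero_or_pos j with rfl | hj
    · refine (Subgroup.card_le_of_le (H := Rsub G ϖ t) (K := Rsub G ϖ 1) ?_).trans (by simpa using hW)
      exact fun σ hσ => Rm.mono hσ (by simpa using ht)
    · refine chain_lemma hab hp hγ _ (hsub t ((Nat.pow_pos hp.pos).trans_le ht)) hj hjn ?_
      intro hh
      have h1 := hdesc (n - j) (by omega)
      rw [show n - (n - j) = j by omega] at h1
      exact h1 (Rm.mono hh ht)
  · intro hc
    by_contra hh
    have := chain_lemma hab hp hγ (Rsub G ϖ (p ^ n - 1)) (hsub _ (by omega)) hn le_rfl hh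
    simp at this
    omega
  · intro hR
    have h1 := hbreak _ hR
    have h2 : 1 * b ≤ (p - 1) * b := Nat.mul_le_mul_right _ (by omega)
    omega

end GroupPart

section HerbrandPart

open MeasureTheory

theorem herb_int {g : ℤ → ℝ} (hg : Antitone g) (a b : ℝ) :
    IntervalIntegrable (fun t : ℝ => g ⌈t⌉ / g 0) volume a b ∨ g 0 < 0 := by
  rcases lt_or_ge (g 0) 0 with h | h
  · exact Or.inr h
  · left
    apply Antitone.intervalIntegrable
    intro x y hxy
    exact div_le_div_of_nonneg_right (hg (Int.ceil_mono hxy)) h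

theorem herb_lower {g : ℤ → ℝ} (hg : Antitone g) (h1 : ∀ i, 1 ≤ g i) {a b : ℝ} (hab : a ≤ b) :
    (b - a) / g 0 ≤ ∫ t in a..b, g ⌈t⌉ / g 0 := by
  have h0 : 0 < g 0 := lt_of_lt_of_le one_pos (h1 0)
  have hi : ∀ a b, IntervalIntegrable (fun t : ℝ => g ⌈t⌉ / g 0) volume a b := fun a b =>
    (herb_int hg a b).resolve_right (not_lt.2 h0.le)
  have : ∫ t in a..b, (1 / g 0 : ℝ) ≤ ∫ t in a..b, g ⌈t⌉ / g 0 := by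
    apply intervalIntegral.integral_mono_on hab (by simp) (hi a b)
    intro x _
    exact div_le_div_of_nonneg_right (h1 _) h0.le
  rw [intervalIntegral.integral_const, smul_eq_mul] at this
  rwa [div_eq_mul_one_div]

theorem herb_sub {g : ℤ → ℝ} (hg : Antitone g) (h1 : ∀ i, 1 ≤ g i) (a b : ℝ) :
    (∫ t in (0:ℝ)..b, g ⌈t⌉ / g 0) = (∫ t in (0:ℝ)..a, g ⌈t⌉ / g 0) +
      ∫ t in a..b, g ⌈t⌉ / g 0 := by
  have h0 : 0 < g 0 := lt_of_lt_of_le one_pos (h1 0)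
  have hi : ∀ a b, IntervalIntegrable (fun t : ℝ => g ⌈t⌉ / g 0) volume a b := fun a b =>
    (herb_int hg a b).resolve_right (not_lt.2 h0.le)
  rw [intervalIntegral.integral_add_adjacent_intervals (hi _ _) (hi _ _)]

theorem herb_strict {g : ℤ → ℝ} (hg : Antitone g) (h1 : ∀ i, 1 ≤ g i) :
    StrictMono (fun u : ℝ => ∫ t in (0:ℝ)..u, g ⌈t⌉ / g 0) := by
  intro a b hab
  have h0 : 0 < g 0 := lt_of_lt_of_le one_pos (h1 0)
  simp only
  rw [herb_sub hg h1 a b]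
  have := herb_lower hg h1 hab.le
  have : 0 < (b - a) / g 0 := div_pos (by linarith) h0
  linarith

theorem herb_surj {g : ℤ → ℝ} (hg : Antitone g) (h1 : ∀ i, 1 ≤ g i) {k : ℝ} (hk : 0 ≤ k) :
    ∃ u : ℝ, (∫ t in (0:ℝ)..u, g ⌈t⌉ / g 0) = k := by
  have h0 : 0 < g 0 := lt_of_lt_of_le one_pos (h1 0)
  have hi : ∀ a b, IntervalIntegrable (fun t : ℝ => g ⌈t⌉ / g 0) volume a b := fun a b =>
    (herb_int hg a b).resolve_right (not_lt.2 h0.le)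
  have hc := intervalIntegral.continuous_primitive hi 0
  have hb : k ≤ ∫ t in (0:ℝ)..(k * g 0), g ⌈t⌉ / g 0 := by
    have := herb_lower hg h1 (a := 0) (b := k * g 0) (by positivity)
    rwa [sub_zero, mul_div_cancel_right₀ _ h0.ne'] at this
  have := intermediate_value_Icc (a := 0) (b := k * g 0) (by positivity) hc.continuousOn
  obtain ⟨u, _, hu⟩ := this ⟨by simpa using hk, hb⟩
  exact ⟨u, hu⟩

theorem herb_upper {g : ℤ → ℝ} (hg : Antitone g) (h1 : ∀ i, 1 ≤ g i) {p : ℕ} (hp : 2 ≤ p)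
    {k : ℕ} (h : ∀ j : ℕ, j < k → ∀ t : ℤ, (p : ℤ) ^ j ≤ t → g t / g 0 ≤ 1 / ((p - 1) * p ^ j)) :
    (∫ t in (0:ℝ)..((p : ℝ) ^ k - 1), g ⌈t⌉ / g 0) ≤ k := by
  have h0 : 0 < g 0 := lt_of_lt_of_le one_pos (h1 0)
  have hi : ∀ a b, IntervalIntegrable (fun t : ℝ => g ⌈t⌉ / g 0) volume a b := fun a b =>
    (herb_int hg a b).resolve_right (not_lt.2 h0.le)
  have hp' : (2 : ℝ) ≤ p := by exact_mod_cast hp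
  induction k with
  | zero => simp
  | succ k ih =>
    rw [herb_sub hg h1 ((p : ℝ) ^ k - 1)]
    have ih' := ih fun j hj => h j (by omega)
    have hpk : (0 : ℝ) < (p : ℝ) ^ k := by positivity
    have hle : (p : ℝ) ^ k - 1 ≤ (p : ℝ) ^ (k+1) - 1 := by rw [pow_succ]; nlinarith
    have : (∫ t in ((p : ℝ) ^ k - 1)..((p : ℝ) ^ (k+1) - 1), g ⌈t⌉ / g 0) ≤
        ∫ t in ((p : ℝ) ^ k - 1)..((p : ℝ) ^ (k+1) - 1), (1 / ((p - 1) * p ^ k) : ℝ) := by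
      apply intervalIntegral.integral_mono_on_of_le_Ioo hle (hi _ _) (by simp)
      intro x hx
      apply h k (by omega)
      have : ((p : ℤ) ^ k - 1) < ⌈x⌉ := by
        rw [Int.lt_ceil]; push_cast; exact hx.1
      omega
    rw [intervalIntegral.integral_const, smul_eq_mul] at this
    have e : ((p : ℝ) ^ (k+1) - 1 - ((p : ℝ) ^ k - 1)) * (1 / ((p - 1) * p ^ k)) = 1 := by
      have : (p : ℝ) - 1 ≠ 0 := by linarith
      field_simp
      ring
    rw [e] at this
    push_cast
    linarith

end HerbrandPart

section ConcretePart

theorem pv_one {p : ℕ} {A : Type} [Field A] (vd : PadicValData A p) : vd.v 1 = 0 := by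
  have h := vd.v_mul 1 1
  rw [mul_one] at h
  have hne : vd.v 1 ≠ ⊤ := by rw [Ne, vd.v_top_iff]; exact one_ne_zero
  obtain ⟨q, hq⟩ := WithTop.ne_top_iff_exists.1 hne
  rw [← hq] at h ⊢
  norm_cast at h ⊢
  linarith

noncomputable def AVal {p : ℕ} {A L : Type} [Field A] [Field L] (vd : PadicValData A p)
    (emb : L →+* A) : AddValuation L (WithTop ℚ) :=
  (AddValuation.of vd.v ((vd.v_top_iff 0).2 rfl) (pv_one vd) vd.v_min_le_add vd.v_mul).comap emb

theorem AVal_apply {p : ℕ} {A L : Type} [Field A] [Field L] (vd : PadicValData A p)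
    (emb : L →+* A) (x : L) : AVal vd emb x = vd.v (emb x) := rfl

variable {L : Type} [Field L] (w : AddValuation L (WithTop ℚ))

theorem w_fin {x : L} (hx : x ≠ 0) : ∃ q : ℚ, w x = q := by
  obtain ⟨q, hq⟩ := WithTop.ne_top_iff_exists.1 ((AddValuation.ne_top_iff w).2 hx)
  exact ⟨q, hq.symm⟩

def OO : Subring L where
  carrier := {x | 0 ≤ w x}
  mul_mem' := fun {a b} ha hb => by
    simp only [Set.mem_setOf_eq, AddValuation.map_mul] at *; exact add_nonneg ha hb
  one_mem' := by simp
  add_mem' := fun {a b} ha hb => (le_min ha hb).trans (w.map_add a b)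
  zero_mem' := by simp
  neg_mem' := fun {a} ha => by simpa using ha

theorem w_div {x y : L} (hy : y ≠ 0) (h : w y ≤ w x) : 0 ≤ w (x / y) := by
  obtain ⟨b, hb⟩ := w_fin w hy
  have h1 : w x = w (x / y) + w y := by rw [← AddValuation.map_mul, div_mul_cancel₀ _ hy]
  rcases eq_or_ne (x / y) 0 with h0 | h0
  · rw [h0]; simp
  · obtain ⟨c, hc⟩ := w_fin w h0
    rw [h1, hb, hc] at h
    rw [hc]
    norm_cast at h ⊢
    linarith

theorem OO_dvd {x y : OO w} (hy : (y : L) ≠ 0) : y ∣ x ↔ w (y : L) ≤ w (x : L) := by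
  constructor
  · rintro ⟨z, rfl⟩
    have := z.2
    change (0 : WithTop ℚ) ≤ w (z : L) at this
    push_cast
    rw [AddValuation.map_mul]
    exact le_add_of_nonneg_right this
  · intro h
    refine ⟨⟨(x : L) / y, w_div w hy h⟩, ?_⟩
    ext
    push_cast
    field_simp

/-- discreteness -/
theorem exists_unif {p : ℕ} (hp : 0 < p) {x : L} (hx0 : x ≠ 0) (hx : 0 < w x)
    (h : ∀ s, 0 < w s → w x < w (s ^ p)) :
    ∃ ϖ : L, 0 < w ϖ ∧ ϖ ≠ 0 ∧ ∀ y, 0 < w y → w ϖ ≤ w y := by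
  obtain ⟨q, hq⟩ := w_fin w hx0
  have hq0 : 0 < q := by rw [hq] at hx; exact_mod_cast hx
  let H : AddSubgroup ℚ :=
    { carrier := {r | ∃ y : L, w y = (r : WithTop ℚ)}
      add_mem' := by
        rintro a b ⟨y, hy⟩ ⟨z, hz⟩
        exact ⟨y * z, by rw [AddValuation.map_mul, hy, hz]; rfl⟩
      zero_mem' := ⟨1, by simp⟩
      neg_mem' := by
        rintro a ⟨y, hy⟩
        refine ⟨y⁻¹, ?_⟩
        have hy0 : y ≠ 0 := by rw [← AddValuation.ne_top_iff w, hy]; simp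
        obtain ⟨b, hb⟩ := w_fin w (inv_ne_zero hy0)
        have : w y + w y⁻¹ = 0 := by rw [← AddValuation.map_mul, mul_inv_cancel₀ hy0]; simp
        rw [hy, hb] at this
        rw [hb]
        norm_cast at this ⊢
        linarith }
  have hbot : H ≠ ⊥ := by
    intro hb
    have : q ∈ H := ⟨x, hq⟩
    rw [hb] at this
    exact hq0.ne' (by simpa using this)
  have hpq : (0 : ℚ) < p := by exact_mod_cast hp
  have hdis : Disjoint (H : Set ℚ) (Set.Ioo 0 (q / p)) := by
    rw [Set.disjoint_left]
    rintro r ⟨s, hs⟩ ⟨h1, h2⟩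
    have h3 := h s (by rw [hs]; exact_mod_cast h1)
    rw [AddValuation.map_pow, hs, hq, ← WithTop.coe_nsmul, WithTop.coe_lt_coe, nsmul_eq_mul] at h3
    rw [lt_div_iff₀ hpq] at h2
    linarith
  obtain ⟨b, ⟨⟨ϖ, hϖ⟩, hb0⟩, hmin⟩ := AddSubgroup.exists_isLeast_pos hbot (by positivity) hdis
  refine ⟨ϖ, by rw [hϖ]; exact_mod_cast hb0, ?_, ?_⟩
  · rw [← AddValuation.ne_top_iff w, hϖ]; simp
  · intro y hy
    rcases eq_or_ne y 0 with rfl | hy0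
    · simp
    · obtain ⟨c, hc⟩ := w_fin w hy0
      rw [hc] at hy
      rw [hϖ, hc]
      exact_mod_cast hmin ⟨⟨y, hc⟩, by exact_mod_cast hy⟩

theorem w_pos_iff {ϖ : L} (h0 : 0 < w ϖ) (hmin : ∀ y, 0 < w y → w ϖ ≤ w y) (hϖ0 : ϖ ≠ 0)
    (y : OO w) : (⟨ϖ, h0.le⟩ : OO w) ∣ y ↔ 0 < w (y : L) := by
  rw [OO_dvd w (y := ⟨ϖ, h0.le⟩) hϖ0]
  exact ⟨fun h => h0.trans_le h, hmin _⟩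

theorem unif_prime {ϖ : L} (h0 : 0 < w ϖ) (hmin : ∀ y, 0 < w y → w ϖ ≤ w y) (hϖ0 : ϖ ≠ 0) :
    Prime (⟨ϖ, h0.le⟩ : OO w) := by
  refine ⟨fun h => hϖ0 (congrArg Subtype.val h), fun h => ?_, fun a b hab => ?_⟩
  · rw [isUnit_iff_dvd_one, w_pos_iff w h0 hmin hϖ0] at h
    simp at h
  · rw [w_pos_iff w h0 hmin hϖ0] at hab ⊢
    rw [w_pos_iff w h0 hmin hϖ0]
    by_contra hcon
    push Not at hcon
    have ha : w (a : L) = 0 := le_antisymm hcon.1 a.2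
    have hb : w (b : L) = 0 := le_antisymm hcon.2 b.2
    push_cast at hab
    rw [AddValuation.map_mul, ha, hb] at hab
    simp at hab

theorem unif_sep {ϖ : L} (h0 : 0 < w ϖ) (hϖ0 : ϖ ≠ 0) (z : OO w)
    (hz : ∀ j : ℕ, (⟨ϖ, h0.le⟩ : OO w) ^ j ∣ z) : z = 0 := by
  by_contra hne
  have hz0 : (z : L) ≠ 0 := fun h => hne (Subtype.ext h)
  obtain ⟨c, hc⟩ := w_fin w hϖ0
  obtain ⟨d, hd⟩ := w_fin w hz0
  rw [hc] at h0
  have hc0 : 0 < c := by exact_mod_cast h0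
  obtain ⟨j, hj⟩ := exists_nat_gt (d / c)
  have := (OO_dvd w (by simpa using fun h => absurd h hϖ0)).1 (hz j)
  push_cast at this
  rw [AddValuation.map_pow, hc, hd, ← WithTop.coe_nsmul, WithTop.coe_le_coe, nsmul_eq_mul] at this
  rw [div_lt_iff₀ hc0] at hj
  linarith

/-- `ℤ_p` is contained in the valuation ring. -/
theorem zp_int {p : ℕ} [hpf : Fact p.Prime] (f : ℚ_[p] →+* L) (hwp : w (p : L) = 1)
    (hmin : ∀ y : ℚ_[p], 0 < w (f y) → 1 ≤ w (f y)) (c : ℤ_[p]) : 0 ≤ w (f c) := by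
  by_contra hneg
  push Not at hneg
  have hneg' : ∀ y : ℚ_[p], w (f y) < 0 → ∃ r : ℚ, w (f y) = r ∧ r ≤ -1 := by
    intro y hy
    have hy0 : f y ≠ 0 := by rintro h; rw [h] at hy; simp at hy
    obtain ⟨r, hr⟩ := w_fin w hy0
    obtain ⟨s, hs⟩ := w_fin w (inv_ne_zero hy0)
    have h1 : w (f y) + w (f y)⁻¹ = 0 := by rw [← AddValuation.map_mul, mul_inv_cancel₀ hy0]; simp
    rw [hr, hs] at h1
    rw [hr] at hy
    norm_cast at h1 hy
    have h2 := hmin y⁻¹ (by rw [map_inv₀, hs]; norm_cast; linarith)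
    rw [map_inv₀, hs] at h2
    norm_cast at h2
    exact ⟨r, hr, by linarith⟩
  obtain ⟨r, hr, hr1⟩ := hneg' c hneg
  set d : ℤ_[p] := 1 + p * c ^ 2 with hd
  have hwd : w (f d) = ((1 + 2 * r : ℚ) : WithTop ℚ) := by
    have h2 : w ((p : L) * (f c) ^ 2) = ((1 + 2 * r : ℚ) : WithTop ℚ) := by
      rw [AddValuation.map_mul, AddValuation.map_pow, hwp, hr, two_nsmul, two_mul]; rfl
    rw [hd]
    rw [PadicInt.coe_add, PadicInt.coe_one, PadicInt.coe_mul, PadicInt.coe_natCast, PadicInt.coe_pow,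
      map_add, map_mul, map_pow, map_one, map_natCast]
    rw [AddValuation.map_add_eq_of_lt_right, h2]
    rw [h2, AddValuation.map_one]
    norm_cast
    linarith
  obtain ⟨q, hq⟩ := exists_nat_gt (-(1 + 2 * r))
  -- choose exponent prime to p
  set m := p * q + 1 with hm
  have hmq : q ≤ m := by have := hpf.out.pos; nlinarith
  have hroot : ∃ z : ℤ_[p], z ^ m = d := by
    have hF : ‖(Polynomial.aeval (1 : ℤ_[p])) (Polynomial.X ^ m - Polynomial.C d)‖ <
        ‖(Polynomial.aeval (1 : ℤ_[p]))
          (Polynomial.derivative (Polynomial.X ^ m - Polynomial.C d))‖ ^ 2 := by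
      have e1 : ‖((m : ℕ) : ℤ_[p])‖ = 1 := by
        have h1 : ¬ ‖((m : ℤ) : ℤ_[p])‖ < 1 := by
          rw [PadicInt.norm_int_lt_one_iff_dvd]
          intro h
          have h2 : p ∣ m := by exact_mod_cast h
          rw [hm, Nat.dvd_add_right (dvd_mul_right _ _)] at h2
          exact hpf.out.one_lt.ne' (Nat.dvd_one.1 h2)
        push_cast at h1
        exact le_antisymm (PadicInt.norm_le_one _) (not_lt.1 h1)
      have e2 : ‖(1 : ℤ_[p]) - d‖ < 1 := by
        rw [PadicInt.norm_lt_one_iff_dvd]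
        exact ⟨-c ^ 2, by rw [hd]; ring⟩
      simp only [Polynomial.derivative_sub, Polynomial.derivative_X_pow, Polynomial.derivative_C,
        map_sub, map_mul, map_pow, Polynomial.aeval_X, Polynomial.aeval_C, one_pow, map_natCast,
        map_zero, sub_zero, mul_one]
      rw [e1]
      simpa using e2
    obtain ⟨z, hz, -⟩ := hensels_lemma hF
    refine ⟨z, ?_⟩
    simp at hz
    exact sub_eq_zero.1 hz
  obtain ⟨z, hz⟩ := hroot
  have hwz : m • w (f z) = ((1 + 2 * r : ℚ) : WithTop ℚ) := by
    rw [← hwd, ← hz]; push_cast; rw [map_pow, AddValuation.map_pow]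
  have hzneg : w (f z) < 0 := by
    by_contra h
    push Not at h
    have : (0 : WithTop ℚ) ≤ m • w (f z) := nsmul_nonneg h m
    rw [hwz] at this
    norm_cast at this
    linarith
  obtain ⟨s, hs, hs1⟩ := hneg' z hzneg
  rw [hs, ← WithTop.coe_nsmul, WithTop.coe_inj, nsmul_eq_mul] at hwz
  have : (q : ℚ) ≤ m := by exact_mod_cast hmq
  nlinarith

/-- perfectness of the residue field -/
theorem perf_of_alg {p : ℕ} [hpf : Fact p.Prime] {R : Type} [CommRing R] {ϖ : R} (hϖ : Prime ϖ)
    (hpϖ : ϖ ∣ (p : R)) (z : R) (P : Polynomial (ZMod p)) (hP : P ≠ 0)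
    (hz : ∀ [Algebra (ZMod p) (R ⧸ Ideal.span {ϖ})],
      Polynomial.aeval (Ideal.Quotient.mk (Ideal.span {ϖ}) z) P = 0) :
    ∃ u, ϖ ∣ z - u ^ p := by
  have hpr : (Ideal.span {ϖ}).IsPrime := (Ideal.span_singleton_prime hϖ.ne_zero).2 hϖ
  have hch : CharP (R ⧸ Ideal.span {ϖ}) p := by
    rw [CharP.charP_iff_prime_eq_zero hpf.out, ← map_natCast (Ideal.Quotient.mk (Ideal.span {ϖ})),
      Ideal.Quotient.eq_zero_iff_mem, Ideal.mem_span_singleton]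
    exact hpϖ
  letI : Algebra (ZMod p) (R ⧸ Ideal.span {ϖ}) := ZMod.algebra _ p
  set y := Ideal.Quotient.mk (Ideal.span {ϖ}) z with hy
  have hint : IsIntegral (ZMod p) y :=
    IsAlgebraic.isIntegral (show IsAlgebraic (ZMod p) y from ⟨P, hP, hz⟩)
  let S := Algebra.adjoin (ZMod p) {y}
  have hfin : Module.Finite (ZMod p) S := Module.Finite.iff_fg.2 hint.fg_adjoin_singleton
  have hfS : Finite S := Module.finite_of_finite (ZMod p)
  have hchS : CharP S p := by
    rw [CharP.charP_iff_prime_eq_zero hpf.out]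
    ext
    push_cast
    exact CharP.cast_eq_zero _ p
  have hinj := frobenius_inj S p
  obtain ⟨s, hs⟩ := (Finite.injective_iff_surjective.1 hinj) ⟨y, Algebra.self_mem_adjoin_singleton _ _⟩
  obtain ⟨u, hu⟩ := Ideal.Quotient.mk_surjective (s : R ⧸ Ideal.span {ϖ})
  refine ⟨u, ?_⟩
  rw [← Ideal.mem_span_singleton, ← Ideal.Quotient.eq_zero_iff_mem, map_sub, map_pow, hu, ← hy,
    sub_eq_zero]
  have := congrArg Subtype.val hs
  rw [frobenius_def] at this
  exact this.symm

theorem perf_main {p : ℕ} [hpf : Fact p.Prime] (f : ℚ_[p] →+* L) (hwp : w (p : L) = 1)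
    (hmin : ∀ y : ℚ_[p], 0 < w (f y) → 1 ≤ w (f y))
    (halg : ∀ z : L, ∃ P : Polynomial ℚ_[p], P ≠ 0 ∧ P.eval₂ f z = 0)
    {ϖ : OO w} (hϖ : Prime ϖ) (hpϖ : ϖ ∣ (p : OO w)) (z : OO w) : ∃ u, ϖ ∣ z - u ^ p := by
  obtain ⟨P, hP, hPz⟩ := halg z
  -- a coefficient of maximal norm
  obtain ⟨i₀, hi₀, hmax⟩ := Finset.exists_max_image P.support (fun i => ‖P.coeff i‖)
    (Polynomial.nonempty_support_iff.2 hP)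
  have hc0 : P.coeff i₀ ≠ 0 := Polynomial.mem_support_iff.1 hi₀
  have hle : ∀ i, ‖P.coeff i / P.coeff i₀‖ ≤ 1 := by
    intro i
    rw [norm_div, div_le_one (norm_pos_iff.2 hc0)]
    by_cases hi : i ∈ P.support
    · exact hmax i hi
    · rw [Polynomial.notMem_support_iff.1 hi]; simp
  let b : ℕ → ℤ_[p] := fun i => ⟨P.coeff i / P.coeff i₀, hle i⟩
  have hb : ∀ i, ∃ n : ℕ, (p : ℤ_[p]) ∣ b i - n := by
    intro i
    obtain ⟨n, -, hn⟩ := PadicInt.exists_mem_range (b i)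
    rw [PadicInt.maximalIdeal_eq_span_p, Ideal.mem_span_singleton] at hn
    exact ⟨n, hn⟩
  choose n hn using hb
  choose r hr using hn
  have hn0 : ¬ p ∣ n i₀ := by
    intro h
    have h1 : b i₀ = 1 := by
      apply Subtype.ext
      change P.coeff i₀ / P.coeff i₀ = 1
      exact div_self hc0
    have h2 := hr i₀
    rw [h1] at h2
    have h3 : (p : ℤ_[p]) ∣ 1 := by
      have : (1 : ℤ_[p]) = p * r i₀ + n i₀ := by rw [← h2]; ring
      rw [this]
      exact dvd_add (dvd_mul_right _ _) (Nat.cast_dvd_cast h)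
    rw [← PadicInt.norm_lt_one_iff_dvd] at h3
    simp at h3
  let Q : Polynomial (ZMod p) := ∑ i ∈ P.support, Polynomial.C ((n i : ZMod p)) * Polynomial.X ^ i
  have hQ : Q ≠ 0 := by
    intro h
    have h1 : Q.coeff i₀ = (n i₀ : ZMod p) := by
      simp only [Q, Polynomial.finset_sum_coeff, Polynomial.coeff_C_mul, Polynomial.coeff_X_pow]
      simp
      intro h; exact absurd h hc0
    rw [h] at h1
    simp at h1
    exact hn0 ((ZMod.natCast_eq_zero_iff _ _).1 h1.symm)
  let rr : ℕ → OO w := fun i => ⟨f (r i), zp_int w f hwp hmin (r i)⟩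
  have hsum : ∑ i ∈ P.support, (n i : OO w) * z ^ i = -(p * ∑ i ∈ P.support, rr i * z ^ i) := by
    apply Subtype.ext
    push_cast
    have h1 : ∀ i, (n i : L) = f (P.coeff i) / f (P.coeff i₀) - p * f (r i) := by
      intro i
      have h2 := congrArg (fun t : ℤ_[p] => f (t : ℚ_[p])) (hr i)
      simp only [PadicInt.coe_sub, PadicInt.coe_mul, PadicInt.coe_natCast, map_sub, map_mul,
        map_natCast] at h2
      have h3 : f (b i : ℚ_[p]) = f (P.coeff i) / f (P.coeff i₀) := by
        rw [← map_div₀]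
      rw [← h3, ← h2]; ring
    rw [Polynomial.eval₂_eq_sum, Polynomial.sum] at hPz
    have h4 : ∑ i ∈ P.support, (n i : L) * (z : L) ^ i =
        (∑ i ∈ P.support, f (P.coeff i) * (z : L) ^ i) / f (P.coeff i₀) -
          p * ∑ i ∈ P.support, f (r i) * (z : L) ^ i := by
      rw [Finset.sum_div, Finset.mul_sum, ← Finset.sum_sub_distrib]
      refine Finset.sum_congr rfl fun i _ => ?_
      rw [h1]; ring
    rw [h4, hPz]
    simp [rr]
  refine perf_of_alg hϖ hpϖ z Q hQ ?_
  intro _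
  simp only [Q, map_sum, map_mul, map_pow, Polynomial.aeval_X, Polynomial.aeval_C, map_natCast]
  have := congrArg (Ideal.Quotient.mk (Ideal.span {ϖ})) hsum
  simp only [map_sum, map_mul, map_pow, map_natCast] at this
  rw [this, Ideal.Quotient.eq_zero_iff_mem, Ideal.mem_span_singleton, dvd_neg]
  exact hpϖ.mul_right _

@[reducible]
def actO {K : Type} [Field K] [Algebra K L] (hO : ∀ (σ : L ≃ₐ[K] L) (x : L), 0 ≤ w x → 0 ≤ w (σ x)) :
    MulSemiringAction (L ≃ₐ[K] L) (OO w) where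
  smul σ x := ⟨σ x, hO σ x x.2⟩
  one_smul x := rfl
  mul_smul σ τ x := rfl
  smul_zero σ := Subtype.ext (map_zero σ)
  smul_add σ x y := Subtype.ext (map_add σ _ _)
  smul_one σ := Subtype.ext (map_one σ)
  smul_mul σ x y := Subtype.ext (map_mul σ _ _)

theorem InMax_iff {p : ℕ} {A : Type} [Field A] (vd : PadicValData A p) (emb : L →+* A) {ϖ : L}
    (h0 : 0 < AVal vd emb ϖ) (hmin : ∀ y, 0 < AVal vd emb y → AVal vd emb ϖ ≤ AVal vd emb y)
    (hϖ0 : ϖ ≠ 0) (j : ℕ) (y : OO (AVal vd emb)) :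
    InMaxIdealPow vd emb j (emb y) ↔ (⟨ϖ, h0.le⟩ : OO (AVal vd emb)) ^ j ∣ y := by
  constructor
  · rintro ⟨u, s, hu, hs, h⟩
    have h1 : y = (⟨u, hu⟩ : OO (AVal vd emb)) * ∏ k, (⟨s k, (hs k).le⟩ : OO (AVal vd emb)) := by
      apply Subtype.ext
      push_cast
      apply emb.injective
      rw [h, map_mul, map_prod]
    rw [h1]
    refine Dvd.dvd.mul_left ?_ _
    have h2 : ∏ k : Fin j, (⟨ϖ, h0.le⟩ : OO (AVal vd emb)) ∣
        ∏ k, (⟨s k, (hs k).le⟩ : OO (AVal vd emb)) :=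
      Finset.prod_dvd_prod_of_dvd _ _ fun k _ =>
        (w_pos_iff (AVal vd emb) h0 hmin hϖ0 ⟨s k, (hs k).le⟩).2 (hs k)
    simpa using h2
  · rintro ⟨u, rfl⟩
    refine ⟨u, fun _ => ϖ, u.2, fun _ => h0, ?_⟩
    simp [mul_comm]

theorem InMax_nonneg {p : ℕ} {A : Type} [Field A] (vd : PadicValData A p) (emb : L →+* A)
    (j : ℕ) (y : L) (h : InMaxIdealPow vd emb j (emb y)) : 0 ≤ AVal vd emb y := by
  obtain ⟨u, s, hu, hs, h⟩ := h
  have h1 : y = u * ∏ k, s k := by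
    apply emb.injective
    rw [h, map_mul, map_prod]
  rw [h1]
  exact (OO (AVal vd emb)).mul_mem hu ((OO (AVal vd emb)).prod_mem fun k _ => (hs k).le)

end ConcretePart

section MidPart

variable {R G : Type} [CommRing R] [IsDomain R] [Group G] [MulSemiringAction G R]

def lowS (G : Type) [Group G] [MulSemiringAction G R] (ϖ : R) (i : ℤ) : Set G :=
  {σ | ∀ x : R, ϖ ^ (i + 1).toNat ∣ σ • x - x}

theorem lowS_eq (ϖ : R) (i : ℤ) (hi : 0 ≤ i) : lowS G ϖ i = (Rsub G ϖ i.toNat : Set G) := by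
  have : (i + 1).toNat = i.toNat + 1 := by omega
  ext σ
  change (∀ x : R, ϖ ^ (i + 1).toNat ∣ σ • x - x) ↔ ∀ x : R, ϖ ^ (i.toNat + 1) ∣ σ • x - x
  rw [this]

theorem mid [Fintype G] [FaithfulSMul G R] (hab : ∀ σ τ : G, σ * τ = τ * σ)
    {p n : ℕ} (hp : p.Prime) (hp3 : 3 ≤ p) (hn : 1 ≤ n) {ϖ : R} (hϖ : Prime ϖ)
    {e : ℕ} (he1 : 1 ≤ e) (he : ϖ ^ e ∣ (p : R)) (he' : ¬ ϖ ^ (e + 1) ∣ (p : R))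
    (hperf : ∀ z : R, ∃ u, ϖ ∣ z - u ^ p)
    (hsep : ∀ z : R, (∀ j : ℕ, ϖ ^ j ∣ z) → z = 0)
    (hN : (p : R) ∣ ∏ τ : G, τ • ϖ) {γ : G} (ψ : ℝ → ℝ)
    (hψ : ψ = Function.invFun (fun u : ℝ => ∫ t in (0:ℝ)..u,
      (Nat.card (lowS G ϖ ⌈t⌉) : ℝ) / (Nat.card (lowS G ϖ 0) : ℝ)))
    (U : ℤ → Set G) (hU : ∀ i, U i = lowS G ϖ ⌈ψ i⌉)
    (hU0 : U 0 = Set.univ) (hU01 : Nat.card (U 0) = (p - 1) * Nat.card (U 1))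
    (hUi : ∀ i : ℕ, 1 ≤ i → i ≤ n → Nat.card (U i) = p * Nat.card (U ((i : ℤ) + 1)))
    (hUn : U ((n : ℤ) + 1) = {1}) (hγ : γ ∈ U 1) (hgen : ∀ h ∈ U 1, ∃ k : ℕ, h = γ ^ k)
    {a x : R} (ha : ∀ σ : G, σ • a = a) {i : ℕ} (hi1 : 1 ≤ i) (hip : i < p) {u : R}
    (hu : ¬ ϖ ∣ u) (hx : x = ϖ ^ i * u) :
    ¬ ϖ ^ (p ^ n) ∣ (NN γ ^ (p ^ (n - 1) - 1)) (a + x) ∧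
      ϖ ^ (p ^ n) ∣ (NN γ ^ (p ^ (n - 1))) (a + x) := by
  set g : ℤ → ℝ := fun i => (Nat.card (lowS G ϖ i) : ℝ) with hgdef
  have hmono : ∀ i j : ℤ, i ≤ j → lowS G ϖ j ⊆ lowS G ϖ i := by
    intro i j hij σ hσ y
    exact (pow_dvd_pow _ (by omega)).trans (hσ y)
  have hg : Antitone g := by
    intro i j hij
    simp only [hgdef]
    exact_mod_cast Nat.card_mono (Set.toFinite _) (hmono i j hij)
  have hone : ∀ i, (1 : G) ∈ lowS G ϖ i := by
    intro i y; simp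
  have h1 : ∀ i, 1 ≤ g i := by
    intro i
    simp only [hgdef]
    have : Nonempty (lowS G ϖ i) := ⟨⟨1, hone i⟩⟩
    exact_mod_cast (Nat.card_pos : 0 < Nat.card (lowS G ϖ i))
  set φ : ℝ → ℝ := fun u => ∫ t in (0:ℝ)..u, g ⌈t⌉ / g 0 with hφ
  have hst : StrictMono φ := herb_strict hg h1
  have hφψ : ∀ k : ℝ, 0 ≤ k → φ (ψ k) = k := by
    intro k hk
    rw [hψ]
    exact Function.invFun_eq (herb_surj hg h1 hk)
  have hφ0 : φ 0 = 0 := by simp [hφ]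
  have hψ0 : ψ 0 = 0 := hst.injective (by rw [hφψ 0 le_rfl, hφ0])
  have hψ1 : 0 < ψ 1 := by
    rw [← hst.lt_iff_lt, hφψ 1 zero_le_one, hφ0]; exact one_pos
  have hl0 : lowS G ϖ 0 = Set.univ := by
    have := hU 0
    rw [hU0] at this
    simpa [hψ0] using this.symm
  have h0 : ∀ τ : G, Rm ϖ 0 τ := by
    intro τ
    have : τ ∈ lowS G ϖ 0 := by rw [hl0]; trivial
    rw [lowS_eq _ _ le_rfl] at this
    exact this
  -- cardinalities
  have hUcard : ∀ d : ℕ, d ≤ n → Nat.card (U ((n + 1 - d : ℕ) : ℤ)) = p ^ d := by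
    intro d
    induction d with
    | zero =>
      intro _
      have : ((n + 1 - 0 : ℕ) : ℤ) = (n : ℤ) + 1 := by push_cast; rfl
      rw [this, hUn]
      simp
    | succ d ih =>
      intro hd
      have h3 := hUi (n + 1 - (d + 1)) (by omega) (by omega)
      have h4 : (((n + 1 - (d + 1) : ℕ) : ℤ)) + 1 = ((n + 1 - d : ℕ) : ℤ) := by omega
      rw [h4, ih (by omega)] at h3
      rw [h3, pow_succ, mul_comm]
  have hc1 : Nat.card (U 1) = p ^ n := by
    have := hUcard n le_rfl
    rwa [show n + 1 - n = 1 by omega] at this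
  have hcn : Nat.card (U n) = p := by
    have := hUcard 1 hn
    rwa [show n + 1 - 1 = n by omega, pow_one] at this
  have hcard : Nat.card G = (p - 1) * p ^ n := by
    rw [← hc1, ← hU01, hU0, Nat.card_univ]
  have hc1pos : 1 ≤ ⌈ψ 1⌉ := Int.one_le_ceil_iff.2 hψ1
  have hU1 : U 1 = (Rsub G ϖ ⌈ψ 1⌉.toNat : Set G) := by
    rw [hU 1, Int.cast_one, lowS_eq _ _ (by omega)]
  have hγ1 : Rm ϖ 1 γ := by
    have : γ ∈ Rsub G ϖ ⌈ψ 1⌉.toNat := by rw [← SetLike.mem_coe, ← hU1]; exact hγ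
    exact Rm.mono this (by omega)
  have hord : orderOf γ = p ^ n := by
    have hz : (Subgroup.zpowers γ : Set G) = U 1 := by
      apply Set.Subset.antisymm
      · rw [hU1]
        have : Subgroup.zpowers γ ≤ Rsub G ϖ ⌈ψ 1⌉.toNat := by
          rw [Subgroup.zpowers_le, ← SetLike.mem_coe, ← hU1]; exact hγ
        exact this
      · intro h hh
        obtain ⟨k, rfl⟩ := hgen h hh
        exact Subgroup.npow_mem_zpowers γ k
    rw [← hc1, ← hz, ← Nat.card_zpowers]; rfl
  obtain ⟨hA, hB, hC, hD⟩ := core hab hp hp3 hn hϖ he1 he he' hperf hsep hcard h0 hN hγ1 hord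
  have hp1 : (0 : ℝ) < (p : ℝ) - 1 := by
    have : (3 : ℝ) ≤ p := by exact_mod_cast hp3
    linarith
  have hp0 : (0 : ℝ) < p := by linarith
  have hg0 : g 0 = ((p : ℝ) - 1) * p ^ n := by
    simp only [hgdef]
    rw [hl0, Nat.card_univ, hcard]
    rw [Nat.cast_mul, Nat.cast_pow, Nat.cast_sub hp.one_le, Nat.cast_one]
  have hψk : ∀ k : ℕ, k ≤ n → (p : ℝ) ^ k - 1 ≤ ψ k := by
    intro k hk
    rw [← hst.le_iff_le, hφψ k (by positivity)]
    apply herb_upper hg h1 hp.two_le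
    intro j hj t ht
    have ht0 : 0 ≤ t := le_trans (by positivity) ht
    have hgt : g t ≤ (p : ℝ) ^ (n - j) := by
      have h3 := hA j t.toNat (by omega) (by zify; rw [Int.toNat_of_nonneg ht0]; exact ht)
      simp only [hgdef]
      rw [lowS_eq _ _ ht0]
      exact_mod_cast h3
    rw [hg0, div_le_div_iff₀ (by positivity) (by positivity), one_mul]
    have h5 : (p : ℝ) ^ n = p ^ (n - j) * p ^ j := by rw [← pow_add, Nat.sub_add_cancel (by omega)]
    rw [h5]
    have : (0 : ℝ) < (p - 1) * p ^ j := by positivity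
    nlinarith [mul_le_mul_of_nonneg_right hgt this.le]
  have hUk : ∀ k : ℕ, k ≤ n → U k ⊆ (Rsub G ϖ (p ^ k - 1) : Set G) := by
    intro k hk
    have h3 : ((p ^ k - 1 : ℕ) : ℤ) ≤ ⌈ψ k⌉ := by
      have h4 := (hψk k hk).trans (Int.le_ceil _)
      rw [Nat.cast_sub (Nat.one_le_pow _ _ hp.pos)]
      push_cast
      exact_mod_cast h4
    have h6 := hmono _ _ h3
    rw [lowS_eq ϖ ((p ^ k - 1 : ℕ) : ℤ) (Int.natCast_nonneg _), Int.toNat_natCast] at h6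
    rw [hU]
    exact_mod_cast h6
  have hγp : Rm ϖ (p - 1) γ := by
    have := hUk 1 hn (by exact_mod_cast hγ)
    rw [pow_one] at this
    exact this
  have hσ : Rm ϖ (p ^ n - 1) (γ ^ p ^ (n - 1)) := by
    apply hC
    have := Nat.card_mono (Set.toFinite _) (hUk n le_rfl)
    rw [hcn] at this
    exact lt_of_lt_of_le hp.one_lt this
  exact final_comp hp hp3 hϖ hn he (hD hσ) he1 hperf hγp hσ hB ha hi1 hip hu hx

end MidPart

section

/-- Lemma 2.10, "N is nilpotent". Let `L/K` satisfy condition (ram)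
with parameter `n ≥ 1`, `G^1` cyclic with generator `γ`, and `K` unramified over `ℚ_p`.
Let `T` be the `k`-linear operator on `V := O_L/M_1` induced by `γ`, where
`M_1 := O_L·m_1 = m_L^{p^n}`, and put `N = T − 1`.  Then for every `α ∈ O_K + X`, where
`X = {x ∈ m_L : v_L(x) < p}`, one has `N^{p^{n−1}−1}·α ≠ 0` and `N^{p^{n−1}}·α = 0` in
`V`.  (The class of `(γ-1)^m α` in `V` is zero iff the element
`∑_{j≤m} (-1)^{m-j} C(m,j) γ^j(α) ∈ O_L` lies in `M_1 = m_L^{p^n}`.) -/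
theorem statement11 {p : ℕ} [Fact p.Prime] (hp : Odd p)
    {A : Type} [Field A] (vd : PadicValData A p)
    (K L : Type) [Field K] [Field L]
    [Algebra ℚ_[p] K] [FiniteDimensional ℚ_[p] K]
    [Algebra K L] [FiniteDimensional K L] [IsGalois K L]
    (emb : L →+* A)
    (hab : ∀ σ τ : L ≃ₐ[K] L, σ * τ = τ * σ)
    (π : K) (hπ : IsUniformizer vd (emb.comp (algebraMap K L)) π)
    (hunram : IsUniformizer vd (emb.comp (algebraMap K L)) (p : K))
    (n : ℕ) (hn : 1 ≤ n) (hram : RamCond vd K L emb n)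
    (γ : L ≃ₐ[K] L) (hγ : γ ∈ upperRamSet vd K L emb 1)
    (hγgen : ∀ h ∈ upperRamSet vd K L emb 1, ∃ k : ℕ, h = γ ^ k)
    (a : K) (ha : 0 ≤ vd.v ((emb.comp (algebraMap K L)) a))
    (x : L) (hx1 : InMaxIdealPow vd emb 1 (emb x)) (hxp : ¬ InMaxIdealPow vd emb p (emb x))
    (α : L) (hα : α = algebraMap K L a + x) :
    (¬ InMaxIdealPow vd emb (p ^ n)
      (emb (∑ j ∈ Finset.range (p ^ (n - 1) - 1 + 1),
        (((-1 : ℤ) ^ (p ^ (n - 1) - 1 - j) * ((p ^ (n - 1) - 1).choose j) : ℤ) : L)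
          * (γ ^ j) α))) ∧
    InMaxIdealPow vd emb (p ^ n)
      (emb (∑ j ∈ Finset.range (p ^ (n - 1) + 1),
        (((-1 : ℤ) ^ (p ^ (n - 1) - j) * ((p ^ (n - 1)).choose j) : ℤ) : L)
          * (γ ^ j) α)) := by
  have hpp : p.Prime := Fact.out
  have hp3 : 3 ≤ p := by
    have := hpp.two_le
    have : p ≠ 2 := by rintro rfl; exact absurd hp (by decide)
    omega
  set w := AVal vd emb with hw
  have hwa : ∀ y, w y = vd.v (emb y) := fun y => rfl
  have hwp : w (p : L) = 1 := by rw [hwa, map_natCast]; exact vd.v_coe_p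
  have hpL : (p : L) ≠ 0 := by
    rw [← AddValuation.ne_top_iff w, hwp]; simp
  -- uniformizer
  have hx0 : x ≠ 0 := by
    rintro rfl
    exact hxp ⟨0, fun _ => (p : L), by rw [← hwa]; simp, fun _ => by rw [← hwa, hwp]; simp, by simp⟩
  have hwx : 0 < w x := by
    obtain ⟨u, s, hu, hs, h⟩ := hx1
    have h1 : x = u * s 0 := by
      apply emb.injective
      rw [h]; simp
    rw [h1, AddValuation.map_mul]
    exact lt_of_lt_of_le (hs 0) (le_add_of_nonneg_left hu)
  have hxs : ∀ s, 0 < w s → w x < w (s ^ p) := by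
    intro s hs
    by_contra hcon
    push Not at hcon
    have hs0 : s ^ p ≠ 0 := by
      intro h0
      rw [h0, AddValuation.map_zero, top_le_iff, AddValuation.top_iff] at hcon
      exact hx0 hcon
    refine hxp ⟨x / s ^ p, fun _ => s, w_div w hs0 hcon, fun _ => hs, ?_⟩
    rw [Finset.prod_const, Finset.card_univ, Fintype.card_fin, ← map_pow, ← map_mul,
      div_mul_cancel₀ _ hs0]
  obtain ⟨ϖ, hϖ, hϖ0, hmin⟩ := exists_unif w hpp.pos hx0 hwx hxs
  obtain ⟨-, hr0, -, hr01, hri, hrn⟩ := hram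
  have hO : ∀ (σ : L ≃ₐ[K] L) (y : L), 0 ≤ w y → 0 ≤ w (σ y) := by
    intro σ y hy
    have hσ : σ ∈ upperRamSet vd K L emb 0 := by rw [hr0]; trivial
    have h1 := hσ y hy
    rw [← map_sub] at h1
    have h2 := InMax_nonneg vd emb _ _ h1
    have h3 := (OO w).add_mem h2 hy
    rwa [sub_add_cancel] at h3
  letI := actO w hO
  have hsm : ∀ (σ : L ≃ₐ[K] L) (y : OO w), ((σ • y : OO w) : L) = σ y := fun σ y => rfl
  haveI : FaithfulSMul (L ≃ₐ[K] L) (OO w) := by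
    refine ⟨fun {σ τ} h => ?_⟩
    ext y
    rcases le_total 0 (w y) with hy | hy
    · exact congrArg Subtype.val (h ⟨y, hy⟩)
    · rcases eq_or_ne y 0 with rfl | hy0
      · simp
      have hy' : 0 ≤ w (y⁻¹) := by
        have := w_div w hy0 (x := 1) (by simpa using hy)
        simpa using this
      have h1 : σ y⁻¹ = τ y⁻¹ := congrArg Subtype.val (h ⟨y⁻¹, hy'⟩)
      rw [map_inv₀, map_inv₀] at h1
      exact inv_injective h1
  let P : OO w := ⟨ϖ, hϖ.le⟩
  have hP : Prime P := unif_prime w hϖ hmin hϖ0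
  have hlow : ∀ i, lowerRamSet vd K L emb i = lowS (L ≃ₐ[K] L) P i := by
    intro i
    ext σ
    constructor
    · intro h y
      have h1 := h y y.2
      rw [← map_sub] at h1
      exact (InMax_iff vd emb hϖ hmin hϖ0 _ (σ • y - y)).1 h1
    · intro h y hy
      have h1 := (InMax_iff vd emb hϖ hmin hϖ0 _ _).2 (h ⟨y, hy⟩)
      rw [← map_sub]
      exact h1
  -- absolute ramification index
  have hpO : ((p : OO w) : L) = (p : L) := by push_cast; rfl
  have hPp : P ∣ (p : OO w) := by
    rw [w_pos_iff w hϖ hmin hϖ0, hpO, hwp]; simp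
  have hex : ∃ j : ℕ, ¬ P ^ j ∣ (p : OO w) := by
    by_contra hcon
    push Not at hcon
    have := unif_sep w hϖ hϖ0 _ hcon
    apply hpL
    rw [← hpO, this]; rfl
  obtain ⟨e, he1, he, he'⟩ : ∃ e : ℕ, 1 ≤ e ∧ P ^ e ∣ (p : OO w) ∧ ¬ P ^ (e + 1) ∣ (p : OO w) := by
    classical
    have h2 : 2 ≤ Nat.find hex := by
      rw [Nat.le_find_iff]
      intro m hm
      interval_cases m <;> simp [hPp]
    refine ⟨Nat.find hex - 1, by omega, ?_, ?_⟩
    · have := Nat.find_min hex (m := Nat.find hex - 1) (by omega)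
      push Not at this
      exact this
    · rw [show Nat.find hex - 1 + 1 = Nat.find hex by omega]
      exact Nat.find_spec hex
  have hKmin : ∀ y : K, 0 < w (algebraMap K L y) → 1 ≤ w (algebraMap K L y) := by
    intro y hy
    have h1 := hunram.2.2 y hy
    have h2 : vd.v ((emb.comp (algebraMap K L)) (p : K)) = 1 := by
      rw [map_natCast]; exact vd.v_coe_p
    rw [h2] at h1
    exact h1
  have hperf : ∀ z : OO w, ∃ u, P ∣ z - u ^ p := by
    intro z
    refine perf_main w ((algebraMap K L).comp (algebraMap ℚ_[p] K)) hwp ?_ ?_ hP hPp z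
    · intro y hy
      exact hKmin _ hy
    · intro z
      letI : Algebra ℚ_[p] L := ((algebraMap K L).comp (algebraMap ℚ_[p] K)).toAlgebra
      haveI : IsScalarTower ℚ_[p] K L := IsScalarTower.of_algebraMap_eq fun _ => rfl
      haveI : Algebra.IsAlgebraic ℚ_[p] L := Algebra.IsAlgebraic.trans ℚ_[p] K L
      obtain ⟨Q, hQ, hQz⟩ := Algebra.IsAlgebraic.isAlgebraic (R := ℚ_[p]) z
      exact ⟨Q, hQ, hQz⟩
  have hN : (p : OO w) ∣ ∏ τ : L ≃ₐ[K] L, τ • P := by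
    have h1 : ((∏ τ : L ≃ₐ[K] L, τ • P : OO w) : L) = algebraMap K L (Algebra.norm K ϖ) := by
      rw [Algebra.norm_eq_prod_automorphisms]
      push_cast
      rfl
    have h2 : P ∣ ∏ τ : L ≃ₐ[K] L, τ • P := by
      have := Finset.dvd_prod_of_mem (fun τ : L ≃ₐ[K] L => τ • P) (Finset.mem_univ 1)
      simpa using this
    rw [w_pos_iff w hϖ hmin hϖ0, h1] at h2
    rw [OO_dvd w (by rw [hpO]; exact hpL), h1, hpO, hwp]
    exact hKmin _ h2
  -- the element x
  let X : OO w := ⟨x, hwx.le⟩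
  have hPX : P ∣ X := (w_pos_iff w hϖ hmin hϖ0 X).2 hwx
  have hPXp : ¬ P ^ p ∣ X := fun h => hxp ((InMax_iff vd emb hϖ hmin hϖ0 p X).2 h)
  obtain ⟨i, hi1, hip, u, hu, hxu⟩ : ∃ i, 1 ≤ i ∧ i < p ∧ ∃ u, ¬ P ∣ u ∧ X = P ^ i * u := by
    classical
    have hex2 : ∃ j : ℕ, ¬ P ^ j ∣ X := ⟨p, hPXp⟩
    have h2 : 2 ≤ Nat.find hex2 := by
      rw [Nat.le_find_iff]
      intro m hm
      interval_cases m <;> simp [hPX]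
    have h3 : Nat.find hex2 ≤ p := Nat.find_min' hex2 hPXp
    have h4 := Nat.find_min hex2 (m := Nat.find hex2 - 1) (by omega)
    push Not at h4
    obtain ⟨u, hu⟩ := h4
    refine ⟨Nat.find hex2 - 1, by omega, by omega, u, ?_, hu⟩
    rintro ⟨v, rfl⟩
    apply Nat.find_spec hex2
    refine ⟨v, ?_⟩
    refine hu.trans ?_
    rw [← mul_assoc, ← pow_succ, show Nat.find hex2 - 1 + 1 = Nat.find hex2 by omega]
  let a' : OO w := ⟨algebraMap K L a, ha⟩
  have ha' : ∀ σ : L ≃ₐ[K] L, σ • a' = a' := fun σ => Subtype.ext (σ.commutes a)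
  have hfun : lowerRamSet vd K L emb = lowS (L ≃ₐ[K] L) P := funext hlow
  have key := mid hab hpp hp3 hn hP he1 he he' hperf (unif_sep w hϖ hϖ0) hN (γ := γ)
    (herbrandPsi vd K L emb)
    (by
      funext k
      unfold herbrandPsi herbrandPhi
      rw [hfun])
    (upperRamSet vd K L emb) (fun i => by unfold upperRamSet; rw [hfun])
    hr0 hr01 hri hrn hγ hγgen ha' hi1 hip hu hxu
  have hsum : ∀ m : ℕ, emb (∑ j ∈ Finset.range (m + 1),
      (((-1 : ℤ) ^ (m - j) * (m.choose j) : ℤ) : L) * (γ ^ j) α) =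
      emb (((NN γ ^ m) (a' + X) : OO w) : L) := by
    intro m
    rw [NN_pow_expand]
    congr 1
    rw [AddSubmonoidClass.coe_finset_sum]
    refine Finset.sum_congr rfl fun j _ => ?_
    rw [hα]
    rfl
  rw [hsum, hsum]
  exact ⟨fun h => key.1 ((InMax_iff vd emb hϖ hmin hϖ0 _ _).1 h),
    (InMax_iff vd emb hϖ hmin hϖ0 _ _).2 key.2⟩

end
end

section
/- Let p be an odd prime, Ψ an unramified extension of ℚ_p with integer ring O, and Ψ_∞/Ψ a totally ramified ℤ_p-extension with n-th layer Ψ_n and integer ring R_n. Then there exists a system of uniformizers (π_n)_{n≥0}, with π_n a uniformizer of R_n, such that π_{n+1}^p ≡ π_n mod p·R_{n+1} for all n ≥ 0. -/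
noncomputable section

open scoped Classical

variable {p : ℕ} {A : Type} [Field A]

/-- `layer` is the tower of layers of a totally ramified `ℤ_p`-extension `Ψ_∞/Ψ`:
`layer n = Ψ_n` is the `n`-th layer, i.e. the unique subextension with
`Gal(Ψ_n/Ψ) ≅ ℤ/p^n`; each layer is Galois and cyclic of degree `p^n` over `Ψ`,
the layers are increasing with union `Ψ_∞`, and each `Ψ_n/Ψ` is totally ramified
(witnessed by a uniformizer of `Ψ_n` of valuation `p^{-n}`, `Ψ` being unramified
over `ℚ_p`). -/
def IsZpExtensionTower (vd : PadicValData A p) (Ψ Ψinf : Type) [Field Ψ] [Field Ψinf]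
    [Algebra Ψ Ψinf] (emb : Ψinf →+* A)
    (layer : ℕ → IntermediateField Ψ Ψinf) : Prop :=
  layer 0 = ⊥ ∧
  (∀ n, layer n ≤ layer (n + 1)) ∧
  (⨆ n, layer n) = ⊤ ∧
  (∀ n, IsGalois Ψ ↥(layer n)) ∧
  (∀ n, IsCyclic (↥(layer n) ≃ₐ[Ψ] ↥(layer n))) ∧
  (∀ n, Nat.card (↥(layer n) ≃ₐ[Ψ] ↥(layer n)) = p ^ n) ∧
  (∀ n, ∃ x : ↥(layer n),
    IsUniformizer vd (emb.comp ((layer n).val : ↥(layer n) →+* Ψinf)) x ∧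
    vd.v ((emb.comp ((layer n).val : ↥(layer n) →+* Ψinf)) x)
      = ((((p : ℚ) ^ n)⁻¹ : ℚ) : WithTop ℚ))

end


namespace ZpT

set_option linter.unusedSectionVars false
set_option linter.unusedSimpArgs false

/-- distinct valuations -/
lemma sum_distinct {L : Type*} [Field L] (w : AddValuation L (WithTop ℤ)) {ι : Type*}
    (s : Finset ι) (f : ι → L)
    (h : ∀ i ∈ s, ∀ j ∈ s, i ≠ j → f i ≠ 0 → w (f i) ≠ w (f j)) :
    (∀ i ∈ s, w (∑ i ∈ s, f i) ≤ w (f i)) ∧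
      (s.Nonempty → ∃ i ∈ s, w (∑ i ∈ s, f i) = w (f i)) := by
  classical
  induction s using Finset.induction_on with
  | empty => simp
  | insert a s ha ih =>
    obtain ⟨ih1, ih2⟩ := ih (fun i hi j hj => h i (Finset.mem_insert_of_mem hi) j (Finset.mem_insert_of_mem hj))
    rw [Finset.sum_insert ha]
    by_cases hne : w (f a) = w (∑ i ∈ s, f i)
    · have h0 : f a = 0 := by
        by_contra h0
        rcases s.eq_empty_or_nonempty with rfl | hs
        · simp at hne
          exact h0 hne
        · obtain ⟨i, hi, hi2⟩ := ih2 hs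
          refine h a (Finset.mem_insert_self a s) i (Finset.mem_insert_of_mem hi) ?_ h0 (hne.trans hi2)
          rintro rfl; exact ha hi
      rw [h0, zero_add]
      have : w (∑ i ∈ s, f i) = ⊤ := by rw [← hne, h0, AddValuation.map_zero]
      constructor
      · intro i hi
        rcases Finset.mem_insert.1 hi with rfl | hi
        · rw [h0]; simp
        · exact ih1 i hi
      · intro _
        exact ⟨a, Finset.mem_insert_self a s, by rw [h0, this]; simp⟩
    · rw [AddValuation.map_add_of_distinct_val _ hne]
      constructor
      · intro i hi
        rcases Finset.mem_insert.1 hi with rfl | hi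
        · exact min_le_left _ _
        · exact (min_le_right _ _).trans (ih1 i hi)
      · intro _
        rcases le_total (w (f a)) (w (∑ i ∈ s, f i)) with h1 | h1
        · exact ⟨a, Finset.mem_insert_self a s, min_eq_left h1⟩
        · rcases s.eq_empty_or_nonempty with rfl | hs
          · refine ⟨a, Finset.mem_insert_self _ _, ?_⟩
            simp
          · obtain ⟨i, hi, hi2⟩ := ih2 hs
            exact ⟨i, Finset.mem_insert_of_mem hi, by rw [min_eq_right h1, hi2]⟩

structure RS (p N : ℕ) (K L : Type*) [Field K] [Field L] [Algebra K L]
    (w : AddValuation L (WithTop ℤ)) (π : L) : Prop where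
  hK : ∀ c : K, c ≠ 0 → ∃ a : ℤ, w (algebraMap K L c) = (((p : ℤ) ^ N * a : ℤ) : WithTop ℤ)
  hfr : Module.finrank K L = p ^ N
  hp : w (p : L) = (((p : ℤ) ^ N : ℤ) : WithTop ℤ)
  hpi : w π = ((1 : ℤ) : WithTop ℤ)
  hinv : ∀ (σ : L ≃ₐ[K] L) x, w (σ x) = w x
  hord : ∀ σ : L ≃ₐ[K] L, σ ^ (p ^ N) = 1

section
variable {p N : ℕ} [hpp : Fact p.Prime] {K L : Type*} [Field K] [Field L] [Algebra K L]
    {w : AddValuation L (WithTop ℤ)} {π : L}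

lemma term_val (h : RS p N K L w π) (x : ℕ → L) (hx : ∀ b, w (x b) = ((b : ℤ) : WithTop ℤ))
    (c : K) (hc : c ≠ 0) (b : ℕ) :
    ∃ a : ℤ, w (algebraMap K L c * x b) = (((p : ℤ) ^ N * a + b : ℤ) : WithTop ℤ) := by
  obtain ⟨a, ha⟩ := h.hK c hc
  exact ⟨a, by rw [AddValuation.map_mul, ha, hx]; norm_cast⟩

lemma eq_of_q {q : ℤ} {b b' : ℕ} {a a' : ℤ} (hb : (b : ℤ) < q) (hb' : (b' : ℤ) < q)
    (h : q * a + b = q * a' + b') : b = b' := by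
  have h1 : (q * a + b) % q = b := by
    rw [Int.mul_add_emod_self_left, Int.emod_eq_of_lt (by positivity) hb]
  have h2 : (q * a' + b') % q = b' := by
    rw [Int.mul_add_emod_self_left, Int.emod_eq_of_lt (by positivity) hb']
  rw [h, h2] at h1
  exact_mod_cast h1.symm

lemma expand (h : RS p N K L w π) (x : ℕ → L) (hx : ∀ b, w (x b) = ((b : ℤ) : WithTop ℤ)) (y : L) :
    ∃ c : ℕ → K, y = ∑ b ∈ Finset.range (p ^ N), algebraMap K L (c b) * x b ∧
      ∀ b < p ^ N, w y ≤ w (algebraMap K L (c b) * x b) := by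
  have hdist : ∀ c : ℕ → K, ∀ b < p ^ N, w (∑ b ∈ Finset.range (p ^ N), algebraMap K L (c b) * x b)
      ≤ w (algebraMap K L (c b) * x b) := by
    intro c b hb
    refine (sum_distinct w (Finset.range (p ^ N)) (fun b => algebraMap K L (c b) * x b) ?_).1 b (by simpa using hb)
    intro i hi j hj hij hfi heq
    simp only [Finset.mem_range] at hi hj
    have hci : c i ≠ 0 := by rintro h0; simp [h0] at hfi
    obtain ⟨a, ha⟩ := term_val h x hx (c i) hci i
    have hcj : c j ≠ 0 := by
      rintro h0
      simp only [h0, map_zero, zero_mul, AddValuation.map_zero, ha] at heq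
      exact WithTop.coe_ne_top heq
    obtain ⟨a', ha'⟩ := term_val h x hx (c j) hcj j
    simp only [ha, ha', WithTop.coe_inj] at heq
    exact hij (eq_of_q (by exact_mod_cast hi) (by exact_mod_cast hj) heq)
  have hx0 : ∀ b, x b ≠ 0 := by
    intro b h0
    have := hx b
    rw [h0, AddValuation.map_zero] at this
    exact WithTop.top_ne_coe this
  have hli : LinearIndependent K (fun b : Fin (p ^ N) => x b) := by
    rw [Fintype.linearIndependent_iff]
    intro g hg i
    by_contra hgi
    let c : ℕ → K := fun b => if hb : b < p ^ N then g ⟨b, hb⟩ else 0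
    have hs : ∑ b ∈ Finset.range (p ^ N), algebraMap K L (c b) * x b = 0 := by
      rw [← hg, ← Fin.sum_univ_eq_sum_range (fun b => algebraMap K L (c b) * x b)]
      refine Finset.sum_congr rfl fun b _ => ?_
      simp [c, Algebra.smul_def]
    have := hdist c i i.2
    rw [hs, AddValuation.map_zero, top_le_iff, AddValuation.top_iff] at this
    simp [c, hx0] at this
    exact hgi this
  have : FiniteDimensional K L := FiniteDimensional.of_finrank_pos (by rw [h.hfr]; exact pow_pos hpp.out.pos _)
  have hsp := hli.span_eq_top_of_card_eq_finrank' (by simp [h.hfr])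
  have hy : y ∈ Submodule.span K (Set.range (fun b : Fin (p ^ N) => x b)) := by rw [hsp]; trivial
  obtain ⟨g, hg⟩ := (Submodule.mem_span_range_iff_exists_fun K).1 hy
  let c : ℕ → K := fun b => if hb : b < p ^ N then g ⟨b, hb⟩ else 0
  have hs : y = ∑ b ∈ Finset.range (p ^ N), algebraMap K L (c b) * x b := by
    rw [← hg, ← Fin.sum_univ_eq_sum_range (fun b => algebraMap K L (c b) * x b)]
    refine Finset.sum_congr rfl fun b _ => ?_
    simp [c, Algebra.smul_def]
  refine ⟨c, hs, fun b hb => ?_⟩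
  have := hdist c b hb
  rwa [← hs] at this

lemma wpow (h : RS p N K L w π) (b : ℕ) : w (π ^ b) = ((b : ℤ) : WithTop ℤ) := by
  rw [AddValuation.map_pow, h.hpi]
  norm_cast
  simp

lemma pi_ne (h : RS p N K L w π) : π ≠ 0 := by
  intro h0
  have := h.hpi
  rw [h0, AddValuation.map_zero] at this
  exact WithTop.top_ne_coe this

/-- `ρ - 1` raises the valuation by at least `c` -/
def Lift (K L : Type*) [Field K] [Field L] [Algebra K L]
    (w : AddValuation L (WithTop ℤ)) (ρ : L ≃ₐ[K] L) (c : ℤ) : Prop :=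
  ∀ x, w x + (c : WithTop ℤ) ≤ w (ρ x - x)

lemma lift_of (h : RS p N K L w π) (ρ : L ≃ₐ[K] L) (c : ℤ)
    (hc : ((1 + c : ℤ) : WithTop ℤ) ≤ w (ρ π - π)) : Lift K L w ρ c := by
  have hpow : ∀ b : ℕ, ((b + c : ℤ) : WithTop ℤ) ≤ w (ρ (π ^ b) - π ^ b) := by
    intro b
    induction b with
    | zero => simp
    | succ b ih =>
      have : ρ (π ^ (b + 1)) - π ^ (b + 1) = ρ (π ^ b) * (ρ π - π) + (ρ (π ^ b) - π ^ b) * π := by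
        rw [pow_succ, map_mul]; ring
      rw [this]
      refine w.map_le_add ?_ ?_
      · rw [AddValuation.map_mul, h.hinv, wpow h]
        refine le_trans (le_of_eq ?_) (add_le_add_right hc _)
        norm_cast; push_cast; ring
      · rw [AddValuation.map_mul, h.hpi]
        refine le_trans (le_of_eq ?_) (add_le_add_left ih _)
        norm_cast; push_cast; ring
  intro x
  obtain ⟨a, ha, hb⟩ := expand h (fun b => π ^ b) (wpow h) x
  have : ρ x - x = ∑ b ∈ Finset.range (p ^ N), algebraMap K L (a b) * (ρ (π ^ b) - π ^ b) := by
    conv_lhs => rw [ha]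
    rw [map_sum, ← Finset.sum_sub_distrib]
    refine Finset.sum_congr rfl fun b _ => ?_
    rw [map_mul, AlgEquiv.commutes]; ring
  rw [this]
  refine w.map_le_sum fun b hb' => ?_
  have h1 := hb b (by simpa using hb')
  refine (add_le_add_left h1 _).trans ?_
  rw [AddValuation.map_mul, AddValuation.map_mul, wpow h, add_assoc]
  refine add_le_add_right ?_ _
  exact_mod_cast hpow b

lemma lift_one (c : ℤ) : Lift K L w 1 c := by
  intro x; simp

lemma lift_mul (h : RS p N K L w π) {ρ ρ' : L ≃ₐ[K] L} {c : ℤ} (h1 : Lift K L w ρ c)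
    (h2 : Lift K L w ρ' c) : Lift K L w (ρ * ρ') c := by
  intro x
  have : (ρ * ρ') x - x = ρ (ρ' x - x) + (ρ x - x) := by
    rw [AlgEquiv.mul_apply, map_sub]; ring
  rw [this]
  refine w.map_le_add ?_ (h1 x)
  rw [h.hinv]; exact h2 x

lemma lift_pow (h : RS p N K L w π) {ρ : L ≃ₐ[K] L} {c : ℤ} (h1 : Lift K L w ρ c) (m : ℕ) :
    Lift K L w (ρ ^ m) c := by
  induction m with
  | zero => rw [pow_zero]; exact lift_one c
  | succ m ih => rw [pow_succ]; exact lift_mul h ih h1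

lemma eq_one_of_fix (h : RS p N K L w π) (ρ : L ≃ₐ[K] L) (hρ : ρ π = π) : ρ = 1 := by
  ext x
  obtain ⟨a, ha, hb⟩ := expand h (fun b => π ^ b) (wpow h) x
  rw [ha, map_sum]
  simp [hρ]

/-- integers -/
def intR (w : AddValuation L (WithTop ℤ)) : Subring L where
  carrier := {x | 0 ≤ w x}
  mul_mem' := by
    intro a b ha hb
    simp only [Set.mem_ofPred_eq] at *
    rw [AddValuation.map_mul]; exact add_nonneg ha hb
  one_mem' := by simp
  add_mem' := by
    intro a b ha hb
    exact w.map_le_add ha hb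
  zero_mem' := by simp
  neg_mem' := by
    intro a ha
    simp only [Set.mem_ofPred_eq, AddValuation.map_neg] at *
    exact ha

lemma mem_intR (x : L) : x ∈ intR w ↔ 0 ≤ w x := Iff.rfl

lemma wpos (h : RS p N K L w π) : ((1 : ℤ) : WithTop ℤ) ≤ w (p : L) := by
  rw [h.hp]
  have := Nat.pos_of_ne_zero (pow_ne_zero N hpp.out.ne_zero)
  norm_cast

lemma pow_add_mod (x y : L) (hx : 0 ≤ w x) (hy : 0 ≤ w y) (n : ℕ) :
    ∃ r, 0 ≤ w r ∧ (x + y) ^ p ^ n = x ^ p ^ n + y ^ p ^ n + p * r := by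
  obtain ⟨r, hr⟩ := exists_add_pow_prime_pow_eq hpp.out (⟨x, hx⟩ : intR w) ⟨y, hy⟩ n
  refine ⟨x * y * r, ?_, ?_⟩
  · rw [AddValuation.map_mul, AddValuation.map_mul]
    exact add_nonneg (add_nonneg hx hy) r.2
  · have := congrArg (Subtype.val) hr
    simp at this
    rw [this]; ring

lemma wild (h : RS p N K L w π) (ρ : L ≃ₐ[K] L) : Lift K L w ρ 1 := by
  apply lift_of h
  have hpi0 := pi_ne h
  obtain ⟨a, ha, hb⟩ := expand h (fun b => π ^ b) (wpow h) (ρ π / π)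
  have hu : w (ρ π / π) = 0 := by
    rw [AddValuation.map_div, h.hinv, h.hpi]; norm_cast
  have hq : 0 < p ^ N := pow_pos hpp.out.pos _
  set c : L := algebraMap K L (a 0) with hc
  have hwc : 0 ≤ w c := by
    have := hb 0 hq
    rw [hu] at this
    simpa using this
  have hr : ((1 : ℤ) : WithTop ℤ) ≤ w (ρ π / π - c) := by
    rw [← Finset.sum_range_add_sum_Ico _ (Nat.one_le_iff_ne_zero.2 hq.ne')] at ha
    simp only [Finset.sum_range_one, pow_zero, mul_one] at ha
    rw [ha, hc, add_sub_cancel_left]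
    refine w.map_le_sum fun b hb' => ?_
    simp only [Finset.mem_Ico] at hb'
    have h1 := hb b hb'.2
    rw [hu] at h1
    by_cases hab : a b = 0
    · simp [hab]
    obtain ⟨t, ht⟩ := term_val h (fun b => π ^ b) (wpow h) (a b) hab b
    rw [ht] at h1 ⊢
    norm_cast at h1 ⊢
    have hne : (p:ℤ) ^ N * t + b ≠ 0 := by
      intro h0
      have := eq_of_q (q := (p : ℤ) ^ N) (b := b) (b' := 0) (a := t) (a' := 0)
        (by exact_mod_cast hb'.2) (by exact_mod_cast hq) (by simpa using h0)
      omega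
    push_cast at h1 ⊢
    omega
  have hstep : ((2 : ℤ) : WithTop ℤ) ≤ w (ρ π - c * π) := by
    have : ρ π - c * π = (ρ π / π - c) * π := by field_simp
    rw [this, AddValuation.map_mul, h.hpi]
    exact le_trans (by norm_cast) (add_le_add_left hr _)
  have hit : ∀ j : ℕ, ((2 : ℤ) : WithTop ℤ) ≤ w ((ρ ^ j) π - c ^ j * π) := by
    intro j
    induction j with
    | zero => simp
    | succ j ih =>
      have : (ρ ^ (j + 1)) π - c ^ (j + 1) * π = ρ ((ρ ^ j) π - c ^ j * π) + c ^ j * (ρ π - c * π) := by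
        rw [pow_succ' ρ, AlgEquiv.mul_apply, map_sub, map_mul, map_pow, hc, AlgEquiv.commutes]; ring
      rw [this]
      refine w.map_le_add ?_ ?_
      · rwa [h.hinv]
      · rw [AddValuation.map_mul]
        refine hstep.trans (le_add_of_nonneg_left ?_)
        rw [AddValuation.map_pow]; exact nsmul_nonneg hwc _
  have hc1 : ((1 : ℤ) : WithTop ℤ) ≤ w (c ^ p ^ N - 1) := by
    have h1 := hit (p ^ N)
    rw [h.hord] at h1
    have : (1 : L ≃ₐ[K] L) π - c ^ p ^ N * π = - ((c ^ p ^ N - 1) * π) := by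
      rw [AlgEquiv.one_apply]; ring
    rw [this, AddValuation.map_neg, AddValuation.map_mul, h.hpi] at h1
    by_contra hlt
    rw [not_le] at hlt
    obtain ⟨t, ht⟩ := WithTop.ne_top_iff_exists.1 hlt.ne_top
    rw [← ht] at h1 hlt
    norm_cast at h1 hlt
    omega
  have hm : 0 ≤ w (c - 1) := by
    have := (intR w).sub_mem (x := c) (y := 1) hwc (by simp [mem_intR])
    exact this
  obtain ⟨r, hr0, hr1⟩ := pow_add_mod (p := p) (w := w) (c - 1) 1 hm (by simp) N
  have hcc : ((1 : ℤ) : WithTop ℤ) ≤ w ((c - 1) ^ p ^ N) := by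
    have : (c - 1) ^ p ^ N = (c ^ p ^ N - 1) - p * r := by
      rw [sub_add_cancel] at hr1; rw [hr1]; ring
    rw [this]
    refine w.map_le_sub hc1 ?_
    rw [AddValuation.map_mul]
    exact (wpos h).trans (le_add_of_nonneg_right hr0)
  have hc2 : ((1 : ℤ) : WithTop ℤ) ≤ w (c - 1) := by
    by_contra hlt
    rw [not_le] at hlt
    obtain ⟨t, ht⟩ := WithTop.ne_top_iff_exists.1 hlt.ne_top
    rw [AddValuation.map_pow] at hcc
    rw [← ht] at hcc hlt hm
    norm_cast at hm hlt
    have : t = 0 := by omega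
    rw [this] at hcc
    simp at hcc
    norm_cast at hcc
  have : ρ π - π = (ρ π - c * π) + (c - 1) * π := by ring
  rw [this]
  refine w.map_le_add (le_trans (by norm_cast) hstep) ?_
  rw [AddValuation.map_mul, h.hpi]
  exact le_trans (by norm_cast) (add_le_add_left hc2 _)

end
end ZpT

namespace ZpT
set_option linter.unusedSectionVars false
set_option linter.unusedSimpArgs false
section
variable {p N : ℕ} [hpp : Fact p.Prime] {K L : Type*} [Field K] [Field L] [Algebra K L]
    {w : AddValuation L (WithTop ℤ)} {π : L}

lemma S_gt (h : RS p N K L w π) (ρ : L ≃ₐ[K] L) (x : L) :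
    w x + ((1 : ℤ) : WithTop ℤ) ≤ w (∑ j ∈ Finset.range p, (ρ ^ j) x) := by
  have : ∑ j ∈ Finset.range p, (ρ ^ j) x = x * p + ∑ j ∈ Finset.range p, ((ρ ^ j) x - x) := by
    rw [Finset.sum_sub_distrib]; simp; ring
  rw [this]
  refine w.map_le_add ?_ (w.map_le_sum fun j _ => wild h _ x)
  rw [AddValuation.map_mul]
  exact add_le_add_right (wpos h) _

lemma S_tel (τ : L ≃ₐ[K] L) (x : L) :
    τ (∑ j ∈ Finset.range p, (τ ^ j) x) - ∑ j ∈ Finset.range p, (τ ^ j) x = (τ ^ p) x - x := by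
  rw [map_sum]
  have : ∀ j ∈ Finset.range p, τ ((τ ^ j) x) = (τ ^ (j + 1)) x := by
    intro j _
    rw [pow_succ', AlgEquiv.mul_apply]
  rw [Finset.sum_congr rfl this, ← Finset.sum_sub_distrib, Finset.sum_range_sub (fun j => (τ ^ j) x)]
  simp

noncomputable def J (w : AddValuation L (WithTop ℤ)) (π : L) (ρ : L ≃ₐ[K] L) : ℤ :=
  (w (ρ π - π)).untopD 0 - 1

lemma J_spec (h : RS p N K L w π) {ρ : L ≃ₐ[K] L} (hρ : ρ ≠ 1) :
    w (ρ π - π) = ((1 + J w π ρ : ℤ) : WithTop ℤ) := by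
  have : w (ρ π - π) ≠ ⊤ := by
    rw [AddValuation.ne_top_iff, sub_ne_zero]
    exact fun h0 => hρ (eq_one_of_fix h ρ h0)
  obtain ⟨t, ht⟩ := WithTop.ne_top_iff_exists.1 this
  rw [J, ← ht]
  simp

lemma lift_J (h : RS p N K L w π) {ρ : L ≃ₐ[K] L} (hρ : ρ ≠ 1) : Lift K L w ρ (J w π ρ) :=
  lift_of h ρ _ (J_spec h hρ).ge

lemma le_J (h : RS p N K L w π) {ρ : L ≃ₐ[K] L} (hρ : ρ ≠ 1) {c : ℤ} (hc : Lift K L w ρ c) :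
    c ≤ J w π ρ := by
  have := hc π
  rw [J_spec h hρ, h.hpi] at this
  norm_cast at this
  omega

lemma J_pos (h : RS p N K L w π) {ρ : L ≃ₐ[K] L} (hρ : ρ ≠ 1) : 1 ≤ J w π ρ :=
  le_J h hρ (wild h ρ)

lemma J_lt (h : RS p N K L w π) {ρ : L ≃ₐ[K] L} (hρ : ρ ^ p ≠ 1) : J w π ρ < J w π (ρ ^ p) := by
  have h1 : ρ ≠ 1 := by rintro rfl; simp at hρ
  have : Lift K L w (ρ ^ p) (J w π ρ + 1) := by
    intro x
    rw [← S_tel]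
    refine le_trans ?_ (lift_J h h1 _)
    refine le_trans (le_of_eq ?_) (add_le_add_left (S_gt h ρ x) _)
    rw [add_assoc]; congr 1; norm_cast; ring
  have := le_J h hρ this
  omega

lemma J_coprime (h : RS p N K L w π) {ρ : L ≃ₐ[K] L} (hρ : ρ ≠ 1) {m : ℕ} (hm : ¬ p ∣ m) :
    ρ ^ m ≠ 1 ∧ J w π (ρ ^ m) = J w π ρ := by
  have hco : m.Coprime (orderOf ρ) := by
    have h1 : orderOf ρ ∣ p ^ N := orderOf_dvd_of_pow_eq_one (h.hord ρ)
    refine Nat.Coprime.coprime_dvd_right h1 (Nat.Coprime.pow_right _ ?_)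
    exact ((Nat.Prime.coprime_iff_not_dvd hpp.out).2 hm).symm
  obtain ⟨m', hm'⟩ := exists_pow_eq_self_of_coprime hco
  have h1 : ρ ^ m ≠ 1 := by
    intro h0; rw [h0, one_pow] at hm'; exact hρ hm'.symm
  refine ⟨h1, le_antisymm ?_ ?_⟩
  · refine le_J h hρ ?_
    have := lift_pow h (lift_J h h1) m'
    rwa [hm'] at this
  · exact le_J h h1 (lift_pow h (lift_J h hρ) m)

noncomputable def xb (π : L) (τ : L ≃ₐ[K] L) (b : ℕ) : L := ∏ l ∈ Finset.range b, (τ ^ l) π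

lemma w_xb (h : RS p N K L w π) (τ : L ≃ₐ[K] L) (b : ℕ) : w (xb π τ b) = ((b : ℤ) : WithTop ℤ) := by
  induction b with
  | zero => simp [xb]
  | succ b ih =>
    rw [xb, Finset.prod_range_succ, AddValuation.map_mul, h.hinv, h.hpi]
    rw [xb] at ih
    rw [ih]; norm_cast

lemma xb_sub (h : RS p N K L w π) (τ : L ≃ₐ[K] L) (b : ℕ) :
    τ (xb π τ b) - xb π τ b = xb π τ b / π * ((τ ^ b) π - π) := by
  have h0 := pi_ne h
  have h1 : τ (xb π τ b) * π = xb π τ b * (τ ^ b) π := by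
    rw [xb, map_prod]
    have : ∀ j ∈ Finset.range b, τ ((τ ^ j) π) = (τ ^ (j + 1)) π := by
      intro j _
      rw [pow_succ', AlgEquiv.mul_apply]
    rw [Finset.prod_congr rfl this, ← Finset.prod_range_succ (fun l => (τ ^ l) π),
      Finset.prod_range_succ' (fun l => (τ ^ l) π)]
    simp
  field_simp
  linear_combination h1

lemma w_xb_div (h : RS p N K L w π) (τ : L ≃ₐ[K] L) (b : ℕ) :
    w (xb π τ b / π) = ((b - 1 : ℤ) : WithTop ℤ) := by
  rw [AddValuation.map_div, w_xb h, h.hpi]; norm_cast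

lemma w_xb_sub (h : RS p N K L w π) (τ : L ≃ₐ[K] L) (b : ℕ) (hb : τ ^ b ≠ 1) :
    w (τ (xb π τ b) - xb π τ b) = ((b + J w π (τ ^ b) : ℤ) : WithTop ℤ) := by
  rw [xb_sub h, AddValuation.map_mul, w_xb_div h, J_spec h hb, ← WithTop.coe_add]
  congr 1; ring

lemma w_xb_sub_ge (h : RS p N K L w π) (τ : L ≃ₐ[K] L) (b : ℕ) (c : ℤ) (hc : Lift K L w (τ ^ b) c) :
    w (xb π τ b) + (c : WithTop ℤ) ≤ w (τ (xb π τ b) - xb π τ b) := by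
  have := hc π
  rw [xb_sub h, AddValuation.map_mul, w_xb_div h, w_xb h]
  rw [h.hpi] at this
  refine le_trans (le_of_eq ?_) (add_le_add_right this _)
  rw [← WithTop.coe_add, ← WithTop.coe_add, ← WithTop.coe_add]
  congr 1; ring

lemma chain {g : ℕ → ℤ} {q : ℤ} {k : ℕ} (hg : ∀ j < k, q ^ (j + 1) ∣ g (j + 1) - g j) {j i : ℕ}
    (hji : j ≤ i) (hik : i ≤ k) : q ^ (j + 1) ∣ g i - g j := by
  induction i, hji using Nat.le_induction with
  | base => simp
  | succ i hi ih =>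
    have h1 := ih (by omega)
    have h2 := (pow_dvd_pow q (by omega : j + 1 ≤ i + 1)).trans (hg i (by omega))
    have := dvd_add h1 h2
    simpa using this

lemma decomp (b : ℕ) (k : ℕ) (hb : ¬ p ^ (k + 1) ∣ b) : ∃ j s, j ≤ k ∧ ¬ p ∣ s ∧ b = p ^ j * s := by
  have hb0 : b ≠ 0 := by rintro rfl; simp at hb
  obtain ⟨j, s, hs, hbs⟩ := Nat.exists_eq_pow_mul_and_not_dvd hb0 p hpp.out.ne_one
  refine ⟨j, s, ?_, hs, hbs⟩
  by_contra hlt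
  push Not at hlt
  exact hb (hbs ▸ (pow_dvd_pow p hlt).mul_right s)

theorem sen (h : RS p N K L w π) (k : ℕ) : ∀ τ : L ≃ₐ[K] L, τ ^ p ^ (k + 1) ≠ 1 →
    (p : ℤ) ^ (k + 1) ∣ J w π (τ ^ p ^ (k + 1)) - J w π (τ ^ p ^ k) := by
  classical
  induction k using Nat.strong_induction_on with
  | _ k IH =>
  intro τ hτ
  have hne : ∀ j ≤ k + 1, τ ^ p ^ j ≠ 1 := by
    intro j hj h0
    apply hτ
    obtain ⟨d, hd⟩ := Nat.exists_eq_add_of_le hj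
    rw [hd, pow_add, pow_mul, h0, one_pow]
  set g : ℕ → ℤ := fun j => J w π (τ ^ p ^ j) with hg
  have hchain : ∀ j < k, (p : ℤ) ^ (j + 1) ∣ g (j + 1) - g j := by
    intro j hj
    exact IH j hj τ (hne _ (by omega))
  have htop : (p : ℤ) ^ k ∣ g (k + 1) - g k := by
    rcases k with _ | k
    · simp
    · have e : ∀ j, (τ ^ p) ^ p ^ j = τ ^ p ^ (j + 1) := by
        intro j; rw [← pow_mul, ← pow_succ']
      have := IH k (by omega) (τ ^ p) (by rw [e]; exact hτ)
      rw [e, e] at this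
      exact this
  change (p : ℤ) ^ (k + 1) ∣ g (k + 1) - g k
  by_contra hcon
  obtain ⟨t, ht⟩ := htop
  have hp0 : (p : ℤ) ≠ 0 := by exact_mod_cast hpp.out.ne_zero
  have htp : ¬ (p : ℤ) ∣ t := by
    rintro ⟨t', rfl⟩
    exact hcon ⟨t', by rw [ht]; ring⟩
  -- choose m
  obtain ⟨s, hs⟩ : ∃ s : ℕ, (p : ℤ) ∣ s + t := by
    refine ⟨((-t) % p).toNat, ?_⟩
    rw [Int.toNat_of_nonneg (Int.emod_nonneg _ hp0)]
    have := Int.emod_add_mul_ediv (-t) p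
    exact ⟨-((-t) / p), by linarith⟩
  have hsp : ¬ p ∣ s := by
    intro h0
    have : (p : ℤ) ∣ s := by exact_mod_cast h0
    exact htp ((dvd_add_right this).1 hs)
  set m : ℕ := p ^ k * s with hm
  have hmJ : (τ ^ p) ^ m ≠ 1 ∧ J w π ((τ ^ p) ^ m) = g (k + 1) := by
    have e : (τ ^ p) ^ m = (τ ^ p ^ (k + 1)) ^ s := by
      rw [hm, ← pow_mul, ← pow_mul]; congr 1; ring
    rw [e]
    exact J_coprime h hτ hsp
  set x' := xb π (τ ^ p) m with hx'
  have hwx : w ((τ ^ p) x' - x') = ((m + g (k + 1) : ℤ) : WithTop ℤ) := by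
    rw [hx', w_xb_sub h _ _ hmJ.1, hmJ.2]
  set y := ∑ j ∈ Finset.range p, (τ ^ j) x' with hy
  have hwy : ((m + 1 : ℤ) : WithTop ℤ) ≤ w y := by
    have := S_gt h τ x'
    rw [hx', w_xb h] at this
    exact_mod_cast this
  obtain ⟨c, hyc, hwc⟩ := expand h (xb π τ) (w_xb h τ) y
  set T : ℕ → L := fun b => algebraMap K L (c b) * (τ (xb π τ b) - xb π τ b) with hT
  have hsum : ∑ b ∈ Finset.range (p ^ N), T b = (τ ^ p) x' - x' := by
    rw [← S_tel, ← hy]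
    conv_rhs => rw [hyc]
    rw [map_sum, ← Finset.sum_sub_distrib]
    refine Finset.sum_congr rfl fun b _ => ?_
    rw [hT, map_mul, AlgEquiv.commutes]; ring
  rw [← Finset.sum_filter_add_sum_filter_not _ (fun b => p ^ (k + 1) ∣ b)] at hsum
  set S1 := ∑ b ∈ Finset.range (p ^ N) with p ^ (k + 1) ∣ b, T b with hS1
  set S2 := ∑ b ∈ Finset.range (p ^ N) with ¬ p ^ (k + 1) ∣ b, T b with hS2
  have hwS1 : ((m + g (k + 1) : ℤ) : WithTop ℤ) < w S1 := by
    refine w.map_lt_sum' (WithTop.coe_lt_top _) fun b hb => ?_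
    simp only [Finset.mem_filter, Finset.mem_range] at hb
    obtain ⟨hb1, d, hd⟩ := hb
    have hl : Lift K L w (τ ^ b) (g (k + 1)) := by
      rw [hd, pow_mul]
      exact lift_pow h (lift_J h hτ) d
    have h1 := w_xb_sub_ge h τ b _ hl
    have h2 := hwc b hb1
    rw [hT]
    simp only
    rw [AddValuation.map_mul]
    refine lt_of_lt_of_le ?_ (add_le_add_right h1 _)
    rw [← add_assoc, ← AddValuation.map_mul]
    refine lt_of_lt_of_le ?_ (add_le_add_left (hwy.trans h2) _)
    norm_cast; push_cast; omega
  have hwS2 : w S2 = ((m + g (k + 1) : ℤ) : WithTop ℤ) := by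
    have : S2 = ((τ ^ p) x' - x') - S1 := by rw [← hsum]; ring
    rw [this, AddValuation.map_sub_eq_of_lt_left, hwx]
    rwa [hwx]
  have key : ∀ b < p ^ N, ¬ p ^ (k + 1) ∣ b → c b ≠ 0 → ∃ (j : ℕ) (a : ℤ), j ≤ k ∧
      (p : ℤ) ^ j ∣ (p : ℤ) ^ N * a + b ∧ ¬ (p : ℤ) ^ (j + 1) ∣ (p : ℤ) ^ N * a + b ∧
      w (T b) = (((p : ℤ) ^ N * a + b + g j : ℤ) : WithTop ℤ) := by
    intro b hb hdb hcb
    obtain ⟨j, s', hj, hs', hbs⟩ := decomp (p := p) b k hdb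
    obtain ⟨a, ha⟩ := h.hK (c b) hcb
    have hs0 : 0 < s' := Nat.pos_of_ne_zero (by rintro rfl; simp at hs')
    have hjN : j < N := by
      have : p ^ j < p ^ N := lt_of_le_of_lt (by rw [hbs]; exact Nat.le_mul_of_pos_right _ hs0) hb
      exact (Nat.pow_lt_pow_iff_right hpp.out.one_lt).1 this
    have hpN : (p : ℤ) ^ (j + 1) ∣ (p : ℤ) ^ N * a := (pow_dvd_pow _ hjN).mul_right _
    have hJ := J_coprime h (hne j (by omega)) hs'
    rw [← pow_mul, ← hbs] at hJ
    refine ⟨j, a, hj, ?_, ?_, ?_⟩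
    · refine dvd_add ((pow_dvd_pow _ (Nat.le_succ j)).trans hpN) ⟨s', ?_⟩
      rw [hbs]; push_cast; rfl
    · intro hd
      have := (dvd_add_right hpN).1 hd
      rw [hbs] at this
      have h3 : p ^ (j + 1) ∣ p ^ j * s' := by exact_mod_cast this
      rw [pow_succ] at h3
      exact hs' (Nat.dvd_of_mul_dvd_mul_left (pow_pos hpp.out.pos j) h3)
    · rw [hT]
      simp only
      rw [AddValuation.map_mul, ha, w_xb_sub h _ _ hJ.1, hJ.2]
      norm_cast
      rw [← add_assoc]
  have hc0 : ∀ b, T b ≠ 0 → c b ≠ 0 := by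
    intro b hb h0; apply hb; rw [hT]; simp [h0]
  have hc0' : ∀ b, w (T b) ≠ ⊤ → c b ≠ 0 := by
    intro b hb h0; apply hb; rw [hT]; simp [h0]
  obtain ⟨-, hex⟩ := sum_distinct w ((Finset.range (p ^ N)).filter (fun b => ¬ p ^ (k + 1) ∣ b)) T (by
    intro i hi i' hi' hii hTi heq
    simp only [Finset.mem_filter, Finset.mem_range] at hi hi'
    obtain ⟨j, a, hj, hd, hnd, hw⟩ := key i hi.1 hi.2 (hc0 i hTi)
    obtain ⟨j', a', hj', hd', hnd', hw'⟩ := key i' hi'.1 hi'.2 (hc0' i' (by rw [← heq, hw]; exact WithTop.coe_ne_top))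
    rw [hw, hw', WithTop.coe_inj] at heq
    rcases lt_trichotomy j j' with hlt | rfl | hlt
    · apply hnd
      have e : (p : ℤ) ^ N * a + i = ((p : ℤ) ^ N * a' + i') + (g j' - g j) := by linarith
      rw [e]
      exact dvd_add ((pow_dvd_pow _ hlt).trans hd') (chain hchain hlt.le hj')
    · exact hii (eq_of_q (q := (p : ℤ) ^ N) (a := a) (a' := a') (by exact_mod_cast hi.1) (by exact_mod_cast hi'.1) (by linarith))
    · apply hnd'
      have e : (p : ℤ) ^ N * a' + i' = ((p : ℤ) ^ N * a + i) + (g j - g j') := by linarith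
      rw [e]
      exact dvd_add ((pow_dvd_pow _ hlt).trans hd) (chain hchain hlt.le hj))
  have hnon : ((Finset.range (p ^ N)).filter (fun b => ¬ p ^ (k + 1) ∣ b)).Nonempty := by
    by_contra he
    rw [Finset.not_nonempty_iff_eq_empty] at he
    rw [hS2, he, Finset.sum_empty, AddValuation.map_zero] at hwS2
    exact WithTop.top_ne_coe hwS2
  obtain ⟨b, hb, hbw⟩ := hex hnon
  simp only [Finset.mem_filter, Finset.mem_range] at hb
  rw [← hS2, hwS2] at hbw
  obtain ⟨j, a, hj, hd, hnd, hw⟩ := key b hb.1 hb.2 (hc0' b (by rw [← hbw]; exact WithTop.coe_ne_top))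
  rw [hw, WithTop.coe_inj] at hbw
  apply hnd
  have e : (p : ℤ) ^ N * a + b = (m + (g (k + 1) - g k)) + (g k - g j) := by linarith
  rw [e]
  refine dvd_add ?_ (chain hchain hj le_rfl)
  refine (pow_dvd_pow (p : ℤ) (by omega : j + 1 ≤ k + 1)).trans ?_
  rw [ht, hm]
  push_cast
  rw [← mul_add, pow_succ]
  exact mul_dvd_mul_left _ hs

theorem J_bound (h : RS p N K L w π) (σ : L ≃ₐ[K] L) (k : ℕ) (hσ : σ ^ p ^ k ≠ 1) :
    (p : ℤ) ^ (k + 1) - 1 ≤ (p - 1) * J w π (σ ^ p ^ k) := by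
  have hp1 : (1 : ℤ) < p := by exact_mod_cast hpp.out.one_lt
  induction k with
  | zero =>
    have := J_pos h hσ
    simp only [zero_add, pow_one]
    nlinarith
  | succ k ih =>
    have h1 : σ ^ p ^ k ≠ 1 := by
      intro h0; apply hσ; rw [pow_succ, pow_mul, h0, one_pow]
    have h2 := ih h1
    obtain ⟨t, ht⟩ := sen h k σ hσ
    have h3 := J_lt h (ρ := σ ^ p ^ k) (by rw [← pow_mul, ← pow_succ]; exact hσ)
    rw [← pow_mul, ← pow_succ] at h3
    have hpk : 0 < (p : ℤ) ^ (k + 1) := by positivity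
    have ht1 : 1 ≤ t := by
      by_contra hlt
      have : t ≤ 0 := by omega
      nlinarith
    have : (p : ℤ) ^ (k + 1) ≤ (p : ℤ) ^ (k + 1) * t := by nlinarith
    have h4 : (p : ℤ) ^ (k + 1) ≤ J w π (σ ^ p ^ (k + 1)) - J w π (σ ^ p ^ k) := by omega
    have := mul_le_mul_of_nonneg_left h4 (by linarith : 0 ≤ (p : ℤ) - 1)
    have e : (p : ℤ) ^ (k + 1 + 1) = p * (p : ℤ) ^ (k + 1) := by ring
    rw [e]
    linarith
end
end ZpT

namespace ZpT
set_option linter.unusedSectionVars false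
set_option linter.unusedSimpArgs false
section
variable {p N : ℕ} [hpp : Fact p.Prime] {K L : Type*} [Field K] [Field L] [Algebra K L]
    {w : AddValuation L (WithTop ℤ)} {π : L}

lemma expand0 (h : RS p N K L w π) (x : L) (hx : 0 ≤ w x) :
    ∃ c : K, ((1 : ℤ) : WithTop ℤ) ≤ w (x - algebraMap K L c) := by
  obtain ⟨a, ha, hb⟩ := expand h (fun b => π ^ b) (wpow h) x
  have hq : 0 < p ^ N := pow_pos hpp.out.pos _
  refine ⟨a 0, ?_⟩
  rw [← Finset.sum_range_add_sum_Ico _ (Nat.one_le_iff_ne_zero.2 hq.ne')] at ha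
  simp only [Finset.sum_range_one, pow_zero, mul_one] at ha
  rw [sub_eq_of_eq_add' ha]
  refine w.map_le_sum fun b hb' => ?_
  simp only [Finset.mem_Ico] at hb'
  have h1 := hx.trans (hb b hb'.2)
  by_cases hab : a b = 0
  · simp [hab]
  obtain ⟨t, ht⟩ := term_val h (fun b => π ^ b) (wpow h) (a b) hab b
  rw [ht] at h1 ⊢
  norm_cast at h1 ⊢
  have hne : (p:ℤ) ^ N * t + b ≠ 0 := by
    intro h0
    have := eq_of_q (q := (p : ℤ) ^ N) (b := b) (b' := 0) (a := t) (a' := 0)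
      (by exact_mod_cast hb'.2) (by exact_mod_cast hq) (by simpa using h0)
    omega
  push_cast at h1 ⊢
  omega

lemma geom_delta {E : Type*} [Ring E] (t : E) (n : ℕ) :
    ∑ i ∈ Finset.range n, t ^ i = ∑ i ∈ Finset.range n, (n.choose (i + 1)) • (t - 1) ^ i := by
  have := congrArg (Polynomial.aeval (t - 1)) (Polynomial.geom_sum_X_comp_X_add_one_eq_sum (R := ℤ) n)
  rw [Polynomial.aeval_comp] at this
  simpa [nsmul_eq_mul] using this

theorem trace_bound {n : ℕ} (h : RS p (n + 1) K L w π) (σ : L ≃ₐ[K] L) (hσ : σ ^ p ^ n ≠ 1)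
    (x : L) (hx : 0 ≤ w x) :
    (((p : ℤ) ^ (n + 1) : ℤ) : WithTop ℤ) ≤ w (∑ j ∈ Finset.range p, ((σ ^ p ^ n) ^ j) x) := by
  set τ := σ ^ p ^ n with hτ
  set l := J w π τ with hl
  have hl1 : 1 ≤ l := J_pos h hσ
  have hb := J_bound h σ n hσ
  have hlift : Lift K L w τ l := lift_J h hσ
  let t : Module.End K L := τ.toLinearMap
  have ht : ∀ j x, (t ^ j) x = (τ ^ j) x := by
    intro j
    induction j with
    | zero => intro x; simp
    | succ j ih => intro x; rw [pow_succ', pow_succ', AlgEquiv.mul_apply, Module.End.mul_apply, ih]; rfl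
  have hδ : ∀ i : ℕ, ((1 + (i + 1) * l : ℤ) : WithTop ℤ) ≤ w (((t - 1) ^ (i + 1)) x) := by
    intro i
    induction i with
    | zero =>
      obtain ⟨c, hc⟩ := expand0 h x hx
      have h1 := hlift (x - algebraMap K L c)
      have h2 : τ (x - algebraMap K L c) - (x - algebraMap K L c) = ((t - 1) ^ (0 + 1) : Module.End K L) x := by
        simp [t]
      rw [h2] at h1
      refine le_trans (le_trans ?_ (add_le_add_left hc _)) h1
      rw [← WithTop.coe_add]; simp
    | succ i ih =>
      have h1 := hlift (((t - 1) ^ (i + 1)) x)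
      rw [pow_succ', Module.End.mul_apply]
      refine le_trans (le_trans (le_of_eq ?_) (add_le_add_left ih _)) h1
      rw [← WithTop.coe_add]; congr 1; push_cast; ring
  have hsum : ∑ j ∈ Finset.range p, (τ ^ j) x
      = ∑ i ∈ Finset.range p, (p.choose (i + 1) : L) * ((t - 1) ^ i) x := by
    have := congrArg (fun f : Module.End K L => f x) (geom_delta t p)
    simp only [LinearMap.sum_apply, ht] at this
    rw [this]
    simp
  rw [hsum]
  have hp2 := hpp.out.two_le
  refine w.map_le_sum fun i hi => ?_
  simp only [Finset.mem_range] at hi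
  rcases Nat.lt_or_ge (i + 1) p with hip | hip
  · obtain ⟨d, hd⟩ := hpp.out.dvd_choose_self (Nat.succ_ne_zero i) hip
    rw [show p.choose (i+1) = p * d from hd]
    push_cast
    rw [AddValuation.map_mul, AddValuation.map_mul, h.hp, add_assoc]
    refine le_add_of_nonneg_right (add_nonneg ?_ ?_)
    · exact natCast_mem (intR w) d
    · rcases i with _ | i
      · simpa using hx
      · refine le_trans ?_ (hδ i)
        norm_cast; push_cast; positivity
  · have : i + 1 = p := by omega
    obtain ⟨i, rfl⟩ : ∃ i', i = i' + 1 := ⟨i - 1, by omega⟩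
    rw [this]
    simp only [Nat.choose_self, Nat.cast_one, one_mul]
    refine le_trans ?_ (hδ i)
    have hpi : (p : ℤ) - 1 = i + 1 := by rw [← this]; push_cast; ring
    rw [hpi] at hb
    exact WithTop.coe_le_coe.2 (by linarith)

lemma w_nat_unit (h : RS p N K L w π) (k : ℕ) (hk0 : 0 < k) (hk : k < p) : w (k : L) = 0 := by
  have h0 : 0 ≤ w (k : L) := natCast_mem (intR w) k
  refine le_antisymm ?_ h0
  by_contra hlt
  rw [not_le] at hlt
  have hco : Nat.Coprime k p := ((Nat.Prime.coprime_iff_not_dvd hpp.out).2 (Nat.not_dvd_of_pos_of_lt hk0 hk)).symm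
  have hcop : IsCoprime (k : ℤ) (p : ℤ) := Nat.isCoprime_iff_coprime.2 hco
  obtain ⟨a, b, hab⟩ := hcop
  have h1 : (a : L) * k + b * p = 1 := by exact_mod_cast congrArg (Int.cast : ℤ → L) hab
  have h2 : 0 < w (1 : L) := by
    rw [← h1]
    refine w.map_lt_add ?_ ?_
    · rw [AddValuation.map_mul]
      exact lt_of_lt_of_le hlt (le_add_of_nonneg_left (intCast_mem (intR w) a))
    · rw [AddValuation.map_mul]
      refine lt_of_lt_of_le ?_ (le_add_of_nonneg_left (intCast_mem (intR w) b))
      exact lt_of_lt_of_le (by norm_cast) (wpos h)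
  simp at h2

theorem norm_cong {n : ℕ} (hodd : Odd p) (h : RS p (n + 1) K L w π) (σ : L ≃ₐ[K] L) (hσ : σ ^ p ^ n ≠ 1)
    (x : L) (hx : 0 ≤ w x) :
    (((p : ℤ) ^ (n + 1) : ℤ) : WithTop ℤ) ≤ w (∏ j ∈ Finset.range p, ((σ ^ p ^ n) ^ j) x - x ^ p) := by
  classical
  set τ := σ ^ p ^ n with hτ
  set q : WithTop ℤ := (((p : ℤ) ^ (n + 1) : ℤ) : WithTop ℤ) with hq
  have hq0 : 0 ≤ q := by rw [hq]; norm_cast; positivity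
  let y : Fin p → L := fun j => (τ ^ (j : ℕ)) x
  let e : ℕ → L := fun k => MvPolynomial.aeval y (MvPolynomial.esymm (Fin p) ℤ k)
  have hps : ∀ k, q ≤ w (MvPolynomial.aeval y (MvPolynomial.psum (Fin p) ℤ k)) := by
    intro k
    have : MvPolynomial.aeval y (MvPolynomial.psum (Fin p) ℤ k)
        = ∑ j ∈ Finset.range p, (τ ^ j) (x ^ k) := by
      rw [MvPolynomial.psum, map_sum, ← Fin.sum_univ_eq_sum_range (fun j => (τ ^ j) (x ^ k))]
      simp [y]
    rw [this]
    refine trace_bound h σ hσ _ ?_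
    rw [AddValuation.map_pow]; exact nsmul_nonneg hx _
  have he0 : e 0 = 1 := by simp [e]
  have he : ∀ k, 0 < k → k < p → q ≤ w (e k) := by
    intro k
    induction k using Nat.strong_induction_on with
    | _ k IH =>
    intro hk0 hk
    have hN := congrArg (MvPolynomial.aeval y) (MvPolynomial.mul_esymm_eq_sum (Fin p) ℤ k)
    rw [map_mul, map_mul, map_sum] at hN
    simp only [map_natCast, map_mul, map_pow, map_neg, map_one] at hN
    have hw := congrArg w hN
    rw [AddValuation.map_mul, w_nat_unit h k hk0 hk, zero_add] at hw
    change w (e k) = _ at hw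
    rw [hw]
    have hneg : ∀ j : ℕ, 0 ≤ w ((-1 : L) ^ j) := by
      intro j; rw [AddValuation.map_pow, AddValuation.map_neg, AddValuation.map_one]; simp
    rw [AddValuation.map_mul]
    refine le_trans ?_ (le_add_of_nonneg_left (hneg _))
    refine w.map_le_sum fun a ha => ?_
    rw [AddValuation.map_mul, AddValuation.map_mul]
    simp only [Finset.mem_filter] at ha
    refine le_trans (hps a.2) (le_add_of_nonneg_left (add_nonneg (hneg _) ?_))
    change 0 ≤ w (e a.1)
    rcases Nat.eq_zero_or_pos a.1 with h0 | h0
    · rw [h0, he0]; simp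
    · exact hq0.trans (IH a.1 ha.2 h0 (by omega))
  have hV := Multiset.prod_X_sub_X_eq_sum_esymm (Finset.univ.val.map y)
  simp only [Multiset.card_map, Finset.card_val, Finset.card_univ, Fintype.card_fin, Multiset.map_map] at hV
  have hev : ∀ z : L, ∏ j, (z - y j) = ∑ j ∈ Finset.range (p + 1), (-1) ^ j * (e j * z ^ (p - j)) := by
    intro z
    have := congrArg (Polynomial.eval z) hV
    rw [Polynomial.eval_finsetSum] at this
    simp only [Polynomial.eval_mul, Polynomial.eval_pow, Polynomial.eval_neg, Polynomial.eval_one,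
      Polynomial.eval_C, Polynomial.eval_X] at this
    simp only [e, MvPolynomial.aeval_esymm_eq_multiset_esymm]
    rw [← this]
    change _ = Polynomial.eval z (∏ j, (Polynomial.X - Polynomial.C (y j)))
    rw [Polynomial.eval_prod]; simp
  have h1 : ∏ j, (x - y j) = 0 := by
    refine Finset.prod_eq_zero (Finset.mem_univ ⟨0, hpp.out.pos⟩) ?_
    simp [y]
  have h2 : ∏ j, (0 - y j) = - ∏ j, y j := by
    simp only [zero_sub]
    rw [Finset.prod_neg]
    simp [hodd.neg_one_pow]
  have h3 : ∏ j ∈ Finset.range p, (τ ^ j) x = ∏ j, y j := by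
    rw [← Fin.prod_univ_eq_prod_range (fun j => (τ ^ j) x)]
  have h4 : ∏ j, y j = ∑ j ∈ Finset.range (p + 1), (-1) ^ j * (e j * (x ^ (p - j) - 0 ^ (p - j))) := by
    have a := hev x
    have b := hev 0
    rw [h1] at a
    rw [h2] at b
    simp only [mul_sub, Finset.sum_sub_distrib]
    rw [← a, ← b]; ring
  rw [h3, h4, Finset.sum_range_succ, Nat.sub_self, pow_zero, pow_zero, sub_self, mul_zero, mul_zero, add_zero]
  obtain ⟨p', hp'⟩ : ∃ p', p = p' + 1 := ⟨p - 1, by have := hpp.out.pos; omega⟩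
  have hr : Finset.range p = Finset.range (p' + 1) := by rw [hp']
  rw [hr, Finset.sum_range_succ']
  rw [he0, pow_zero, Nat.sub_zero, zero_pow hpp.out.ne_zero, one_mul, one_mul, sub_zero, add_sub_cancel_right]
  refine w.map_le_sum fun j hj => ?_
  simp only [Finset.mem_range] at hj
  rw [AddValuation.map_mul, AddValuation.map_mul]
  refine (he (j + 1) (by omega) (by omega)).trans ?_
  refine le_trans ?_ (le_add_of_nonneg_left ?_)
  · refine le_add_of_nonneg_right ?_
    rw [zero_pow (by omega), sub_zero, AddValuation.map_pow]
    exact nsmul_nonneg hx _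
  · rw [AddValuation.map_pow, AddValuation.map_neg, AddValuation.map_one]; simp

lemma sum_pow_mod (s : Finset ℕ) (f : ℕ → L) (hf : ∀ i ∈ s, 0 ≤ w (f i)) :
    w (p : L) ≤ w ((∑ i ∈ s, f i) ^ p - ∑ i ∈ s, f i ^ p) := by
  classical
  induction s using Finset.induction_on with
  | empty => simp [hpp.out.ne_zero]
  | insert a s ha ih =>
    have ih := ih fun i hi => hf i (Finset.mem_insert_of_mem hi)
    obtain ⟨r, hr, hr2⟩ := pow_add_mod (p := p) (w := w) (f a) (∑ i ∈ s, f i) (hf a (Finset.mem_insert_self _ _))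
      (w.map_le_sum fun i hi => hf i (Finset.mem_insert_of_mem hi)) 1
    simp only [pow_one] at hr2
    rw [Finset.sum_insert ha, Finset.sum_insert ha, hr2]
    have : f a ^ p + (∑ i ∈ s, f i) ^ p + p * r - (f a ^ p + ∑ i ∈ s, f i ^ p)
        = ((∑ i ∈ s, f i) ^ p - ∑ i ∈ s, f i ^ p) + p * r := by ring
    rw [this]
    refine w.map_le_add ih ?_
    rw [AddValuation.map_mul]; exact le_add_of_nonneg_right hr
end
end ZpT

namespace ZpT
set_option linter.unusedSectionVars false
set_option linter.unusedSimpArgs false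
section
variable {F : Type*} [Field F] {v : AddValuation F (WithTop ℚ)}

lemma v_zpow {x : F} {a : ℚ} (hx : v x = (a : WithTop ℚ)) (k : ℤ) :
    v (x ^ k) = ((k * a : ℚ) : WithTop ℚ) := by
  have hn : ∀ n : ℕ, v (x ^ n) = ((n * a : ℚ) : WithTop ℚ) := by
    intro n
    rw [AddValuation.map_pow, hx, ← WithTop.coe_nsmul, nsmul_eq_mul]
  rcases k with n | n
  · simpa using hn n
  · rw [zpow_negSucc, AddValuation.map_inv, hn, ← WithTop.LinearOrderedAddCommGroup.coe_neg]
    congr 1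
    push_cast; ring

lemma valgrp {q : ℚ} (hq : 0 < q) {x0 : F} (hx0 : v x0 = ((q⁻¹ : ℚ) : WithTop ℚ))
    (hmin : ∀ y, 0 < v y → v x0 ≤ v y) (y : F) (hy : y ≠ 0) :
    ∃ z : ℤ, v y = ((z / q : ℚ) : WithTop ℚ) := by
  obtain ⟨a, ha⟩ := WithTop.ne_top_iff_exists.1 ((AddValuation.ne_top_iff v).2 hy)
  refine ⟨⌊a * q⌋, ?_⟩
  have h1 : v (y * x0 ^ (-⌊a * q⌋)) = ((a - ⌊a * q⌋ / q : ℚ) : WithTop ℚ) := by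
    rw [AddValuation.map_mul, v_zpow hx0, ← ha, ← WithTop.coe_add]
    congr 1
    push_cast; ring
  have h2 := Int.floor_le (a * q)
  have h3 := Int.lt_floor_add_one (a * q)
  rw [← ha]
  congr 1
  by_contra hne
  have h4 : (⌊a * q⌋ : ℚ) / q ≤ a := by rwa [div_le_iff₀ hq]
  have h5 := hmin (y * x0 ^ (-⌊a * q⌋)) (by
    rw [h1]
    have : (0 : ℚ) < a - ⌊a * q⌋ / q := by
      have := lt_of_le_of_ne h4 (Ne.symm hne)
      linarith
    exact_mod_cast this)
  rw [h1, hx0, WithTop.coe_le_coe] at h5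
  have h6 : a * q < (⌊a * q⌋ / q + q⁻¹) * q := by
    rw [add_mul, div_mul_cancel₀ _ hq.ne', inv_mul_cancel₀ hq.ne']; exact h3
  have := lt_of_mul_lt_mul_right h6 hq.le
  linarith

lemma exists_w {q : ℚ} (hq : 0 < q) (hv : ∀ y : F, y ≠ 0 → ∃ z : ℤ, v y = ((z / q : ℚ) : WithTop ℚ)) :
    ∃ w : AddValuation F (WithTop ℤ), ∀ x, v x = (w x).map (fun z : ℤ => (z : ℚ) / q) := by
  have hmono : StrictMono (fun z : ℤ => (z : ℚ) / q) := by
    intro a b hab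
    simp only
    have : (a : ℚ) < b := by exact_mod_cast hab
    gcongr
  have hmt : StrictMono (WithTop.map (fun z : ℤ => (z : ℚ) / q)) := hmono.withTop_map
  have hex : ∀ x : F, ∃ t : WithTop ℤ, v x = t.map (fun z : ℤ => (z : ℚ) / q) := by
    intro x
    by_cases hx : x = 0
    · exact ⟨⊤, by simp [hx]⟩
    · obtain ⟨z, hz⟩ := hv x hx
      exact ⟨z, by rw [hz]; rfl⟩
  choose f hf using hex
  have hadd : ∀ a b : WithTop ℤ, (a + b).map (fun z : ℤ => (z : ℚ) / q)
      = a.map (fun z : ℤ => (z : ℚ) / q) + b.map (fun z : ℤ => (z : ℚ) / q) := by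
    intro a b
    induction a with
    | top => simp
    | coe a =>
      induction b with
      | top => simp
      | coe b =>
        rw [← WithTop.coe_add]
        simp only [WithTop.map_coe]
        rw [← WithTop.coe_add]
        congr 1
        push_cast; ring
  refine ⟨AddValuation.of f ?_ ?_ ?_ ?_, hf⟩
  · apply hmt.injective
    rw [← hf]; simp
  · apply hmt.injective
    rw [← hf, AddValuation.map_one]
    change _ = WithTop.map _ ((0 : ℤ) : WithTop ℤ)
    simp
  · intro x y
    have := v.map_add x y
    rw [hf, hf y, hf (x + y), ← hmt.monotone.map_min, hmt.le_iff_le] at this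
    exact this
  · intro x y
    apply hmt.injective
    rw [hadd, ← hf, ← hf, ← hf, AddValuation.map_mul]

end

section
variable {p : ℕ} [hpp : Fact p.Prime]

lemma exists_sqrt (hodd : Odd p) (x : ℤ_[p]) : ∃ y : ℤ_[p], y ^ 2 = 1 + p * x ^ 2 := by
  obtain ⟨e, he⟩ : ∃ e : ℤ_[p], e = 1 + p * x ^ 2 := ⟨_, rfl⟩
  let P : Polynomial ℤ_[p] := Polynomial.X ^ 2 - Polynomial.C e
  have h1 : P.aeval (1 : ℤ_[p]) = - (p * x ^ 2) := by
    simp [P, he]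
  have h2 : P.derivative.aeval (1 : ℤ_[p]) = 2 := by
    simp [P]
    norm_num
  have h3 : ‖(2 : ℤ_[p])‖ = 1 := by
    rw [← PadicInt.isUnit_iff]
    have : ¬ (p ∣ 2) := by
      intro h
      have := (Nat.prime_dvd_prime_iff_eq hpp.out Nat.prime_two).1 h
      rw [this] at hodd
      exact absurd hodd (by decide)
    have h4 : ‖((2 : ℕ) : ℤ_[p])‖ = 1 := by
      have := (PadicInt.norm_natCast_eq_one_iff (p := p) (n := 2)).2
        ((Nat.Prime.coprime_iff_not_dvd hpp.out).2 this)
      exact this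
    rw [PadicInt.isUnit_iff]
    exact_mod_cast h4
  obtain ⟨z, hz, -⟩ := hensels_lemma (p := p) (R := ℤ_[p]) (F := P) (a := 1) (by
    rw [h1, h2, h3, norm_neg, norm_mul, one_pow]
    have a1 : ‖x ^ 2‖ ≤ 1 := PadicInt.norm_le_one _
    have a2 : ‖(p : ℤ_[p])‖ < 1 := by
      rw [PadicInt.norm_p]
      exact inv_lt_one_of_one_lt₀ (by exact_mod_cast hpp.out.one_lt)
    calc _ ≤ ‖(p : ℤ_[p])‖ * 1 := by gcongr
      _ < 1 := by simpa using a2)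
  refine ⟨z, ?_⟩
  simp [P] at hz
  linear_combination hz + he

variable {F : Type*} [Field F] {v : AddValuation F (WithTop ℚ)} [Algebra ℚ_[p] F]

lemma v_padicInt (hodd : Odd p) (hv : ∀ y : F, y ≠ 0 → ∃ z : ℤ, v y = ((z : ℚ) : WithTop ℚ))
    (hvp : v (p : F) = 1) (x : ℤ_[p]) : 0 ≤ v (algebraMap ℚ_[p] F x) := by
  by_contra hlt
  rw [not_le] at hlt
  set X : F := algebraMap ℚ_[p] F x with hX
  obtain ⟨y, hy⟩ := exists_sqrt hodd x
  set Y : F := algebraMap ℚ_[p] F y with hY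
  have hXY : Y ^ 2 = 1 + p * X ^ 2 := by
    have := congrArg (fun t : ℤ_[p] => algebraMap ℚ_[p] F t) hy
    simpa [hX, hY] using this
  have hX0 : X ≠ 0 := by intro h0; rw [h0] at hlt; simp at hlt
  obtain ⟨z, hz⟩ := hv X hX0
  rw [hz] at hlt
  have hz0 : z < 0 := by
    have : ((z : ℚ) : WithTop ℚ) < ((0 : ℚ) : WithTop ℚ) := hlt
    exact_mod_cast WithTop.coe_lt_coe.1 this
  have h1 : v (p * X ^ 2) = ((1 + 2 * z : ℚ) : WithTop ℚ) := by
    rw [AddValuation.map_mul, AddValuation.map_pow, hvp, hz, ← WithTop.coe_nsmul]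
    change ((1 : ℚ) : WithTop ℚ) + _ = _
    rw [← WithTop.coe_add]; simp
  have h2 : v (Y ^ 2) = ((1 + 2 * z : ℚ) : WithTop ℚ) := by
    rw [hXY, AddValuation.map_add_eq_of_lt_right, h1]
    rw [h1, AddValuation.map_one]
    change _ < ((0 : ℚ) : WithTop ℚ)
    rw [WithTop.coe_lt_coe]
    have : z ≤ -1 := by omega
    have : (z : ℚ) ≤ -1 := by exact_mod_cast this
    linarith
  have hY0 : Y ≠ 0 := by
    intro h0
    rw [h0] at h2
    simp at h2
    exact WithTop.coe_ne_top h2.symm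
  obtain ⟨t, ht⟩ := hv Y hY0
  rw [AddValuation.map_pow, ht, ← WithTop.coe_nsmul, WithTop.coe_inj] at h2
  simp only [nsmul_eq_mul, Nat.cast_ofNat] at h2
  have h3 : ((2 * t : ℤ) : ℚ) = ((1 + 2 * z : ℤ) : ℚ) := by
    push_cast; linarith
  have : 2 * t = 1 + 2 * z := by exact_mod_cast h3
  omega

lemma v_padic (hvp : v (p : F) = 1) (hint : ∀ x : ℤ_[p], 0 ≤ v (algebraMap ℚ_[p] F x))
    (x : ℚ_[p]) (hx : x ≠ 0) : v (algebraMap ℚ_[p] F x) = ((x.valuation : ℚ) : WithTop ℚ) := by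
  have hu : ∀ u : ℚ_[p], ‖u‖ = 1 → v (algebraMap ℚ_[p] F u) = 0 := by
    intro u hu
    have h1 := hint ⟨u, hu.le⟩
    have h2 := hint ⟨u⁻¹, by rw [norm_inv, hu]; simp⟩
    simp only [map_inv₀, AddValuation.map_inv] at h1 h2
    have hu0 : algebraMap ℚ_[p] F u ≠ 0 := by
      rw [map_ne_zero]; rintro rfl; simp at hu
    obtain ⟨a, ha⟩ := WithTop.ne_top_iff_exists.1 ((AddValuation.ne_top_iff v).2 hu0)
    rw [← ha] at h1 h2 ⊢
    rw [← WithTop.LinearOrderedAddCommGroup.coe_neg] at h2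
    have h1 : (0 : ℚ) ≤ a := by exact_mod_cast h1
    have h2 : (0 : ℚ) ≤ -a := by exact_mod_cast h2
    have : a = 0 := by linarith
    rw [this]; rfl
  have hp0 : (p : ℚ_[p]) ≠ 0 := by exact_mod_cast hpp.out.ne_zero
  have hpr : (p : ℝ) ≠ 0 := by exact_mod_cast hpp.out.ne_zero
  have h1 := hu (x * (p : ℚ_[p]) ^ (-x.valuation)) (by
    rw [norm_mul, norm_zpow, Padic.norm_p, Padic.norm_eq_zpow_neg_valuation hx]
    rw [inv_zpow, ← zpow_neg, neg_neg, ← zpow_add₀ hpr]; simp)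
  have hvp' : v (p : F) = ((1 : ℚ) : WithTop ℚ) := hvp
  have h2 : algebraMap ℚ_[p] F x = algebraMap ℚ_[p] F (x * (p : ℚ_[p]) ^ (-x.valuation)) * (p : F) ^ x.valuation := by
    rw [map_mul, map_zpow₀, map_natCast, mul_assoc, ← zpow_add₀]
    · simp
    · rw [← map_natCast (algebraMap ℚ_[p] F), map_ne_zero]; exact hp0
  rw [h2, AddValuation.map_mul, h1, v_zpow hvp', zero_add]; simp

/-- Galois invariance -/
lemma v_inv [Algebra.IsAlgebraic ℚ_[p] F] (hvp : v (p : F) = 1)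
    (hint : ∀ x : ℤ_[p], 0 ≤ v (algebraMap ℚ_[p] F x)) (σ : F ≃ₐ[ℚ_[p]] F) (x : F) :
    v (σ x) = v x := by
  have hp1 : (1 : ℝ) < p := by exact_mod_cast hpp.out.one_lt
  have hp0 : (0 : ℝ) < p := by linarith
  let g : WithTop ℚ → ℝ := fun t => t.recTopCoe 0 (fun a => (p : ℝ) ^ (-(a : ℝ)))
  have gtop : g ⊤ = 0 := rfl
  have gcoe : ∀ a : ℚ, g a = (p : ℝ) ^ (-(a : ℝ)) := fun a => rfl
  have gpos : ∀ a : ℚ, 0 < g a := fun a => by rw [gcoe]; positivity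
  have ganti : StrictAnti g := by
    intro a b hab
    induction a with
    | top => simp at hab
    | coe a =>
      induction b with
      | top => rw [gtop]; exact gpos a
      | coe b =>
        rw [gcoe, gcoe]
        apply Real.rpow_lt_rpow_of_exponent_lt hp1
        have : (a : ℝ) < b := by exact_mod_cast WithTop.coe_lt_coe.1 hab
        linarith
  have gnn : ∀ t, 0 ≤ g t := by
    intro t
    rw [← gtop]; exact ganti.antitone le_top
  have gadd : ∀ a b, g (a + b) = g a * g b := by
    intro a b
    induction a with
    | top => simp [gtop]
    | coe a =>
      induction b with
      | top => simp [gtop]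
      | coe b =>
        rw [← WithTop.coe_add, gcoe, gcoe, gcoe, ← Real.rpow_add hp0]
        congr 1; push_cast; ring
  let f : AbsoluteValue F ℝ :=
    { toFun := fun x => g (v x)
      map_mul' := fun x y => by simp only [AddValuation.map_mul, gadd]
      nonneg' := fun x => gnn _
      eq_zero' := fun x => by
        constructor
        · intro h0
          by_contra hx
          obtain ⟨a, ha⟩ := WithTop.ne_top_iff_exists.1 ((AddValuation.ne_top_iff v).2 hx)
          have := gpos a
          rw [ha] at this
          exact this.ne' h0
        · rintro rfl; simp only [AddValuation.map_zero, gtop]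
      add_le' := fun x y => by
        refine le_trans (ganti.antitone (v.map_add x y)) ?_
        rcases min_choice (v x) (v y) with h | h
        · rw [h]; exact le_add_of_nonneg_right (gnn _)
        · rw [h]; exact le_add_of_nonneg_left (gnn _) }
  have hf : ∀ x : ℚ_[p], f (algebraMap ℚ_[p] F x) = ‖x‖ := by
    intro x
    by_cases hx : x = 0
    · simp [hx]
    change g (v _) = _
    rw [v_padic hvp hint x hx, gcoe, Padic.norm_eq_zpow_neg_valuation hx, ← Real.rpow_intCast]
    congr 1; push_cast; rfl
  have h1 := spectralNorm_unique_field_norm_ext hf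
  have : f (σ x) = f x := by rw [h1, h1, ← spectralNorm_eq_of_equiv]
  exact ganti.injective this

end
end ZpT

namespace ZpT
set_option linter.unusedSectionVars false
set_option linter.unusedSimpArgs false
set_option linter.style.haveILetI false
section
variable {F : Type*} [Field F]

def VS (v : AddValuation F (WithTop ℚ)) : ValuationSubring F where
  carrier := {x | 0 ≤ v x}
  mul_mem' := by
    intro a b ha hb
    simp only [Set.mem_ofPred_eq] at *
    rw [AddValuation.map_mul]; exact add_nonneg ha hb
  one_mem' := by simp
  add_mem' := by
    intro a b ha hb
    exact v.map_le_add ha hb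
  zero_mem' := by simp
  neg_mem' := by
    intro a ha
    simpa using ha
  mem_or_inv_mem' := by
    intro x
    by_cases hx : x = 0
    · left; simp [hx]
    obtain ⟨a, ha⟩ := WithTop.ne_top_iff_exists.1 ((AddValuation.ne_top_iff v).2 hx)
    have h1 : v x⁻¹ = ((-a : ℚ) : WithTop ℚ) := by
      rw [AddValuation.map_inv, ← ha, ← WithTop.LinearOrderedAddCommGroup.coe_neg]
    rcases le_total 0 a with h | h
    · left
      change 0 ≤ v x
      rw [← ha]; exact_mod_cast h
    · right
      change 0 ≤ v x⁻¹
      rw [h1]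
      have : 0 ≤ -a := by linarith
      exact_mod_cast this

variable {v : AddValuation F (WithTop ℚ)}

lemma res_zero (x : VS v) : IsLocalRing.residue (VS v) x = 0 ↔ 0 < v (x : F) := by
  rw [IsLocalRing.residue_eq_zero_iff, IsLocalRing.mem_maximalIdeal, mem_nonunits_iff]
  have hx0 : 0 ≤ v (x : F) := x.2
  constructor
  · intro h
    by_contra hlt
    apply h
    have h0 : v (x : F) = 0 := le_antisymm (not_lt.1 hlt) hx0
    have hne : (x : F) ≠ 0 := by
      intro h1; rw [h1] at h0; simp at h0
    have h2 : (0 : WithTop ℚ) ≤ v (x : F)⁻¹ := by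
      rw [AddValuation.map_inv, h0]; simp
    refine IsUnit.of_mul_eq_one ⟨(x : F)⁻¹, h2⟩ ?_
    apply Subtype.ext
    simp [hne]
  · intro h hu
    obtain ⟨y, hy⟩ := isUnit_iff_exists_inv.1 hu
    have h1 := congrArg (fun t : VS v => v (t : F)) hy
    simp only [MulMemClass.coe_mul, OneMemClass.coe_one, AddValuation.map_mul, AddValuation.map_one] at h1
    have hy0 : 0 ≤ v (y : F) := y.2
    have := add_pos_of_pos_of_nonneg h hy0
    rw [h1] at this
    exact lt_irrefl _ this

variable {p : ℕ} [hpp : Fact p.Prime] [Algebra ℚ_[p] F]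

lemma perf [Algebra.IsAlgebraic ℚ_[p] F]
    (hv : ∀ y : F, y ≠ 0 → ∃ z : ℤ, v y = ((z : ℚ) : WithTop ℚ))
    (hvp : v (p : F) = 1) (hint : ∀ x : ℤ_[p], 0 ≤ v (algebraMap ℚ_[p] F x))
    (c : F) (hc : 0 ≤ v c) : ∃ d, 0 ≤ v d ∧ 1 ≤ v (c - d ^ p) := by
  let k := IsLocalRing.ResidueField (VS v)
  let res := IsLocalRing.residue (VS v)
  have hp0 : ((p : ℕ) : k) = 0 := by
    have : res (p : VS v) = 0 := by
      rw [res_zero]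
      have : ((p : VS v) : F) = p := by simp
      rw [this, hvp]; exact zero_lt_one
    simpa using this
  haveI : CharP k p := by
    have h1 : ringChar k ∣ p := ringChar.dvd hp0
    rcases (Nat.dvd_prime hpp.out).1 h1 with h | h
    · exact absurd h (CharP.ringChar_ne_one)
    · rw [← h]; exact ringChar.charP k
  letI : Algebra (ZMod p) k := ZMod.algebra k p
  let j : ℤ_[p] →+* VS v :=
    ((algebraMap ℚ_[p] F).comp (PadicInt.Coe.ringHom (p := p))).codRestrict (VS v).toSubring
      (fun x => hint x)
  have hj : ∀ x : ℤ_[p], ((j x : VS v) : F) = algebraMap ℚ_[p] F x := fun x => rfl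
  have hres : ∀ x : ℤ_[p], res (j x) = algebraMap (ZMod p) k (PadicInt.toZMod x) := by
    intro x
    obtain ⟨n, hn, hx⟩ := PadicInt.exists_mem_range x
    rw [PadicInt.maximalIdeal_eq_span_p, Ideal.mem_span_singleton] at hx
    obtain ⟨y, hy⟩ := hx
    have : x = n + p * y := by rw [← hy]; ring
    rw [this]
    simp only [map_add, map_mul, map_natCast]
    change (n : k) + (p : k) * _ = _
    rw [hp0]
    simp
  haveI : Algebra.IsAlgebraic (ZMod p) k := by
    constructor
    intro a
    obtain ⟨b, rfl⟩ := IsLocalRing.residue_surjective (R := VS v) a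
    obtain ⟨f, hf0, hf⟩ := Algebra.IsAlgebraic.isAlgebraic (R := ℚ_[p]) (b : F)
    obtain ⟨i, hi, hmax⟩ := f.support.exists_max_image (fun i => ‖f.coeff i‖)
      (Polynomial.nonempty_support_iff.2 hf0)
    have hi0 : f.coeff i ≠ 0 := Polynomial.mem_support_iff.1 hi
    have hle : ∀ m, ‖f.coeff m / f.coeff i‖ ≤ 1 := by
      intro m
      rw [norm_div]
      apply div_le_one_of_le₀ _ (norm_nonneg _)
      by_cases hm : m ∈ f.support
      · exact hmax m hm
      · rw [Polynomial.notMem_support_iff.1 hm]; simp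
    let g : ℕ → ℤ_[p] := fun m => ⟨f.coeff m / f.coeff i, hle m⟩
    refine ⟨∑ m ∈ f.support, Polynomial.monomial m (PadicInt.toZMod (g m)), ?_, ?_⟩
    · intro h0
      have h1 := congrArg (fun q => Polynomial.coeff q i) h0
      simp only [Polynomial.finsetSum_coeff, Polynomial.coeff_monomial, Polynomial.coeff_zero] at h1
      rw [Finset.sum_ite_eq' f.support i] at h1
      rw [if_pos hi] at h1
      have h2 : g i = 1 := by
        apply Subtype.ext
        simp [g, hi0]
      rw [h2, map_one] at h1
      exact one_ne_zero h1
    · simp only [map_sum, Polynomial.aeval_monomial]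
      have h3 : (∑ m ∈ f.support, j (g m) * b ^ m) = 0 := by
        apply Subtype.ext
        have : ((∑ m ∈ f.support, j (g m) * b ^ m : VS v) : F)
            = ∑ m ∈ f.support, algebraMap ℚ_[p] F (f.coeff m / f.coeff i) * (b : F) ^ m := by
          rw [AddSubmonoidClass.coe_finsetSum]
          rfl
        rw [this]
        rw [Polynomial.aeval_def, Polynomial.eval₂_eq_sum, Polynomial.sum_def] at hf
        have h5 : (∑ m ∈ f.support, algebraMap ℚ_[p] F (f.coeff m / f.coeff i) * (b : F) ^ m)
            = (algebraMap ℚ_[p] F (f.coeff i))⁻¹ *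
              ∑ m ∈ f.support, algebraMap ℚ_[p] F (f.coeff m) * (b : F) ^ m := by
          rw [Finset.mul_sum]
          refine Finset.sum_congr rfl fun m _ => ?_
          rw [map_div₀, div_eq_inv_mul, mul_assoc]
        rw [h5, hf, mul_zero]; rfl
      have h4 := congrArg res h3
      simp only [map_sum, map_mul, map_pow, map_zero, hres] at h4
      exact h4
  haveI : PerfectField k := Algebra.IsAlgebraic.perfectField (ZMod p)
  haveI : ExpChar k p := ExpChar.prime hpp.out
  obtain ⟨d', hd'⟩ := (PerfectRing.bijective_frobenius (R := k) (p := p)).2 (res ⟨c, hc⟩)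
  obtain ⟨d, rfl⟩ := IsLocalRing.residue_surjective (R := VS v) d'
  refine ⟨d, d.2, ?_⟩
  have h1 : res (⟨c, hc⟩ - d ^ p) = 0 := by
    rw [map_sub, map_pow, ← hd']; exact sub_self _
  rw [res_zero] at h1
  have h2 : ((⟨c, hc⟩ - d ^ p : VS v) : F) = c - (d : F) ^ p := rfl
  rw [h2] at h1
  by_cases h0 : c - (d : F) ^ p = 0
  · rw [h0]; simp
  obtain ⟨z, hz⟩ := hv _ h0
  rw [hz] at h1 ⊢
  have : (0 : ℚ) < z := by exact_mod_cast h1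
  have : 0 < z := by exact_mod_cast this
  have : (1 : ℚ) ≤ z := by exact_mod_cast this
  exact_mod_cast this
end
end ZpT

namespace ZpT
set_option linter.unusedSectionVars false
set_option linter.unusedSimpArgs false
set_option linter.style.haveILetI false
section
open Finset
variable {p : ℕ} [hpp : Fact p.Prime] {K M L : Type*} [Field K] [Field M] [Field L]
  [Algebra K M] [Algebra K L] [Algebra M L] [IsScalarTower K M L]
  {wM : AddValuation M (WithTop ℤ)} {wL : AddValuation L (WithTop ℤ)} {πM : M} {π : L}

lemma exists_coe {F : Type*} [Field F] {w : AddValuation F (WithTop ℤ)} {x : F} (hx : x ≠ 0) :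
    ∃ a : ℤ, w x = (a : WithTop ℤ) := by
  obtain ⟨a, ha⟩ := WithTop.ne_top_iff_exists.1 ((AddValuation.ne_top_iff w).2 hx)
  exact ⟨a, ha.symm⟩

lemma v_mul_le {F : Type*} [Field F] {w : AddValuation F (WithTop ℤ)} {x y : F} {t : WithTop ℤ}
    (hx : t ≤ w x) (hy : 0 ≤ w y) : t ≤ w (x * y) := by
  rw [AddValuation.map_mul]
  calc t = t + 0 := by simp
    _ ≤ _ := add_le_add hx hy

lemma v_sum_le {F : Type*} [Field F] {w : AddValuation F (WithTop ℤ)} {ι : Type*} (s : Finset ι)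
    (f : ι → F) {t : WithTop ℤ} (h : ∀ i ∈ s, t ≤ w (f i)) : t ≤ w (∑ i ∈ s, f i) := by
  classical
  induction s using Finset.induction_on with
  | empty => simp
  | insert a s ha ih =>
    rw [sum_insert ha]
    exact w.map_le_add (h a (by simp)) (ih fun i hi => h i (by simp [hi]))

lemma pow_cong {F : Type*} [Field F] {w : AddValuation F (WithTop ℤ)} {x y : F} {t : WithTop ℤ}
    (hx : 0 ≤ w x) (hy : 0 ≤ w y) (h : t ≤ w (x - y)) (b : ℕ) : t ≤ w (x ^ b - y ^ b) := by
  rw [← Commute.geom_sum₂_mul (Commute.all x y), mul_comm]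
  apply v_mul_le h
  apply v_sum_le
  intro i _
  rw [AddValuation.map_mul, AddValuation.map_pow, AddValuation.map_pow]
  exact add_nonneg (nsmul_nonneg hx _) (nsmul_nonneg hy _)

lemma step {n : ℕ} (hn : 1 ≤ n) (hodd : Odd p) (hL : RS p (n + 1) K L wL π) (hM : RS p n K M wM πM)
    (hc : ∀ (x : M) (a : ℤ), wM x = (a : WithTop ℤ) →
      wL (algebraMap M L x) = (((p : ℤ) * a : ℤ) : WithTop ℤ))
    (hperf : ∀ c : K, 0 ≤ wL (algebraMap K L c) →
      ∃ d : K, 0 ≤ wL (algebraMap K L d) ∧ wL (p : L) ≤ wL (algebraMap K L (c - d ^ p)))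
    (σ : L ≃ₐ[K] L) (hσ : σ ^ p ^ n ≠ 1) (N : M)
    (hN : algebraMap M L N = ∏ j ∈ range p, ((σ ^ p ^ n) ^ j) π) (πn : M)
    (hπn : wM πn = ((1 : ℤ) : WithTop ℤ)) :
    ∃ π' : L, wL π' = ((1 : ℤ) : WithTop ℤ) ∧ wL (p : L) ≤ wL (π' ^ p - algebraMap M L πn) := by
  have hp0 : 0 < p := hpp.out.pos
  have hpi0 := pi_ne hL
  have hwN : wL (algebraMap M L N) = ((p : ℤ) : WithTop ℤ) := by
    rw [hN]
    have : ∀ m : ℕ, wL (∏ j ∈ range m, ((σ ^ p ^ n) ^ j) π) = ((m : ℤ) : WithTop ℤ) := by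
      intro m
      induction m with
      | zero => simp
      | succ m ih =>
        rw [prod_range_succ, AddValuation.map_mul, ih, hL.hinv, hL.hpi, ← WithTop.coe_add]
        push_cast; rfl
    exact this p
  have hN0 : N ≠ 0 := by
    rintro rfl
    rw [map_zero, AddValuation.map_zero] at hwN
    exact WithTop.coe_ne_top hwN.symm
  have hMN : wM N = ((1 : ℤ) : WithTop ℤ) := by
    obtain ⟨a, ha⟩ := exists_coe (w := wM) hN0
    have h1 := hc _ _ ha
    rw [hwN, WithTop.coe_inj] at h1
    have : a = 1 := by
      have h2 : (p : ℤ) * 1 = p * a := by rw [mul_one]; exact h1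
      exact (mul_left_cancel₀ (by exact_mod_cast hp0.ne') h2).symm
    rw [ha, this]
  have hM' : RS p n K M wM N := ⟨hM.hK, hM.hfr, hM.hp, hMN, hM.hinv, hM.hord⟩
  obtain ⟨c, hc1, hc2⟩ := expand hM' (fun b => N ^ b) (wpow hM') πn
  have hpn0 : (0 : ℤ) < (p : ℤ) ^ n := by positivity
  have hcint : ∀ b ∈ range (p ^ n), 0 ≤ wL (algebraMap K L (c b)) := by
    intro b hb
    by_cases h0 : c b = 0
    · rw [h0]; simp
    have h1 := hc2 b (mem_range.1 hb)
    obtain ⟨a, ha⟩ := hM.hK _ h0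
    rw [hπn, AddValuation.map_mul, ha, wpow hM', ← WithTop.coe_add, WithTop.coe_le_coe] at h1
    rw [IsScalarTower.algebraMap_apply K M L, hc _ _ ha]
    have hb' : (b : ℤ) < (p : ℤ) ^ n := by exact_mod_cast mem_range.1 hb
    have ha0 : 0 ≤ a := by
      by_contra hlt
      have : a ≤ -1 := by omega
      nlinarith
    have : 0 ≤ (p : ℤ) * ((p : ℤ) ^ n * a) := by positivity
    exact_mod_cast this
  have hex : ∀ b, ∃ d : K, b ∈ range (p ^ n) → 0 ≤ wL (algebraMap K L d) ∧
      wL (p : L) ≤ wL (algebraMap K L (c b - d ^ p)) := by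
    intro b
    by_cases hb : b ∈ range (p ^ n)
    · obtain ⟨d, hd⟩ := hperf (c b) (hcint b hb)
      exact ⟨d, fun _ => hd⟩
    · exact ⟨0, fun h => absurd h hb⟩
  choose d hd using hex
  have hpiint : ∀ b : ℕ, 0 ≤ wL (π ^ b) := by
    intro b
    rw [wpow hL]
    exact_mod_cast Int.natCast_nonneg b
  have hNint : 0 ≤ wL (algebraMap M L N) := by
    rw [hwN]; exact_mod_cast Int.natCast_nonneg p
  have hNp : wL (p : L) ≤ wL (π ^ p - algebraMap M L N) := by
    have h1 := norm_cong hodd hL σ hσ π (by rw [hL.hpi]; exact_mod_cast zero_le_one)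
    rw [hL.hp, ← AddValuation.map_neg, neg_sub, hN]
    exact h1
  set π' : L := ∑ b ∈ range (p ^ n), algebraMap K L (d b) * π ^ b with hπ'
  have h1 : wL (p : L) ≤ wL (π' ^ p - ∑ b ∈ range (p ^ n), (algebraMap K L (d b) * π ^ b) ^ p) := by
    apply sum_pow_mod
    intro b hb
    exact v_mul_le (hd b hb).1 (hpiint b)
  have h2 : wL (p : L) ≤ wL (∑ b ∈ range (p ^ n), (algebraMap K L (d b) * π ^ b) ^ p
      - algebraMap M L πn) := by
    rw [hc1, map_sum, ← sum_sub_distrib]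
    apply v_sum_le
    intro b hb
    have : (algebraMap K L (d b) * π ^ b) ^ p - algebraMap M L (algebraMap K M (c b) * N ^ b)
        = ((π ^ p) ^ b - (algebraMap M L N) ^ b) * algebraMap K L (d b) ^ p
          + (-(algebraMap K L (c b - d b ^ p))) * (algebraMap M L N) ^ b := by
      rw [map_mul, map_pow, ← IsScalarTower.algebraMap_apply K M L, map_sub, map_pow]
      ring
    rw [this]
    apply wL.map_le_add
    · apply v_mul_le (pow_cong (hpiint p) hNint hNp b)
      rw [AddValuation.map_pow]; exact nsmul_nonneg (hd b hb).1 _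
    · apply v_mul_le
      · rw [AddValuation.map_neg]; exact (hd b hb).2
      · rw [AddValuation.map_pow]; exact nsmul_nonneg hNint _
  have h3 : wL (p : L) ≤ wL (π' ^ p - algebraMap M L πn) := by
    have := wL.map_le_add h1 h2
    rwa [sub_add_sub_cancel] at this
  refine ⟨π', ?_, h3⟩
  have h4 := hc _ _ hπn
  rw [mul_one] at h4
  have h5 : wL (π' ^ p) = ((p : ℤ) : WithTop ℤ) := by
    have h6 : wL (algebraMap M L πn) < wL (π' ^ p - algebraMap M L πn) := by
      refine lt_of_lt_of_le ?_ h3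
      rw [h4, hL.hp, WithTop.coe_lt_coe]
      have : p ^ 1 < p ^ (n + 1) := Nat.pow_lt_pow_right hpp.out.one_lt (by omega)
      rw [pow_one] at this
      exact_mod_cast this
    have := AddValuation.map_add_eq_of_lt_right wL h6
    rw [sub_add_cancel] at this
    rw [this, h4]
  have h7 : π' ≠ 0 := by
    intro h0
    rw [h0, zero_pow hp0.ne', AddValuation.map_zero] at h5
    exact WithTop.coe_ne_top h5.symm
  obtain ⟨a, ha⟩ := exists_coe (w := wL) h7
  rw [AddValuation.map_pow, ha, ← WithTop.coe_nsmul, WithTop.coe_inj, nsmul_eq_mul] at h5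
  have : a = 1 := by
    have h2 : (p : ℤ) * a = p * 1 := by rw [mul_one]; exact h5
    exact (mul_left_cancel₀ (by exact_mod_cast hp0.ne') h2)
  rw [ha, this]
end

section
open Finset
variable {p : ℕ} [hpp : Fact p.Prime] {K M L : Type*} [Field K] [Field M] [Field L]
  [Algebra K M] [Algebra K L] [Algebra M L] [IsScalarTower K M L]

lemma norm_mem {n : ℕ} [FiniteDimensional K L] [IsGalois K L] (σ : L ≃ₐ[K] L)
    (hgen : ∀ τ, τ ∈ Subgroup.zpowers σ) (hcard : Nat.card (L ≃ₐ[K] L) = p ^ (n + 1))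
    (hfM : Module.finrank K M = p ^ n) (x : L) :
    ∃ N : M, algebraMap M L N = ∏ j ∈ range p, ((σ ^ p ^ n) ^ j) x := by
  have hσ : orderOf σ = p ^ (n + 1) := by
    rw [← hcard]; exact orderOf_eq_card_of_forall_mem_zpowers hgen
  have hτ : (σ ^ p ^ n) ^ p = 1 := by
    rw [← pow_mul, ← pow_succ, ← hσ, pow_orderOf_eq_one]
  let E : IntermediateField K L := (IsScalarTower.toAlgHom K M L).fieldRange
  have hEM : Module.finrank K E = p ^ n := by
    rw [← hfM]
    exact (AlgEquiv.ofInjectiveField (IsScalarTower.toAlgHom K M L)).toLinearEquiv.finrank_eq.symm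
  have hEL : Module.finrank E L = p := by
    have h1 := Module.finrank_mul_finrank K E L
    rw [hEM, ← IsGalois.card_aut_eq_finrank K L, hcard, pow_succ] at h1
    exact Nat.eq_of_mul_eq_mul_left (pow_pos hpp.out.pos n) h1
  have hcardH : Nat.card E.fixingSubgroup = p := by
    rw [IsGalois.card_fixingSubgroup_eq_finrank, hEL]
  have hmem : ∀ g ∈ E.fixingSubgroup, ∃ i : ℕ, g = (σ ^ p ^ n) ^ i := by
    intro g hg
    have hgp : g ^ p = 1 := by
      have := pow_card_eq_one' (G := E.fixingSubgroup) (x := ⟨g, hg⟩)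
      rw [hcardH] at this
      exact congrArg Subtype.val this
    obtain ⟨k, hk⟩ := (mem_powers_iff_mem_zpowers.2 (hgen g))
    simp only at hk
    subst hk
    rw [← pow_mul, ← orderOf_dvd_iff_pow_eq_one, hσ, pow_succ] at hgp
    obtain ⟨i, hi⟩ := Nat.dvd_of_mul_dvd_mul_right hpp.out.pos hgp
    exact ⟨i, by rw [hi, pow_mul]⟩
  have hfix : ∏ j ∈ range p, ((σ ^ p ^ n) ^ j) x ∈ E := by
    rw [← IsGalois.fixedField_fixingSubgroup E, IntermediateField.mem_fixedField_iff]
    intro g hg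
    obtain ⟨i, rfl⟩ := hmem g hg
    set τ := σ ^ p ^ n
    have h1 : τ (∏ j ∈ range p, (τ ^ j) x) = ∏ j ∈ range p, (τ ^ j) x := by
      rw [map_prod]
      have : ∀ j, τ ((τ ^ j) x) = (τ ^ (j + 1)) x := by
        intro j; rw [pow_succ']; rfl
      simp only [this]
      have h2 := prod_range_succ (fun j => (τ ^ j) x) p
      rw [prod_range_succ', hτ, pow_zero] at h2
      by_cases hx : x = 0
      · subst hx; simp
      · exact mul_right_cancel₀ (by simpa using hx) h2
    clear hg
    induction i with
    | zero => simp
    | succ i ih =>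
      rw [pow_succ, AlgEquiv.mul_apply, h1]
      exact ih
  obtain ⟨N, hN⟩ := hfix
  exact ⟨N, hN⟩
end
end ZpT

namespace ZpT
set_option linter.unusedSectionVars false
set_option linter.unusedSimpArgs false
set_option linter.style.haveILetI false
section
variable (p : ℕ) [hpp : Fact p.Prime] (K L : Type*) [Field K] [Field L] [Algebra ℚ_[p] K]
  [Algebra K L]

structure LD (n : ℕ) (v : AddValuation L (WithTop ℚ)) : Prop where
  hvp : v (p : L) = 1
  hK : ∀ c : K, c ≠ 0 → ∃ z : ℤ, v (algebraMap K L c) = ((z : ℚ) : WithTop ℚ)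
  hint : ∀ x : ℤ_[p], 0 ≤ v (algebraMap K L (algebraMap ℚ_[p] K x))
  hx0 : ∃ x0 : L, v x0 = ((((p : ℚ) ^ n)⁻¹ : ℚ) : WithTop ℚ) ∧ ∀ y, 0 < v y → v x0 ≤ v y
  gal : IsGalois K L
  cyc : IsCyclic (L ≃ₐ[K] L)
  card : Nat.card (L ≃ₐ[K] L) = p ^ n

variable {p K L} {n : ℕ} {v : AddValuation L (WithTop ℚ)}

lemma LD.fin (h : LD p K L n v) : FiniteDimensional K L := by
  have := h.gal
  have h1 : Nat.card (L ≃ₐ[K] L) ≠ 0 := by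
    rw [h.card]; exact pow_ne_zero _ hpp.out.ne_zero
  have : Finite (L ≃ₐ[K] L) := Nat.finite_of_card_ne_zero h1
  exact IsGalois.finiteDimensional_of_finite K L

lemma LD.mk_w [FiniteDimensional ℚ_[p] K] (h : LD p K L n v) :
    ∃ w : AddValuation L (WithTop ℤ),
      (∀ (x : L) (a : ℤ), w x = (a : WithTop ℤ) ↔ v x = (((a : ℚ) / (p : ℚ) ^ n : ℚ) : WithTop ℚ)) ∧
      (∀ x y, w x ≤ w y ↔ v x ≤ v y) ∧
      ∀ π, v π = ((((p : ℚ) ^ n)⁻¹ : ℚ) : WithTop ℚ) → RS p n K L w π := by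
  have hq : (0 : ℚ) < (p : ℚ) ^ n := by have := hpp.out.pos; positivity
  obtain ⟨x0, hx0, hmin⟩ := h.hx0
  obtain ⟨w, hw⟩ := exists_w hq (valgrp hq hx0 hmin)
  have hmono : StrictMono (fun z : ℤ => (z : ℚ) / (p : ℚ) ^ n) := by
    intro a b hab
    simp only
    have : (a : ℚ) < b := by exact_mod_cast hab
    gcongr
  have hmt : StrictMono (WithTop.map (fun z : ℤ => (z : ℚ) / (p : ℚ) ^ n)) := hmono.withTop_map
  have h1 : ∀ (x : L) (a : ℤ), w x = (a : WithTop ℤ) ↔ v x = (((a : ℚ) / (p : ℚ) ^ n : ℚ) : WithTop ℚ) := by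
    intro x a
    rw [hw, ← hmt.injective.eq_iff, WithTop.map_coe]
  have h2 : ∀ x y, w x ≤ w y ↔ v x ≤ v y := by
    intro x y
    rw [hw, hw, hmt.le_iff_le]
  refine ⟨w, h1, h2, ?_⟩
  intro π hπ
  have := h.gal
  have := h.fin
  refine ⟨?_, ?_, ?_, ?_, ?_, ?_⟩
  · intro c hc
    obtain ⟨z, hz⟩ := h.hK c hc
    refine ⟨z, ?_⟩
    rw [h1, hz]
    congr 1
    push_cast
    field_simp
  · rw [← IsGalois.card_aut_eq_finrank, h.card]
  · rw [h1, h.hvp]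
    push_cast
    rw [div_self hq.ne']; rfl
  · rw [h1, hπ]; congr 1; push_cast; ring
  · intro σ x
    letI : Algebra ℚ_[p] L := ((algebraMap K L).comp (algebraMap ℚ_[p] K)).toAlgebra
    haveI : IsScalarTower ℚ_[p] K L := IsScalarTower.of_algebraMap_eq' rfl
    haveI : FiniteDimensional ℚ_[p] L := FiniteDimensional.trans ℚ_[p] K L
    have h3 := v_inv (v := v) h.hvp h.hint (σ.restrictScalars ℚ_[p]) x
    exact le_antisymm ((h2 _ _).2 h3.le) ((h2 _ _).2 h3.ge)
  · intro σ
    rw [← h.card]; exact pow_card_eq_one'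
end
section
variable {p : ℕ} [hpp : Fact p.Prime] {K M L : Type*} [Field K] [Field M] [Field L] [Algebra ℚ_[p] K]
  [FiniteDimensional ℚ_[p] K]
  [Algebra K M] [Algebra K L] [Algebra M L] [IsScalarTower K M L]
  {n : ℕ} {vM : AddValuation M (WithTop ℚ)} {vL : AddValuation L (WithTop ℚ)}

lemma bigstep (hodd : Odd p) (hM : LD p K M n vM) (hL : LD p K L (n + 1) vL)
    (hc : ∀ x, vL (algebraMap M L x) = vM x) (πn : M)
    (hπn : vM πn = ((((p : ℚ) ^ n)⁻¹ : ℚ) : WithTop ℚ)) :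
    ∃ π' : L, vL π' = ((((p : ℚ) ^ (n + 1))⁻¹ : ℚ) : WithTop ℚ) ∧
      1 ≤ vL (π' ^ p - algebraMap M L πn) := by
  obtain ⟨x0, hx0, -⟩ := hL.hx0
  have hpQ : (p : ℚ) ≠ 0 := by exact_mod_cast hpp.out.ne_zero
  rcases Nat.eq_zero_or_pos n with rfl | hn
  · refine ⟨x0, hx0, ?_⟩
    apply vL.map_le_sub
    · rw [AddValuation.map_pow, hx0, ← WithTop.coe_nsmul]
      simp [hpQ]
    · rw [hc, hπn]; simp
  obtain ⟨wM, hM1, hM2, hM3⟩ := hM.mk_w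
  obtain ⟨wL, hL1, hL2, hL3⟩ := hL.mk_w
  have rL := hL3 _ hx0
  have rM := hM3 _ hπn
  have := hL.gal
  have := hL.fin
  obtain ⟨σ, hσ⟩ := hL.cyc.exists_generator
  have hord : orderOf σ = p ^ (n + 1) := by
    rw [← hL.card]; exact orderOf_eq_card_of_forall_mem_zpowers hσ
  obtain ⟨N, hN⟩ := norm_mem (M := M) σ hσ hL.card rM.hfr x0
  obtain ⟨π', h1, h2⟩ := step hn hodd rL rM (by
      intro x a ha
      rw [hM1] at ha
      rw [hL1, hc, ha]
      congr 1
      push_cast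
      field_simp
      ring) (by
      intro c h0
      have hz : (0 : WithTop ℤ) = wL 1 := by simp
      have hzv : (0 : WithTop ℚ) = vL 1 := by simp
      rw [hz, hL2, ← hzv] at h0
      obtain ⟨d, hd1, hd2⟩ := perf (p := p) (F := K) (v := vL.comap (algebraMap K L))
        hL.hK (by change vL (algebraMap K L p) = 1; rw [map_natCast]; exact hL.hvp) hL.hint c h0
      refine ⟨d, ?_, ?_⟩
      · rw [hz, hL2, ← hzv]; exact hd1
      · rw [hL2, hL.hvp]; exact hd2) σ (by
      intro h0
      have := orderOf_dvd_of_pow_eq_one h0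
      rw [hord] at this
      have := (Nat.pow_dvd_pow_iff_le_right hpp.out.one_lt).1 this
      omega) N hN πn rM.hpi
  refine ⟨π', ?_, ?_⟩
  · rw [hL1] at h1
    rw [h1]; congr 1; push_cast; ring
  · rw [hL2, hL.hvp] at h2
    exact h2
end
end ZpT

section

/-- Theorem 3.1. Let `p` be an odd prime, `Ψ` an unramified (finite)
extension of `ℚ_p` with integer ring `O`, and `Ψ_∞/Ψ` a totally ramified
`ℤ_p`-extension with `n`-th layer `Ψ_n` and integer ring `R_n`.  Then there exists a
system of uniformizers `(π_n)_{n≥0}`, with `π_n` a uniformizer of `R_n`, such that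
`π_{n+1}^p ≡ π_n mod p·R_{n+1}` for all `n ≥ 0`. -/
theorem statement12 {p : ℕ} [Fact p.Prime] (hp : Odd p)
    {A : Type} [Field A] (vd : PadicValData A p)
    (Ψ Ψinf : Type) [Field Ψ] [Field Ψinf]
    [Algebra ℚ_[p] Ψ] [FiniteDimensional ℚ_[p] Ψ] [Algebra Ψ Ψinf]
    (emb : Ψinf →+* A)
    (hunram : IsUniformizer vd (emb.comp (algebraMap Ψ Ψinf)) (p : Ψ))
    (layer : ℕ → IntermediateField Ψ Ψinf)
    (htower : IsZpExtensionTower vd Ψ Ψinf emb layer) :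
    ∃ πs : (m : ℕ) → ↥(layer m),
      (∀ m : ℕ, IsUniformizer vd
        (emb.comp ((layer m).val : ↥(layer m) →+* Ψinf)) (πs m)) ∧
      (∀ m : ℕ, ∃ r : ↥(layer (m + 1)),
        0 ≤ vd.v ((emb.comp ((layer (m + 1)).val : ↥(layer (m + 1)) →+* Ψinf)) r) ∧
        ((emb.comp ((layer (m + 1)).val : ↥(layer (m + 1)) →+* Ψinf)) (πs (m + 1))) ^ p
            - (emb.comp ((layer m).val : ↥(layer m) →+* Ψinf)) (πs m)
          = (p : A) * (emb.comp ((layer (m + 1)).val : ↥(layer (m + 1)) →+* Ψinf)) r) := by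
  obtain ⟨h0, hle, -, hgal, hcyc, hcard, hunif⟩ := htower
  have hv1 : vd.v 1 = 0 := by
    have h1 := vd.v_mul 1 1
    rw [mul_one] at h1
    obtain ⟨a, ha⟩ := WithTop.ne_top_iff_exists.1
      (fun h => one_ne_zero ((vd.v_top_iff 1).1 h) : vd.v 1 ≠ ⊤)
    rw [← ha, ← WithTop.coe_add, WithTop.coe_inj] at h1
    have : a = 0 := by linarith
    rw [← ha, this]; rfl
  let vA : AddValuation A (WithTop ℚ) := AddValuation.of vd.v ((vd.v_top_iff 0).2 rfl) hv1
    vd.v_min_le_add vd.v_mul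
  have hvA : ∀ x, vA x = vd.v x := fun x => rfl
  let vK : AddValuation Ψ (WithTop ℚ) := vA.comap (emb.comp (algebraMap Ψ Ψinf))
  have hvK : ∀ x, vK x = vd.v (emb (algebraMap Ψ Ψinf x)) := fun x => rfl
  have hvKp : vK (p : Ψ) = 1 := by
    rw [hvK, map_natCast, map_natCast]; exact vd.v_coe_p
  have hKint : ∀ c : Ψ, c ≠ 0 → ∃ z : ℤ, vK c = ((z : ℚ) : WithTop ℚ) := by
    intro c hc
    obtain ⟨z, hz⟩ := ZpT.valgrp (v := vK) (q := 1) one_pos (x0 := (p : Ψ))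
      (by rw [hvKp]; simp) hunram.2.2 c hc
    exact ⟨z, by rw [hz]; simp⟩
  have hint := ZpT.v_padicInt (F := Ψ) (v := vK) hp hKint hvKp
  let vn : (n : ℕ) → AddValuation (layer n) (WithTop ℚ) := fun n =>
    vA.comap (emb.comp ((layer n).val : ↥(layer n) →+* Ψinf))
  have hvn : ∀ n x, vn n x = vd.v (emb (x : Ψinf)) := fun n x => rfl
  have hLD : ∀ n, ZpT.LD p Ψ (layer n) n (vn n) := by
    intro n
    refine ⟨?_, fun c hc => hKint c hc, fun x => hint x, ?_, hgal n, hcyc n, hcard n⟩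
    · have : (((p : layer n)) : Ψinf) = p := by simp
      rw [hvn, this, map_natCast]; exact vd.v_coe_p
    · obtain ⟨x, hx1, hx2⟩ := hunif n
      exact ⟨x, hx2, hx1.2.2⟩
  have hstep : ∀ n (x : layer n), vn n x = ((((p : ℚ) ^ n)⁻¹ : ℚ) : WithTop ℚ) →
      ∃ y : layer (n + 1), vn (n + 1) y = ((((p : ℚ) ^ (n + 1))⁻¹ : ℚ) : WithTop ℚ) ∧
        1 ≤ vd.v (emb (y : Ψinf) ^ p - emb (x : Ψinf)) := by
    intro n x hx
    letI : Algebra (layer n) (layer (n + 1)) :=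
      (IntermediateField.inclusion (hle n)).toRingHom.toAlgebra
    haveI : IsScalarTower Ψ (layer n) (layer (n + 1)) := IsScalarTower.of_algebraMap_eq' rfl
    obtain ⟨y, hy1, hy2⟩ := ZpT.bigstep hp (hLD n) (hLD (n + 1)) (fun _ => rfl) x hx
    refine ⟨y, hy1, ?_⟩
    have h2 : vn (n + 1) (y ^ p - algebraMap (layer n) (layer (n + 1)) x)
        = vd.v (emb (y : Ψinf) ^ p - emb (x : Ψinf)) := by
      rw [← map_pow, ← map_sub]; rfl
    rw [← h2]; exact hy2
  choose nxt hn1 hn2 using hstep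
  obtain ⟨x0, -, hx0⟩ := hunif 0
  let s : (n : ℕ) → {x : layer n // vn n x = ((((p : ℚ) ^ n)⁻¹ : ℚ) : WithTop ℚ)} := fun n =>
    Nat.rec (motive := fun n => {x : layer n // vn n x = ((((p : ℚ) ^ n)⁻¹ : ℚ) : WithTop ℚ)})
      ⟨x0, hx0⟩ (fun n x => ⟨nxt n x.1 x.2, hn1 n x.1 x.2⟩) n
  refine ⟨fun n => (s n).1, ?_, ?_⟩
  · intro m
    obtain ⟨x, hx1, hx2⟩ := hunif m
    have h1 : vn m (s m).1 = vn m x := (s m).2.trans hx2.symm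
    refine ⟨?_, ?_, ?_⟩
    · intro (h : (s m).1 = 0)
      have h2 := (s m).2
      rw [h, AddValuation.map_zero] at h2
      exact WithTop.coe_ne_top h2.symm
    · change 0 < vn m (s m).1
      rw [h1]; exact hx1.2.1
    · intro y hy
      change vn m (s m).1 ≤ _
      rw [h1]; exact hx1.2.2 y hy
  · intro m
    have h1 : 1 ≤ vd.v (emb ((s (m + 1)).1 : Ψinf) ^ p - emb ((s m).1 : Ψinf)) :=
      hn2 m (s m).1 (s m).2
    have hpA : (p : A) ≠ 0 := by
      intro h
      have h2 := vd.v_coe_p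
      rw [(vd.v_top_iff _).2 h] at h2
      exact absurd h2.symm (WithTop.coe_ne_top (a := (1 : ℚ)))
    let r : layer (m + 1) := (p : layer (m + 1))⁻¹ *
      ((s (m + 1)).1 ^ p - IntermediateField.inclusion (hle m) (s m).1)
    have hr : emb (r : Ψinf)
        = (p : A)⁻¹ * (emb ((s (m + 1)).1 : Ψinf) ^ p - emb ((s m).1 : Ψinf)) := by
      simp [r]
    have hr2 : emb ((s (m + 1)).1 : Ψinf) ^ p - emb ((s m).1 : Ψinf)
        = (p : A) * emb (r : Ψinf) := by
      rw [hr, mul_inv_cancel_left₀ hpA]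
    refine ⟨r, ?_, hr2⟩
    rw [hr2, vd.v_mul, vd.v_coe_p] at h1
    change 0 ≤ vd.v (emb (r : Ψinf))
    revert h1
    generalize vd.v (emb (r : Ψinf)) = t
    intro h1
    induction t with
    | top => simp
    | coe t =>
      have h3 : ((1 : ℚ) : WithTop ℚ) ≤ ((1 : ℚ) : WithTop ℚ) + (t : WithTop ℚ) := h1
      rw [← WithTop.coe_add, WithTop.coe_le_coe] at h3
      have : 0 ≤ t := by linarith
      exact_mod_cast this

end
end
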